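/- (Proposition 4, part 1.) Suppose Assumptions 1, 2 and 3 hold, X and Y are conditionally independent given Z, and Σ = E[u_1 u_1ᵀ] is invertible. Let p ≥ 1, J ≥ 1, fix locations (t_j)_{j=1}^J in 𝒳̈ × 𝒴, let (r_n) satisfy n^{(β+γ)/(2β)} = o(r_n), set every RLS regularization parameter to λ_{r_n} = r_n^{−1/(1+γ)}, and let (δ_n) be positive reals with δ_n → 0. Then √n·(Σ_{n,r_n} + δ_n·Id_J)^{−1/2} S̃_{n,r_n} converges in distribution, as n → ∞, to the standard multivariate Gaussian law N(0, Id_J) on ℝ^J. -/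

import Mathlib

open MeasureTheory ProbabilityTheory Filter Topology Asymptotics
open scoped RealInnerProductSpace

noncomputable section

namespace CIPaper

/-- A positive definite kernel. -/
def PosDefKernel {D : Type*} (k : D → D → ℝ) : Prop :=
  ∀ (n : ℕ) (x : Fin n → D) (c : Fin n → ℝ),
    0 ≤ ∑ i : Fin n, ∑ j : Fin n, c i * c j * k (x i) (x j)

/-- The mean embedding of `ν` with respect to the kernel `k`. -/
def meanEmbed {D : Type*} [MeasurableSpace D] (k : D → D → ℝ) (ν : Measure D) (t : D) : ℝ :=
  ∫ x, k x t ∂ν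

/-- A kernel is characteristic if the mean embedding is injective on probability measures. -/
def Characteristic {D : Type*} [MeasurableSpace D] (k : D → D → ℝ) : Prop :=
  ∀ P Q : Measure D, IsProbabilityMeasure P → IsProbabilityMeasure Q →
    (∀ t, meanEmbed k P t = meanEmbed k Q t) → P = Q

def BoundedKernel {D : Type*} (k : D → D → ℝ) : Prop := ∃ C, ∀ x y, |k x y| ≤ C

/-- Assumption 1 of the paper, for the tensor product kernel built from `kX` and `kY` :
the tensor kernel is positive definite, characteristic, bounded, continuous and analytic. -/
structure Assumption1 {DX DY : Type*} [MeasurableSpace DX] [MeasurableSpace DY]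
    [NormedAddCommGroup DX] [NormedSpace ℝ DX] [NormedAddCommGroup DY] [NormedSpace ℝ DY]
    (kX : DX → DX → ℝ) (kY : DY → DY → ℝ) : Prop where
  posdef : PosDefKernel fun p q : DX × DY => kX p.1 q.1 * kY p.2 q.2
  charac : Characteristic fun p q : DX × DY => kX p.1 q.1 * kY p.2 q.2
  bounded : BoundedKernel fun p q : DX × DY => kX p.1 q.1 * kY p.2 q.2
  continuous : Continuous fun pq : (DX × DY) × (DX × DY) => kX pq.1.1 pq.2.1 * kY pq.1.2 pq.2.2
  analytic : ∀ p : DX × DY, AnalyticOnNhd ℝ (fun q : DX × DY => kX p.1 q.1 * kY p.2 q.2) Set.univ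

/-- The random metric `d_{p,J}` between two measures, with locations `t`. -/
def dpJ {D : Type*} [MeasurableSpace D] (k : D → D → ℝ) (p : ℕ) {J : ℕ}
    (t : Fin J → D) (P Q : Measure D) : ℝ :=
  ((J : ℝ)⁻¹ * ∑ j : Fin J, |meanEmbed k P (t j) - meanEmbed k Q (t j)| ^ p) ^ ((p : ℝ)⁻¹)

/-- `P` is the measure `P_{Ẍ⊗Y|Z}` of the paper : a Borel probability measure with
`P(A×B) = E[E[1_A(Ẍ)|Z]·E[1_B(Y)|Z]]` for all measurable `A`, `B`. -/
def IsCondProdMeasure {Ω : Type*} [MeasurableSpace Ω] (μ : Measure Ω)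
    {DX DZ DY : Type*} [MeasurableSpace DX] [MeasurableSpace DZ] [MeasurableSpace DY]
    (X : Ω → DX) (Z : Ω → DZ) (Y : Ω → DY) (P : Measure ((DX × DZ) × DY)) : Prop :=
  IsProbabilityMeasure P ∧
    ∀ (A : Set (DX × DZ)) (B : Set DY), MeasurableSet A → MeasurableSet B →
      (P (A ×ˢ B)).toReal =
        ∫ ω, ((μ[fun ω' => A.indicator (fun _ => (1 : ℝ)) (X ω', Z ω') |
                MeasurableSpace.comap Z inferInstance]) ω)
            * ((μ[fun ω' => B.indicator (fun _ => (1 : ℝ)) (Y ω') |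
                MeasurableSpace.comap Z inferInstance]) ω) ∂μ

/-- The witness function `Δ`. -/
def witness {Ω : Type*} [MeasurableSpace Ω] (μ : Measure Ω)
    {DX DZ DY : Type*} [MeasurableSpace DZ]
    (kX : DX × DZ → DX × DZ → ℝ) (kY : DY → DY → ℝ)
    (X : Ω → DX) (Z : Ω → DZ) (Y : Ω → DY) (t1 : DX × DZ) (t2 : DY) : ℝ :=
  ∫ ω, (kX t1 (X ω, Z ω) -
          (μ[fun ω' => kX t1 (X ω', Z ω') | MeasurableSpace.comap Z inferInstance]) ω)
      * (kY t2 (Y ω) -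
          (μ[fun ω' => kY t2 (Y ω') | MeasurableSpace.comap Z inferInstance]) ω) ∂μ

/-- Cramér–Wold characterization: `ν` is the centered Gaussian measure on `ℝ^J` with
covariance matrix `S`. -/
def IsCenteredGaussian {J : ℕ} (S : Matrix (Fin J) (Fin J) ℝ) (ν : Measure (Fin J → ℝ)) : Prop :=
  IsProbabilityMeasure ν ∧
    ∀ a : Fin J → ℝ,
      ν.map (fun v => ∑ j, a j * v j) =
        gaussianReal 0 (Real.toNNReal (∑ i, ∑ j, a i * S i j * a j))

/-- Convergence in distribution (weak convergence of the image laws). -/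
def TendstoInDistribution {Ω : Type*} [MeasurableSpace Ω] (μ : Measure Ω) {E : Type*}
    [TopologicalSpace E] [MeasurableSpace E] (W : ℕ → Ω → E) (ν : Measure E) : Prop :=
  ∀ f : BoundedContinuousFunction E ℝ,
    Tendsto (fun n : ℕ => ∫ ω, f (W n ω) ∂μ) atTop (𝓝 (∫ x, f x ∂ν))

/-- The one-sample statistic `u_i(j)` of the paper (oracle version), where `e1`, `e2` are
the conditional mean functions. -/
def uStat {Ω DX DZ DY : Type*} (kX : DX × DZ → DX × DZ → ℝ) (kY : DY → DY → ℝ)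
    (e1 : DX × DZ → DZ → ℝ) (e2 : DY → DZ → ℝ)
    (xS : ℕ → Ω → DX) (zS : ℕ → Ω → DZ) (yS : ℕ → Ω → DY)
    {J : ℕ} (t : Fin J → (DX × DZ) × DY) (i : ℕ) (j : Fin J) (ω : Ω) : ℝ :=
  (kX (t j).1 (xS i ω, zS i ω) - e1 (t j).1 (zS i ω)) *
    (kY (t j).2 (yS i ω) - e2 (t j).2 (zS i ω))

/-- `S_n`, the empirical mean of the `u_i`. -/
def SStat {Ω DX DZ DY : Type*} (kX : DX × DZ → DX × DZ → ℝ) (kY : DY → DY → ℝ)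
    (e1 : DX × DZ → DZ → ℝ) (e2 : DY → DZ → ℝ)
    (xS : ℕ → Ω → DX) (zS : ℕ → Ω → DZ) (yS : ℕ → Ω → DY)
    {J : ℕ} (t : Fin J → (DX × DZ) × DY) (n : ℕ) (ω : Ω) : Fin J → ℝ :=
  fun j => (n : ℝ)⁻¹ * ∑ i ∈ Finset.range n, uStat kX kY e1 e2 xS zS yS t i j ω

/-- The covariance matrix `Σ = E[u₁ u₁ᵀ]`. -/
def covMat {Ω DX DZ DY : Type*} [MeasurableSpace Ω] (μ : Measure Ω)
    (kX : DX × DZ → DX × DZ → ℝ) (kY : DY → DY → ℝ)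
    (e1 : DX × DZ → DZ → ℝ) (e2 : DY → DZ → ℝ)
    (xS : ℕ → Ω → DX) (zS : ℕ → Ω → DZ) (yS : ℕ → Ω → DY)
    {J : ℕ} (t : Fin J → (DX × DZ) × DY) : Matrix (Fin J) (Fin J) ℝ :=
  Matrix.of fun j j' =>
    ∫ ω, uStat kX kY e1 e2 xS zS yS t 0 j ω * uStat kX kY e1 e2 xS zS yS t 0 j' ω ∂μ

/-- The empirical covariance matrix `Σ̂_n` of the oracle `u_i`. -/
def covHat {Ω DX DZ DY : Type*} (kX : DX × DZ → DX × DZ → ℝ) (kY : DY → DY → ℝ)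
    (e1 : DX × DZ → DZ → ℝ) (e2 : DY → DZ → ℝ)
    (xS : ℕ → Ω → DX) (zS : ℕ → Ω → DZ) (yS : ℕ → Ω → DY)
    {J : ℕ} (t : Fin J → (DX × DZ) × DY) (n : ℕ) (ω : Ω) : Matrix (Fin J) (Fin J) ℝ :=
  Matrix.of fun j j' => (n : ℝ)⁻¹ * ∑ i ∈ Finset.range n,
    uStat kX kY e1 e2 xS zS yS t i j ω * uStat kX kY e1 e2 xS zS yS t i j' ω

/-- The regularized least squares estimator built from the first `r` samples `zs` with
targets `target`, kernel `kZ` and regularization parameter `lam`. -/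
def rls {DZ : Type*} (kZ : DZ → DZ → ℝ) (zs : ℕ → DZ) (target : ℕ → ℝ)
    (r : ℕ) (lam : ℝ) (z : DZ) : ℝ :=
  ∑ i : Fin r,
    (((Matrix.of fun i l : Fin r => kZ (zs i) (zs l)) +
        ((r : ℝ) * lam) • (1 : Matrix (Fin r) (Fin r) ℝ))⁻¹.mulVec
      fun i : Fin r => target i) i * kZ (zs i) z

/-- The statistic `ũ_{i,r}(j)` built from the RLS estimators. -/
def uTildeStat {Ω DX DZ DY : Type*} (kX : DX × DZ → DX × DZ → ℝ) (kY : DY → DY → ℝ)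
    {J : ℕ} (kZ1 kZ2 : Fin J → DZ → DZ → ℝ)
    (xS : ℕ → Ω → DX) (zS : ℕ → Ω → DZ) (yS : ℕ → Ω → DY)
    (t : Fin J → (DX × DZ) × DY) (r : ℕ) (lam : ℝ) (i : ℕ) (j : Fin J) (ω : Ω) : ℝ :=
  (kX (t j).1 (xS i ω, zS i ω) -
      rls (kZ1 j) (fun l => zS l ω) (fun l => kX (t j).1 (xS l ω, zS l ω)) r lam (zS i ω)) *
    (kY (t j).2 (yS i ω) -
      rls (kZ2 j) (fun l => zS l ω) (fun l => kY (t j).2 (yS l ω)) r lam (zS i ω))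

/-- `S̃_{n,r}`. -/
def STilde {Ω DX DZ DY : Type*} (kX : DX × DZ → DX × DZ → ℝ) (kY : DY → DY → ℝ)
    {J : ℕ} (kZ1 kZ2 : Fin J → DZ → DZ → ℝ)
    (xS : ℕ → Ω → DX) (zS : ℕ → Ω → DZ) (yS : ℕ → Ω → DY)
    (t : Fin J → (DX × DZ) × DY) (n r : ℕ) (lam : ℝ) (ω : Ω) : Fin J → ℝ :=
  fun j => (n : ℝ)⁻¹ * ∑ i ∈ Finset.range n,
    uTildeStat kX kY kZ1 kZ2 xS zS yS t r lam i j ω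

/-- `Σ_{n,r}`, the empirical covariance matrix of the `ũ_{i,r}`. -/
def covTilde {Ω DX DZ DY : Type*} (kX : DX × DZ → DX × DZ → ℝ) (kY : DY → DY → ℝ)
    {J : ℕ} (kZ1 kZ2 : Fin J → DZ → DZ → ℝ)
    (xS : ℕ → Ω → DX) (zS : ℕ → Ω → DZ) (yS : ℕ → Ω → DY)
    (t : Fin J → (DX × DZ) × DY) (n r : ℕ) (lam : ℝ) (ω : Ω) : Matrix (Fin J) (Fin J) ℝ :=
  Matrix.of fun j j' => (n : ℝ)⁻¹ * ∑ i ∈ Finset.range n,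
    uTildeStat kX kY kZ1 kZ2 xS zS yS t r lam i j ω *
      uTildeStat kX kY kZ1 kZ2 xS zS yS t r lam i j' ω

open scoped Classical MatrixOrder in
/-- The inverse square root `M^{-1/2}` of a positive semidefinite matrix. -/
def invSqrtMat {J : ℕ} (M : Matrix (Fin J) (Fin J) ℝ) : Matrix (Fin J) (Fin J) ℝ :=
  if h : M.PosSemidef then (CFC.sqrt M)⁻¹ else 0

/-- The chi-square distribution with `J` degrees of freedom, realized as the law of the sum of
squares of `J` independent standard Gaussians. -/
def chiSq (J : ℕ) : Measure ℝ :=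
  (Measure.pi fun _ : Fin J => gaussianReal 0 1).map fun v => ∑ j, v j ^ 2

/-- Assumption 2 of the paper for the operator `L` on `L²(P_Z)` :
`Tr((L + λ)⁻¹ L) ≤ Q λ^{-γ}`, the trace of the positive operator being computed in any
Hilbert basis. -/
def TraceAssumption {DZ : Type*} [MeasurableSpace DZ] (PZ : Measure DZ)
    (L : Lp ℝ 2 PZ →L[ℝ] Lp ℝ 2 PZ) (Q γ : ℝ) : Prop :=
  ∀ lam : ℝ, 0 < lam → ∀ (ι : Type) (e : HilbertBasis ι ℝ (Lp ℝ 2 PZ)),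
    ∑' i, ⟪(Ring.inverse (L + lam • (1 : Lp ℝ 2 PZ →L[ℝ] Lp ℝ 2 PZ)) * L) (e i), e i⟫ ≤
      Q * lam ^ (-γ)

/-- `P = L^s` : `P` is self-adjoint and acts as `c ^ s` on every eigenvector of `L`
(this determines the fractional power, via functional calculus, of a positive self-adjoint
compact operator). -/
def IsFracPower {H : Type*} [NormedAddCommGroup H] [InnerProductSpace ℝ H]
    (L : H →L[ℝ] H) (s : ℝ) (P : H →L[ℝ] H) : Prop :=
  (∀ v w : H, ⟪P v, w⟫ = ⟪v, P w⟫) ∧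
    ∀ (c : ℝ) (v : H), L v = c • v → P v = c ^ s • v

end CIPaper

open CIPaper


/-! ### Part A : deterministic facts on the RLS smoother -/

/-- Coefficients of the linear smoother associated with RLS. -/
def acoef {D : Type*} (k : D → D → ℝ) (zs : ℕ → D) (r : ℕ) (lam : ℝ) (z : D) (l : ℕ) : ℝ :=
  if h : l < r then
    ∑ m : Fin r, ((Matrix.of fun i l : Fin r => k (zs i) (zs l)) +
        ((r : ℝ) * lam) • (1 : Matrix (Fin r) (Fin r) ℝ))⁻¹ m ⟨l, h⟩ * k (zs m) z
  else 0

lemma rls_eq_acoef {D : Type*} (k : D → D → ℝ) (zs : ℕ → D) (target : ℕ → ℝ) (r : ℕ) (lam : ℝ)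
    (z : D) :
    rls k zs target r lam z = ∑ l ∈ Finset.range r, acoef k zs r lam z l * target l := by
  unfold rls
  rw [Finset.sum_range]
  simp only [acoef, Fin.is_lt, dite_true, Fin.eta, Matrix.mulVec, dotProduct, Finset.sum_mul]
  rw [Finset.sum_comm]
  refine Finset.sum_congr rfl fun l _ => Finset.sum_congr rfl fun m _ => ?_
  ring

lemma gram_isUnit {H : Type*} [NormedAddCommGroup H] [InnerProductSpace ℝ H]
    {D : Type*} (k : D → D → ℝ) (zs : ℕ → D) (Φ : ℕ → H)
    (hΦ : ∀ i l, k (zs i) (zs l) = ⟪Φ i, Φ l⟫) (r : ℕ) (lam : ℝ) (hr : 1 ≤ r) (hlam : 0 < lam) :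
    IsUnit ((Matrix.of fun i l : Fin r => k (zs i) (zs l)) +
        ((r : ℝ) * lam) • (1 : Matrix (Fin r) (Fin r) ℝ)) := by
  have h1 : (Matrix.of fun i l : Fin r => k (zs i) (zs l)) = Matrix.gram ℝ (fun i : Fin r => Φ i) := by
    ext i l
    simp [Matrix.gram, hΦ]
  have h2 : ((Matrix.of fun i l : Fin r => k (zs i) (zs l)) +
        ((r : ℝ) * lam) • (1 : Matrix (Fin r) (Fin r) ℝ)).PosDef := by
    rw [h1]
    refine Matrix.PosDef.posSemidef_add (Matrix.posSemidef_gram ℝ _) ?_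
    exact Matrix.PosDef.one.smul (by positivity)
  exact h2.isUnit

lemma acoef_rep {H : Type*} [NormedAddCommGroup H] [InnerProductSpace ℝ H]
    {D : Type*} (k : D → D → ℝ) (zs : ℕ → D) (Φ : ℕ → H)
    (hΦ : ∀ i l, k (zs i) (zs l) = ⟪Φ i, Φ l⟫) (r : ℕ) (lam : ℝ) (hr : 1 ≤ r) (hlam : 0 < lam)
    (y : ℕ → ℝ) :
    ∃ q : H, (∀ i, ∑ l ∈ Finset.range r, acoef k zs r lam (zs i) l * y l = ⟪Φ i, q⟫) ∧
      ∀ h : H, (r : ℝ)⁻¹ * ∑ m ∈ Finset.range r, ⟪Φ m, q⟫ * ⟪Φ m, h⟫ + lam * ⟪q, h⟫ =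
        (r : ℝ)⁻¹ * ∑ m ∈ Finset.range r, y m * ⟪Φ m, h⟫ := by
  set M := ((Matrix.of fun i l : Fin r => k (zs i) (zs l)) +
        ((r : ℝ) * lam) • (1 : Matrix (Fin r) (Fin r) ℝ)) with hM
  have hU := gram_isUnit k zs Φ hΦ r lam hr hlam
  rw [← hM] at hU
  have hr0 : (r : ℝ) ≠ 0 := by positivity
  set α := M⁻¹.mulVec (fun i : Fin r => y i) with hα
  have hMα : M.mulVec α = fun i : Fin r => y i := by
    rw [hα, Matrix.mulVec_mulVec, Matrix.mul_nonsing_inv _ ((Matrix.isUnit_iff_isUnit_det _).1 hU),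
      Matrix.one_mulVec]
  set q : H := ∑ m : Fin r, α m • Φ m with hq
  have hin : ∀ h, ⟪q, h⟫ = ∑ m : Fin r, α m * ⟪Φ m, h⟫ := by
    intro h; rw [hq, sum_inner]; simp [real_inner_smul_left]
  have hq1 : ∀ i : Fin r, ⟪Φ i, q⟫ + r * lam * α i = y i := by
    intro i
    have := congrFun hMα i
    rw [← this, hM, Matrix.add_mulVec, Matrix.smul_mulVec, Matrix.one_mulVec, Pi.add_apply,
      real_inner_comm, hin]
    simp only [Matrix.mulVec, dotProduct, Matrix.of_apply, Pi.smul_apply, smul_eq_mul, hΦ]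
    congr 1
    refine Finset.sum_congr rfl fun m _ => ?_
    rw [real_inner_comm]; ring
  refine ⟨q, ?_, ?_⟩
  · intro i
    rw [← rls_eq_acoef, real_inner_comm, hin]
    unfold rls
    exact Finset.sum_congr rfl fun m _ => by rw [hΦ]
  · intro h
    rw [hin, Finset.sum_range, Finset.sum_range, Finset.mul_sum, Finset.mul_sum, Finset.mul_sum,
      ← Finset.sum_add_distrib]
    refine Finset.sum_congr rfl fun m _ => ?_
    rw [← hq1 m]
    field_simp

/-- The deterministic bounds on the smoother. `cr h` is the quadratic form of the regularized
empirical covariance operator. -/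
lemma smoother_bounds {H : Type*} [NormedAddCommGroup H] [InnerProductSpace ℝ H]
    {D : Type*} (k : D → D → ℝ) (zs : ℕ → D) (Φ : ℕ → H)
    (hΦ : ∀ i l, k (zs i) (zs l) = ⟪Φ i, Φ l⟫) (n r : ℕ) (lam : ℝ) (hr : 1 ≤ r) (hlam : 0 < lam)
    (K κ : ℝ) (hK : 0 ≤ K) (hκ : ∀ i, ‖Φ i‖ ^ 2 ≤ κ)
    (cr : H → ℝ)
    (hcr : ∀ h, cr h = (r : ℝ)⁻¹ * ∑ m ∈ Finset.range r, ⟪Φ m, h⟫ ^ 2 + lam * ‖h‖ ^ 2)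
    (hE2 : ∀ h, ∑ i ∈ Finset.range n, ⟪Φ i, h⟫ ^ 2 ≤ n * K * cr h)
    (w : H) (Nw : ℝ) (hw : ∀ h, 2 * ⟪w, h⟫ ≤ K * Nw + cr h)
    (N : ℕ → ℝ) (hN : ∀ l < r, ∀ h, 2 * ⟪Φ l, h⟫ ≤ K * N l + cr h)
    (f : D → ℝ) (hf : ∀ i, f (zs i) = ⟪w, Φ i⟫) :
    (∑ i ∈ Finset.range n,
      (∑ l ∈ Finset.range r, acoef k zs r lam (zs i) l * f (zs l) - f (zs i)) ^ 2
        ≤ n * K ^ 2 * lam ^ 2 * Nw) ∧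
    (∑ i ∈ Finset.range n, ∑ l ∈ Finset.range r, acoef k zs r lam (zs i) l ^ 2
        ≤ n * K ^ 2 / (r : ℝ) ^ 2 * ∑ l ∈ Finset.range r, N l) ∧
    (∀ b : ℕ → ℝ, ∑ l ∈ Finset.range r, (∑ i ∈ Finset.range n, acoef k zs r lam (zs i) l * b i) ^ 2
        ≤ n * K / r * ∑ i ∈ Finset.range n, b i ^ 2) ∧
    (∀ i, ∑ l ∈ Finset.range r, acoef k zs r lam (zs i) l ^ 2 ≤ κ / (r * lam)) ∧
    (∀ i, (∑ l ∈ Finset.range r, acoef k zs r lam (zs i) l * f (zs l) - f (zs i)) ^ 2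
        ≤ κ * ‖w‖ ^ 2) := by
  have hr0 : (0 : ℝ) < r := by positivity
  have hri : (0 : ℝ) < (r : ℝ)⁻¹ := by positivity
  have hκ0 : 0 ≤ κ := (sq_nonneg _).trans (hκ 0)
  have hcr0 : ∀ h, 0 ≤ cr h := fun h => by rw [hcr]; positivity
  have hcrn : ∀ h, lam * ‖h‖ ^ 2 ≤ cr h := fun h => by
    rw [hcr]
    have : 0 ≤ (r : ℝ)⁻¹ * ∑ m ∈ Finset.range r, ⟪Φ m, h⟫ ^ 2 := by positivity
    linarith
  -- the general representation
  have hrep := acoef_rep k zs Φ hΦ r lam hr hlam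
  -- bias
  obtain ⟨q, hq1, hq2⟩ := hrep (fun m => ⟪Φ m, w⟫)
  have hGu : ∀ h, (r : ℝ)⁻¹ * ∑ m ∈ Finset.range r, ⟪Φ m, lam⁻¹ • (w - q)⟫ * ⟪Φ m, h⟫ +
      lam * ⟪lam⁻¹ • (w - q), h⟫ = ⟪w, h⟫ := by
    intro h
    have := hq2 h
    simp only [inner_smul_right, inner_sub_right, real_inner_smul_left, inner_sub_left]
    have e1 : ∑ m ∈ Finset.range r, lam⁻¹ * (⟪Φ m, w⟫ - ⟪Φ m, q⟫) * ⟪Φ m, h⟫ =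
       lam⁻¹ * (∑ m ∈ Finset.range r, ⟪Φ m, w⟫ * ⟪Φ m, h⟫ -
        ∑ m ∈ Finset.range r, ⟪Φ m, q⟫ * ⟪Φ m, h⟫) := by
      rw [← Finset.sum_sub_distrib, Finset.mul_sum]
      exact Finset.sum_congr rfl fun m _ => by ring
    rw [e1]
    have e2 : lam * (lam⁻¹ * (⟪w, h⟫ - ⟪q, h⟫)) = ⟪w, h⟫ - ⟪q, h⟫ := by field_simp
    rw [e2, mul_left_comm, mul_sub]
    have e3 : (r : ℝ)⁻¹ * ∑ m ∈ Finset.range r, ⟪Φ m, w⟫ * ⟪Φ m, h⟫ -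
      (r : ℝ)⁻¹ * ∑ m ∈ Finset.range r, ⟪Φ m, q⟫ * ⟪Φ m, h⟫ = lam * ⟪q, h⟫ := by linarith
    rw [e3]
    field_simp
    ring
  set u := lam⁻¹ • (w - q) with hu
  have hcu : cr u = ⟪w, u⟫ := by
    rw [hcr, ← hGu u, real_inner_self_eq_norm_sq]
    simp only [pow_two]
  have hcuN : cr u ≤ K * Nw := by have := hw u; linarith
  have ha : ∀ i, ∑ l ∈ Finset.range r, acoef k zs r lam (zs i) l * f (zs l) - f (zs i) =
      - lam * ⟪Φ i, u⟫ := by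
    intro i
    have h1 := hq1 i
    have h2 : ∑ l ∈ Finset.range r, acoef k zs r lam (zs i) l * f (zs l) = ⟪Φ i, q⟫ := by
      rw [← h1]
      exact Finset.sum_congr rfl fun l _ => by rw [hf, real_inner_comm]
    rw [h2, hf, hu, inner_smul_right, inner_sub_right, real_inner_comm (Φ i) w]
    field_simp
    ring
  -- operator norm type bound
  have hop : ∀ (y : ℕ → ℝ) (q : H), (∀ h : H, (r : ℝ)⁻¹ * ∑ m ∈ Finset.range r, ⟪Φ m, q⟫ * ⟪Φ m, h⟫
      + lam * ⟪q, h⟫ = (r : ℝ)⁻¹ * ∑ m ∈ Finset.range r, y m * ⟪Φ m, h⟫) →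
      cr q ≤ (r : ℝ)⁻¹ * ∑ m ∈ Finset.range r, y m ^ 2 := by
    intro y q h
    have h1 : cr q = (r : ℝ)⁻¹ * ∑ m ∈ Finset.range r, y m * ⟪Φ m, q⟫ := by
      rw [hcr, ← h q, real_inner_self_eq_norm_sq]; simp only [pow_two]
    have h2 : 2 * ∑ m ∈ Finset.range r, y m * ⟪Φ m, q⟫ ≤ ∑ m ∈ Finset.range r, y m ^ 2 +
        ∑ m ∈ Finset.range r, ⟪Φ m, q⟫ ^ 2 := by
      rw [Finset.mul_sum, ← Finset.sum_add_distrib]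
      exact Finset.sum_le_sum fun m _ => by nlinarith [sq_nonneg (y m - ⟪Φ m, q⟫)]
    have h3 : (r : ℝ)⁻¹ * ∑ m ∈ Finset.range r, ⟪Φ m, q⟫ ^ 2 ≤ cr q := by
      rw [hcr]; have : 0 ≤ lam * ‖q‖ ^ 2 := by positivity
      linarith
    have h4 := mul_le_mul_of_nonneg_left h2 hri.le
    rw [mul_add] at h4
    linarith
  have hop2 : ∀ y : ℕ → ℝ, ∑ i ∈ Finset.range n,
      (∑ l ∈ Finset.range r, acoef k zs r lam (zs i) l * y l) ^ 2 ≤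
      n * K / r * ∑ m ∈ Finset.range r, y m ^ 2 := by
    intro y
    obtain ⟨q, h1, h2⟩ := hrep y
    simp only [h1]
    refine (hE2 q).trans ?_
    have := mul_le_mul_of_nonneg_left (hop y q h2) (show 0 ≤ n * K by positivity)
    refine this.trans (le_of_eq ?_)
    field_simp
  refine ⟨?_, ?_, ?_, ?_, ?_⟩
  · simp only [ha]
    have : ∑ i ∈ Finset.range n, (-lam * ⟪Φ i, u⟫) ^ 2 =
        lam ^ 2 * ∑ i ∈ Finset.range n, ⟪Φ i, u⟫ ^ 2 := by
      rw [Finset.mul_sum]; exact Finset.sum_congr rfl fun i _ => by ring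
    rw [this]
    calc lam ^ 2 * ∑ i ∈ Finset.range n, ⟪Φ i, u⟫ ^ 2 ≤ lam ^ 2 * (n * K * (K * Nw)) := by
          gcongr
          exact (hE2 u).trans (by gcongr)
      _ = _ := by ring
  · rw [Finset.sum_comm, Finset.mul_sum]
    refine Finset.sum_le_sum fun l hl => ?_
    have hl' := Finset.mem_range.1 hl
    obtain ⟨q, h1, h2⟩ := hrep (fun m => if m = l then 1 else 0)
    simp only [mul_ite, mul_one, mul_zero, ite_mul, one_mul, zero_mul, Finset.sum_ite_eq', hl,
      if_true] at h1 h2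
    simp only [h1]
    refine (hE2 q).trans ?_
    have h3 : cr q = (r : ℝ)⁻¹ * ⟪Φ l, q⟫ := by
      rw [hcr, ← h2 q, real_inner_self_eq_norm_sq]; simp only [pow_two]
    have h4 := hN l hl' ((r : ℝ) • q)
    have h5 : cr ((r : ℝ) • q) = r ^ 2 * cr q := by
      rw [hcr, hcr]
      simp only [inner_smul_right, norm_smul, mul_pow, ← Finset.mul_sum]
      simp; ring
    rw [h5, inner_smul_right] at h4
    have h6 : (r : ℝ) * ⟪Φ l, q⟫ = r ^ 2 * cr q := by rw [h3]; field_simp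
    rw [h6] at h4
    have h7 : (r : ℝ) ^ 2 * cr q ≤ K * N l := by linarith
    have h8 : cr q ≤ K * N l / (r : ℝ) ^ 2 := by
      rw [le_div_iff₀ (by positivity)]; linarith
    calc (n : ℝ) * K * cr q ≤ n * K * (K * N l / (r : ℝ) ^ 2) := by gcongr
      _ = _ := by ring
  · intro b
    set s : ℕ → ℝ := fun l => ∑ i ∈ Finset.range n, acoef k zs r lam (zs i) l * b i with hs
    have h1 := hop2 s
    set B := ∑ i ∈ Finset.range n, b i ^ 2
    set T := ∑ l ∈ Finset.range r, s l ^ 2 with hT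
    have h2 : T = ∑ i ∈ Finset.range n, b i *
        (∑ l ∈ Finset.range r, acoef k zs r lam (zs i) l * s l) := by
      rw [hT]
      simp only [Finset.mul_sum]
      rw [Finset.sum_comm]
      refine Finset.sum_congr rfl fun l _ => ?_
      rw [pow_two]
      nth_rw 1 [hs]
      simp only [Finset.sum_mul]
      exact Finset.sum_congr rfl fun i _ => by ring
    have h3 : T ^ 2 ≤ B * (n * K / r * T) := by
      rw [h2]
      refine (Finset.sum_mul_sq_le_sq_mul_sq _ _ _).trans ?_
      rw [← h2]
      have : 0 ≤ B := by positivity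
      gcongr
    have hT0 : 0 ≤ T := by positivity
    rcases hT0.eq_or_lt with h | h
    · rw [← h]; positivity
    · have : T * T ≤ (n * K / r * B) * T := by rw [← pow_two]; linarith
      exact le_of_mul_le_mul_right this h
  · intro i
    set y : ℕ → ℝ := fun l => acoef k zs r lam (zs i) l with hy
    obtain ⟨q, h1, h2⟩ := hrep y
    set S := ∑ l ∈ Finset.range r, y l ^ 2 with hS
    have h3 : S = ⟪Φ i, q⟫ := by
      rw [← h1 i, hS]; exact Finset.sum_congr rfl fun l _ => by rw [pow_two]
    have h4 := (hcrn q).trans (hop y q h2)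
    have h5 : S ^ 2 ≤ κ * ‖q‖ ^ 2 := by
      rw [h3]
      have := abs_real_inner_le_norm (Φ i) q
      calc ⟪Φ i, q⟫ ^ 2 = |⟪Φ i, q⟫| ^ 2 := (sq_abs _).symm
        _ ≤ (‖Φ i‖ * ‖q‖) ^ 2 := by gcongr
        _ = ‖Φ i‖ ^ 2 * ‖q‖ ^ 2 := by ring
        _ ≤ _ := by gcongr; exact hκ i
    have hS0 : 0 ≤ S := by positivity
    have h6 : ‖q‖ ^ 2 ≤ S / (r * lam) := by
      rw [le_div_iff₀ (by positivity)]
      have := mul_le_mul_of_nonneg_left h4 hr0.le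
      rw [← mul_assoc, ← mul_assoc, mul_inv_cancel₀ hr0.ne', one_mul] at this
      linarith
    rcases hS0.eq_or_lt with h | h
    · change S ≤ _
      rw [← h]; positivity
    · have : S * S ≤ (κ / (r * lam)) * S := by
        rw [← pow_two]
        refine h5.trans ?_
        calc κ * ‖q‖ ^ 2 ≤ κ * (S / (r * lam)) := by gcongr
          _ = _ := by ring
      exact le_of_mul_le_mul_right this h
  · intro i
    rw [ha]
    have h1 : lam * ‖u‖ ^ 2 ≤ ‖w‖ * ‖u‖ := by
      refine (hcrn u).trans ?_
      rw [hcu]; exact real_inner_le_norm _ _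
    have h2 : lam * ‖u‖ ≤ ‖w‖ := by
      rcases (norm_nonneg u).eq_or_lt with h | h
      · rw [← h]; simp
      · refine le_of_mul_le_mul_right ?_ h
        rw [mul_assoc, ← pow_two]; exact h1
    have := abs_real_inner_le_norm (Φ i) u
    calc (-lam * ⟪Φ i, u⟫) ^ 2 = lam ^ 2 * |⟪Φ i, u⟫| ^ 2 := by rw [sq_abs]; ring
      _ ≤ lam ^ 2 * (‖Φ i‖ * ‖u‖) ^ 2 := by gcongr
      _ = ‖Φ i‖ ^ 2 * (lam * ‖u‖) ^ 2 := by ring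
      _ ≤ κ * ‖w‖ ^ 2 := by gcongr; exact hκ i

/-! ### Part B : concentration of the empirical covariance operator -/

lemma hb_hasSum_sq {ι H : Type*} [NormedAddCommGroup H] [InnerProductSpace ℝ H]
    (b : HilbertBasis ι ℝ H) (h : H) : HasSum (fun i => ⟪b i, h⟫ ^ 2) (‖h‖ ^ 2) := by
  have := b.hasSum_inner_mul_inner h h
  rw [real_inner_self_eq_norm_sq] at this
  have e : (fun i => ⟪b i, h⟫ ^ 2) = fun i => ⟪h, b i⟫ * ⟪b i, h⟫ := by
    ext i; rw [real_inner_comm h, pow_two]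
  rw [e]; exact this

/-- The deviation matrix, in the basis `b`. -/
def devMat {D ι H : Type*} [NormedAddCommGroup H] [InnerProductSpace ℝ H]
    (b : HilbertBasis ι ℝ H) (Ψ : D → H) [DecidableEq ι] (σ : ι → ℝ) (N : ℕ) (zs : ℕ → D)
    (i j : ι) : ℝ :=
  (N : ℝ)⁻¹ * ∑ l ∈ Finset.range N, ⟪b i, Ψ (zs l)⟫ * ⟪b j, Ψ (zs l)⟫ - if i = j then σ i else 0

lemma devMat_integral_le {Ω D ι H : Type*} [MeasurableSpace Ω] [MeasurableSpace D]
    [NormedAddCommGroup H] [InnerProductSpace ℝ H]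
    (μ : Measure Ω) [IsProbabilityMeasure μ] (P : Measure D) [IsProbabilityMeasure P]
    (zS : ℕ → Ω → D) (hz : ∀ i, Measurable (zS i)) (hind : iIndepFun zS μ)
    (hlaw : ∀ i, μ.map (zS i) = P)
    (b : HilbertBasis ι ℝ H) (Ψ : D → H) [DecidableEq ι] (σ : ι → ℝ)
    (hmeas : ∀ i, Measurable fun z => ⟪b i, Ψ z⟫) (κ : ℝ) (hκ : ∀ z, ‖Ψ z‖ ^ 2 ≤ κ)
    (hσ : ∀ i j, ∫ z, ⟪b i, Ψ z⟫ * ⟪b j, Ψ z⟫ ∂P = if i = j then σ i else 0)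
    (N : ℕ) (hN : 1 ≤ N) (i j : ι) :
    Measurable (fun ω => devMat b Ψ σ N (fun l => zS l ω) i j) ∧
    ∫⁻ ω, ENNReal.ofReal (devMat b Ψ σ N (fun l => zS l ω) i j ^ 2) ∂μ ≤
      ENNReal.ofReal ((N : ℝ)⁻¹) *
        ∫⁻ z, ENNReal.ofReal ((⟪b i, Ψ z⟫ * ⟪b j, Ψ z⟫) ^ 2) ∂P := by
  set g : D → ℝ := fun z => ⟪b i, Ψ z⟫ * ⟪b j, Ψ z⟫ with hg
  have hgm : Measurable g := (hmeas i).mul (hmeas j)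
  have hcoord : ∀ i z, |⟪b i, Ψ z⟫| ≤ ‖Ψ z‖ := by
    intro i z
    have := abs_real_inner_le_norm (b i) (Ψ z)
    rwa [b.orthonormal.1 i, one_mul] at this
  have hgb : ∀ z, |g z| ≤ κ := by
    intro z
    refine le_trans ?_ (hκ z)
    rw [hg, pow_two]; simp only [abs_mul]
    gcongr <;> exact hcoord _ _
  have hN0 : (N : ℝ) ≠ 0 := by positivity
  have hmem : ∀ l, MemLp (fun ω => g (zS l ω)) 2 μ := fun l =>
    MemLp.of_bound (hgm.comp (hz l)).aestronglyMeasurable κ (ae_of_all _ fun ω => by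
      simpa using hgb _)
  have hmeasD : Measurable (fun ω => devMat b Ψ σ N (fun l => zS l ω) i j) := by
    unfold devMat
    refine (Measurable.const_mul ?_ _).sub_const _
    exact Finset.measurable_fun_sum _ fun l _ => hgm.comp (hz l)
  refine ⟨hmeasD, ?_⟩
  have hmean : ∀ l, ∫ ω, g (zS l ω) ∂μ = if i = j then σ i else 0 := by
    intro l
    rw [← hσ i j, ← hlaw l, integral_map (hz l).aemeasurable hgm.aestronglyMeasurable]
  have hvarle : ∀ l, Var[fun ω => g (zS l ω); μ] ≤ ∫ z, g z ^ 2 ∂P := by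
    intro l
    refine (variance_le_expectation_sq (hgm.comp (hz l)).aestronglyMeasurable).trans ?_
    rw [← hlaw l, integral_map (hz l).aemeasurable (hgm.pow_const 2).aestronglyMeasurable]
    exact le_of_eq rfl
  set X : ℕ → Ω → ℝ := fun l ω => g (zS l ω) with hX
  have hXind : iIndepFun X μ := hind.comp (fun _ => g) (fun _ => hgm)
  have hvar : Var[∑ l ∈ Finset.range N, X l; μ] = ∑ l ∈ Finset.range N, Var[X l; μ] :=
    IndepFun.variance_sum (fun l _ => hmem l) (fun a _ c _ hac => hXind.indepFun hac)
  have hsum : Var[fun ω => devMat b Ψ σ N (fun l => zS l ω) i j; μ] ≤ (N : ℝ)⁻¹ * ∫ z, g z ^ 2 ∂P := by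
    have e : (fun ω => devMat b Ψ σ N (fun l => zS l ω) i j) =
        fun ω => ((N : ℝ)⁻¹ • (∑ l ∈ Finset.range N, X l)) ω - (if i = j then σ i else 0) := by
      ext ω
      simp [devMat, hX, hg, Finset.sum_apply]
    rw [e, variance_sub_const (Measurable.aestronglyMeasurable (by
      refine Measurable.const_smul ?_ _
      have e2 : (∑ l ∈ Finset.range N, X l) = fun ω => ∑ l ∈ Finset.range N, X l ω := by
        ext ω; simp
      rw [e2]
      exact Finset.measurable_fun_sum _ fun l _ => hgm.comp (hz l))), variance_smul, hvar]
    calc ((N : ℝ)⁻¹) ^ 2 * ∑ l ∈ Finset.range N, Var[X l; μ]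
        ≤ ((N : ℝ)⁻¹) ^ 2 * ∑ l ∈ Finset.range N, ∫ z, g z ^ 2 ∂P := by
          gcongr with l _; exact hvarle l
      _ = _ := by simp; field_simp
  have hbd : ∀ ω, |devMat b Ψ σ N (fun l => zS l ω) i j| ≤ κ + |if i = j then σ i else 0| := by
    intro ω
    unfold devMat
    refine (abs_sub _ _).trans ?_
    gcongr
    rw [abs_mul, abs_of_nonneg (by positivity)]
    calc (N : ℝ)⁻¹ * |∑ l ∈ Finset.range N, ⟪b i, Ψ (zS l ω)⟫ * ⟪b j, Ψ (zS l ω)⟫|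
        ≤ (N : ℝ)⁻¹ * ∑ l ∈ Finset.range N, κ := by
          gcongr
          exact (Finset.abs_sum_le_sum_abs _ _).trans (Finset.sum_le_sum fun l _ => hgb _)
      _ = κ := by simp; field_simp
  have hDmem : MemLp (fun ω => devMat b Ψ σ N (fun l => zS l ω) i j) 2 μ :=
    MemLp.of_bound hmeasD.aestronglyMeasurable _ (ae_of_all _ fun ω => by simpa using hbd ω)
  have hDmean : ∫ ω, devMat b Ψ σ N (fun l => zS l ω) i j ∂μ = 0 := by
    unfold devMat
    rw [integral_sub, integral_const_mul, integral_finsetSum]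
    · have : ∀ l ∈ Finset.range N, ∫ ω, ⟪b i, Ψ (zS l ω)⟫ * ⟪b j, Ψ (zS l ω)⟫ ∂μ =
          if i = j then σ i else 0 := fun l _ => hmean l
      rw [Finset.sum_congr rfl this]
      simp
      field_simp
      split_ifs with h
      · rw [h, sub_self]
      · rw [sub_self]
    · intro l _; exact (hmem l).integrable (by norm_num)
    · exact Integrable.const_mul (integrable_finsetSum _ fun l _ => (hmem l).integrable (by norm_num)) _
    · exact integrable_const _
  have hg2 : Integrable (fun z => g z ^ 2) P :=
    (MemLp.of_bound (p := 2) hgm.aestronglyMeasurable κ (ae_of_all _ fun z => by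
      simpa using hgb z)).integrable_sq
  rw [← ofReal_integral_eq_lintegral_ofReal hDmem.integrable_sq (ae_of_all _ fun ω => sq_nonneg _),
    ← ofReal_integral_eq_lintegral_ofReal hg2 (ae_of_all _ fun ω => sq_nonneg _),
    ← ENNReal.ofReal_mul (by positivity)]
  refine ENNReal.ofReal_le_ofReal ?_
  rw [variance_of_integral_eq_zero hmeasD.aemeasurable hDmean] at hsum
  exact hsum

/-- Hilbert--Schmidt deviation. -/
def devHS {D ι H : Type*} [NormedAddCommGroup H] [InnerProductSpace ℝ H]
    (b : HilbertBasis ι ℝ H) (Ψ : D → H) [DecidableEq ι] (σ : ι → ℝ) (s : ℝ) (N : ℕ)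
    (zs : ℕ → D) : ENNReal :=
  ∑' i, ∑' j, ENNReal.ofReal ((σ i + s)⁻¹ * (σ j + s)⁻¹) *
    ENNReal.ofReal (devMat b Ψ σ N zs i j ^ 2)

lemma sum_coord_le {D ι H : Type*} [NormedAddCommGroup H] [InnerProductSpace ℝ H]
    (b : HilbertBasis ι ℝ H) (Ψ : D → H) (σ : ι → ℝ) (hσ0 : ∀ i, 0 ≤ σ i) (s : ℝ) (hs : 0 < s)
    (κ : ℝ) (hκ : ∀ z, ‖Ψ z‖ ^ 2 ≤ κ) (z : D) :
    ∑' i, ENNReal.ofReal ((σ i + s)⁻¹ * ⟪b i, Ψ z⟫ ^ 2) ≤ ENNReal.ofReal (κ / s) := by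
  have h1 := hb_hasSum_sq b (Ψ z)
  calc ∑' i, ENNReal.ofReal ((σ i + s)⁻¹ * ⟪b i, Ψ z⟫ ^ 2)
      ≤ ∑' i, ENNReal.ofReal (s⁻¹ * ⟪b i, Ψ z⟫ ^ 2) := by
        refine ENNReal.tsum_le_tsum fun i => ENNReal.ofReal_le_ofReal ?_
        gcongr
        linarith [hσ0 i]
    _ = ENNReal.ofReal (s⁻¹ * ‖Ψ z‖ ^ 2) := by
        rw [← (h1.mul_left s⁻¹).tsum_eq, ENNReal.ofReal_tsum_of_nonneg (fun i => by positivity)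
          (h1.mul_left s⁻¹).summable]
    _ ≤ _ := by
        refine ENNReal.ofReal_le_ofReal ?_
        rw [div_eq_inv_mul]
        gcongr
        exact hκ z

lemma lintegral_coord {D ι H : Type*} [MeasurableSpace D] [NormedAddCommGroup H]
    [InnerProductSpace ℝ H] (P : Measure D) [IsProbabilityMeasure P]
    (b : HilbertBasis ι ℝ H) (Ψ : D → H) [DecidableEq ι] (σ : ι → ℝ) (hσ0 : ∀ i, 0 ≤ σ i)
    (hmeas : ∀ i, Measurable fun z => ⟪b i, Ψ z⟫) (κ : ℝ) (hκ : ∀ z, ‖Ψ z‖ ^ 2 ≤ κ)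
    (hσ : ∀ i j, ∫ z, ⟪b i, Ψ z⟫ * ⟪b j, Ψ z⟫ ∂P = if i = j then σ i else 0) (s : ℝ) (hs : 0 < s)
    (i : ι) :
    ∫⁻ z, ENNReal.ofReal ((σ i + s)⁻¹ * ⟪b i, Ψ z⟫ ^ 2) ∂P = ENNReal.ofReal (σ i / (σ i + s)) := by
  have hcoord : ∀ i z, |⟪b i, Ψ z⟫| ≤ ‖Ψ z‖ := by
    intro i z
    have := abs_real_inner_le_norm (b i) (Ψ z)
    rwa [b.orthonormal.1 i, one_mul] at this
  have hintg : Integrable (fun z => ⟪b i, Ψ z⟫ ^ 2) P := by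
    refine Integrable.of_bound ((hmeas i).pow_const 2).aestronglyMeasurable κ
      (ae_of_all _ fun z => ?_)
    rw [Real.norm_eq_abs, abs_pow]
    exact le_trans (by gcongr; exact hcoord i z) (hκ z)
  have h0 : 0 < σ i + s := by linarith [hσ0 i]
  rw [← ofReal_integral_eq_lintegral_ofReal (hintg.const_mul _)
    (ae_of_all _ fun z => by positivity), integral_const_mul]
  have := hσ i i
  simp only [if_true, ← pow_two] at this
  rw [this, div_eq_inv_mul]

lemma devHS_prob {Ω D ι H : Type*} [MeasurableSpace Ω] [MeasurableSpace D]
    [NormedAddCommGroup H] [InnerProductSpace ℝ H] [Countable ι]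
    (μ : Measure Ω) [IsProbabilityMeasure μ] (P : Measure D) [IsProbabilityMeasure P]
    (zS : ℕ → Ω → D) (hz : ∀ i, Measurable (zS i)) (hind : iIndepFun zS μ)
    (hlaw : ∀ i, μ.map (zS i) = P)
    (b : HilbertBasis ι ℝ H) (Ψ : D → H) [DecidableEq ι] (σ : ι → ℝ) (hσ0 : ∀ i, 0 ≤ σ i)
    (hmeas : ∀ i, Measurable fun z => ⟪b i, Ψ z⟫) (κ : ℝ) (hκ : ∀ z, ‖Ψ z‖ ^ 2 ≤ κ)
    (hσ : ∀ i j, ∫ z, ⟪b i, Ψ z⟫ * ⟪b j, Ψ z⟫ ∂P = if i = j then σ i else 0)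
    (N : ℕ) (hN : 1 ≤ N) (s T : ℝ) (hs : 0 < s)
    (hT : ∑' i, ENNReal.ofReal (σ i / (σ i + s)) ≤ ENNReal.ofReal T) :
    μ {ω | ENNReal.ofReal (1 / 4) < devHS b Ψ σ s N (fun l => zS l ω)} ≤
      ENNReal.ofReal (4 * κ * T / (N * s)) := by
  have hκ0 : 0 ≤ κ := by
    have : Nonempty D := by
      by_contra h
      rw [not_nonempty_iff] at h
      have := measure_univ (μ := P)
      simp [Measure.eq_zero_of_isEmpty P] at this
    exact (sq_nonneg _).trans (hκ (Classical.arbitrary D))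
  have hpos : ∀ i, 0 < σ i + s := fun i => by linarith [hσ0 i]
  have hE : ∫⁻ ω, devHS b Ψ σ s N (fun l => zS l ω) ∂μ ≤ ENNReal.ofReal (κ * T / (N * s)) := by
    unfold devHS
    rw [lintegral_tsum]
    swap
    · intro i
      refine (Measurable.tsum fun j => ?_).aemeasurable
      exact ((devMat_integral_le μ P zS hz hind hlaw b Ψ σ hmeas κ hκ hσ N hN i j).1.pow_const
        2).ennreal_ofReal.const_mul _
    calc ∑' i, ∫⁻ ω, ∑' j, ENNReal.ofReal ((σ i + s)⁻¹ * (σ j + s)⁻¹) *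
            ENNReal.ofReal (devMat b Ψ σ N (fun l => zS l ω) i j ^ 2) ∂μ
        ≤ ∑' i, ∑' j, ENNReal.ofReal ((N : ℝ)⁻¹) * ∫⁻ z, ENNReal.ofReal ((σ i + s)⁻¹ * ⟪b i, Ψ z⟫ ^ 2) *
            ENNReal.ofReal ((σ j + s)⁻¹ * ⟪b j, Ψ z⟫ ^ 2) ∂P := by
          refine ENNReal.tsum_le_tsum fun i => ?_
          rw [lintegral_tsum]
          swap
          · intro j
            exact (((devMat_integral_le μ P zS hz hind hlaw b Ψ σ hmeas κ hκ hσ N hN i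
              j).1.pow_const 2).ennreal_ofReal.const_mul _).aemeasurable
          refine ENNReal.tsum_le_tsum fun j => ?_
          have h := devMat_integral_le μ P zS hz hind hlaw b Ψ σ hmeas κ hκ hσ N hN i j
          rw [lintegral_const_mul _ (h.1.pow_const 2).ennreal_ofReal]
          refine (mul_le_mul_right h.2 _).trans ?_
          have hmm : Measurable fun z => ENNReal.ofReal ((⟪b i, Ψ z⟫ * ⟪b j, Ψ z⟫) ^ 2) :=
            (((hmeas i).mul (hmeas j)).pow_const 2).ennreal_ofReal
          rw [← mul_assoc, mul_comm (ENNReal.ofReal ((σ i + s)⁻¹ * (σ j + s)⁻¹)), mul_assoc,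
            ← lintegral_const_mul _ hmm]
          refine mul_le_mul_right (lintegral_mono fun z => ?_) _
          have := hpos i
          have := hpos j
          rw [← ENNReal.ofReal_mul (by positivity), ← ENNReal.ofReal_mul (by positivity)]
          exact ENNReal.ofReal_le_ofReal (le_of_eq (by ring))
      _ = ENNReal.ofReal ((N : ℝ)⁻¹) * ∫⁻ z, (∑' i, ENNReal.ofReal ((σ i + s)⁻¹ * ⟪b i, Ψ z⟫ ^ 2)) *
            (∑' j, ENNReal.ofReal ((σ j + s)⁻¹ * ⟪b j, Ψ z⟫ ^ 2)) ∂P := by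
          have hm : ∀ i, Measurable fun z => ENNReal.ofReal ((σ i + s)⁻¹ * ⟪b i, Ψ z⟫ ^ 2) :=
            fun i => (((hmeas i).pow_const 2).const_mul _).ennreal_ofReal
          simp only [ENNReal.tsum_mul_left]
          congr 1
          have e1 : ∀ z, (∑' i, ENNReal.ofReal ((σ i + s)⁻¹ * ⟪b i, Ψ z⟫ ^ 2)) *
            (∑' j, ENNReal.ofReal ((σ j + s)⁻¹ * ⟪b j, Ψ z⟫ ^ 2)) =
            ∑' i, ∑' j, ENNReal.ofReal ((σ i + s)⁻¹ * ⟪b i, Ψ z⟫ ^ 2) *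
              ENNReal.ofReal ((σ j + s)⁻¹ * ⟪b j, Ψ z⟫ ^ 2) := by
            intro z
            rw [← ENNReal.tsum_mul_right]
            exact tsum_congr fun i => ENNReal.tsum_mul_left.symm
          have hmm : ∀ i j, Measurable fun z => ENNReal.ofReal ((σ i + s)⁻¹ * ⟪b i, Ψ z⟫ ^ 2) *
              ENNReal.ofReal ((σ j + s)⁻¹ * ⟪b j, Ψ z⟫ ^ 2) := fun i j => (hm i).mul (hm j)
          simp only [e1]
          rw [lintegral_tsum fun i => (Measurable.tsum fun j => hmm i j).aemeasurable]
          refine tsum_congr fun i => ?_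
          rw [lintegral_tsum fun j => (hmm i j).aemeasurable]
      _ ≤ ENNReal.ofReal ((N : ℝ)⁻¹) * ∫⁻ z, ENNReal.ofReal (κ / s) *
            (∑' j, ENNReal.ofReal ((σ j + s)⁻¹ * ⟪b j, Ψ z⟫ ^ 2)) ∂P := by
          gcongr with z
          exact sum_coord_le b Ψ σ hσ0 s hs κ hκ z
      _ = ENNReal.ofReal ((N : ℝ)⁻¹) * (ENNReal.ofReal (κ / s) *
            ∑' j, ENNReal.ofReal (σ j / (σ j + s))) := by
          have hm : ∀ i, Measurable fun z => ENNReal.ofReal ((σ i + s)⁻¹ * ⟪b i, Ψ z⟫ ^ 2) :=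
            fun i => (((hmeas i).pow_const 2).const_mul _).ennreal_ofReal
          rw [lintegral_const_mul _ (Measurable.tsum hm),
            lintegral_tsum fun i => (hm i).aemeasurable]
          congr 2
          exact tsum_congr fun i => lintegral_coord P b Ψ σ hσ0 hmeas κ hκ hσ s hs i
      _ ≤ ENNReal.ofReal ((N : ℝ)⁻¹) * (ENNReal.ofReal (κ / s) * ENNReal.ofReal T) := by gcongr
      _ = _ := by
          rw [← ENNReal.ofReal_mul (by positivity), ← ENNReal.ofReal_mul (by positivity)]
          congr 1
          field_simp
  have hmk := mul_meas_ge_le_lintegral₀ (μ := μ) (f := fun ω => devHS b Ψ σ s N (fun l => zS l ω))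
    (by
      refine (Measurable.tsum fun i => Measurable.tsum fun j => ?_).aemeasurable
      exact ((devMat_integral_le μ P zS hz hind hlaw b Ψ σ hmeas κ hκ hσ N hN i j).1.pow_const
        2).ennreal_ofReal.const_mul _) (ENNReal.ofReal (1 / 4))
  have h1 : ENNReal.ofReal (1 / 4) * μ {ω | ENNReal.ofReal (1 / 4) < devHS b Ψ σ s N (fun l => zS l ω)} ≤
      ENNReal.ofReal (κ * T / (N * s)) := by
    refine le_trans ?_ (hmk.trans hE)
    gcongr
    exact fun h => le_of_lt h
  have h2 := mul_le_mul_right h1 (ENNReal.ofReal 4)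
  rw [← mul_assoc, ← ENNReal.ofReal_mul (by norm_num), ← ENNReal.ofReal_mul (by norm_num),
    show (4 : ℝ) * (1 / 4) = 1 by norm_num, ENNReal.ofReal_one, one_mul] at h2
  refine h2.trans (le_of_eq ?_)
  congr 1
  ring

lemma devHS_det {D ι H : Type*} [NormedAddCommGroup H] [InnerProductSpace ℝ H]
    (b : HilbertBasis ι ℝ H) (Ψ : D → H) [DecidableEq ι] (σ : ι → ℝ) (hσ0 : ∀ i, 0 ≤ σ i)
    (κ : ℝ) (hσκ : ∀ i, σ i ≤ κ) (s : ℝ) (hs : 0 < s) (N : ℕ)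
    (zs : ℕ → D) (hdev : devHS b Ψ σ s N zs ≤ ENNReal.ofReal (1 / 4)) (h : H) :
    Summable (fun i => σ i * ⟪b i, h⟫ ^ 2) ∧
    |(N : ℝ)⁻¹ * ∑ l ∈ Finset.range N, ⟪Ψ (zs l), h⟫ ^ 2 - ∑' i, σ i * ⟪b i, h⟫ ^ 2| ≤
      1 / 2 * (∑' i, σ i * ⟪b i, h⟫ ^ 2 + s * ‖h‖ ^ 2) := by
  have hsq := hb_hasSum_sq b h
  have hsum : Summable (fun i => σ i * ⟪b i, h⟫ ^ 2) := by
    refine Summable.of_nonneg_of_le (fun i => mul_nonneg (hσ0 i) (sq_nonneg _)) (fun i => ?_)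
      (hsq.summable.mul_left κ)
    exact mul_le_mul_of_nonneg_right (hσκ i) (sq_nonneg _)
  refine ⟨hsum, ?_⟩
  have hpos : ∀ i, 0 < σ i + s := fun i => by linarith [hσ0 i]
  set hF : Finset ι → H := fun F => ∑ i ∈ F, ⟪b i, h⟫ • b i with hhF
  have hlim : Tendsto hF atTop (𝓝 h) := by
    have := b.hasSum_repr h
    simp only [b.repr_apply_apply] at this
    exact this
  have hl1 : Tendsto (fun F : Finset ι => |(N : ℝ)⁻¹ * ∑ l ∈ Finset.range N, ⟪Ψ (zs l), hF F⟫ ^ 2 -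
      ∑ i ∈ F, σ i * ⟪b i, h⟫ ^ 2|) atTop
      (𝓝 |(N : ℝ)⁻¹ * ∑ l ∈ Finset.range N, ⟪Ψ (zs l), h⟫ ^ 2 - ∑' i, σ i * ⟪b i, h⟫ ^ 2|) := by
    refine Tendsto.abs (Tendsto.sub ?_ hsum.hasSum)
    refine Tendsto.const_mul _ (tendsto_finsetSum _ fun l _ => Tendsto.pow ?_ 2)
    exact Tendsto.inner tendsto_const_nhds hlim
  have hl2 : Tendsto (fun F : Finset ι => 1 / 2 * (∑ i ∈ F, σ i * ⟪b i, h⟫ ^ 2 +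
      s * ∑ i ∈ F, ⟪b i, h⟫ ^ 2)) atTop
      (𝓝 (1 / 2 * (∑' i, σ i * ⟪b i, h⟫ ^ 2 + s * ‖h‖ ^ 2))) :=
    Tendsto.const_mul _ (Tendsto.add hsum.hasSum (Tendsto.const_mul _ hsq))
  refine le_of_tendsto_of_tendsto' hl1 hl2 fun F => ?_
  have hA : (N : ℝ)⁻¹ * ∑ l ∈ Finset.range N, ⟪Ψ (zs l), hF F⟫ ^ 2 - ∑ i ∈ F, σ i * ⟪b i, h⟫ ^ 2 =
      ∑ p ∈ F ×ˢ F, (⟪b p.1, h⟫ * ⟪b p.2, h⟫) * devMat b Ψ σ N zs p.1 p.2 := by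
    rw [Finset.sum_product]
    have e1 : ∀ l, ⟪Ψ (zs l), hF F⟫ ^ 2 = ∑ i ∈ F, ∑ j ∈ F, (⟪b i, h⟫ * ⟪b j, h⟫) *
        (⟪b i, Ψ (zs l)⟫ * ⟪b j, Ψ (zs l)⟫) := by
      intro l
      rw [hhF]
      simp only [inner_sum, inner_smul_right]
      rw [pow_two, Finset.sum_mul_sum]
      refine Finset.sum_congr rfl fun i _ => Finset.sum_congr rfl fun j _ => ?_
      rw [real_inner_comm (b i) (Ψ (zs l)), real_inner_comm (b j) (Ψ (zs l))]
      ring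
    simp only [e1, devMat, mul_sub, Finset.sum_sub_distrib]
    congr 1
    · rw [Finset.sum_comm, Finset.mul_sum]
      refine Finset.sum_congr rfl fun i _ => ?_
      rw [Finset.sum_comm, Finset.mul_sum]
      refine Finset.sum_congr rfl fun j _ => ?_
      rw [← Finset.mul_sum]; ring
    · refine Finset.sum_congr rfl fun i hi => ?_
      simp [hi]; ring
  rw [hA]
  have hDsum : ∑ p ∈ F ×ˢ F, ((σ p.1 + s)⁻¹ * (σ p.2 + s)⁻¹) * devMat b Ψ σ N zs p.1 p.2 ^ 2 ≤ 1 / 4 := by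
    have hnn : ∀ p : ι × ι, 0 ≤ ((σ p.1 + s)⁻¹ * (σ p.2 + s)⁻¹) := fun p => by
      have := hpos p.1; have := hpos p.2; positivity
    rw [← ENNReal.ofReal_le_ofReal_iff (by norm_num)]
    refine le_trans ?_ hdev
    rw [ENNReal.ofReal_sum_of_nonneg fun p _ => mul_nonneg (hnn p) (sq_nonneg _)]
    unfold devHS
    rw [← ENNReal.tsum_prod]
    refine le_trans (le_of_eq ?_) (ENNReal.sum_le_tsum (F ×ˢ F))
    refine Finset.sum_congr rfl fun p _ => ?_
    rw [ENNReal.ofReal_mul (hnn p)]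
  have hB : ∑ i ∈ F, σ i * ⟪b i, h⟫ ^ 2 + s * ∑ i ∈ F, ⟪b i, h⟫ ^ 2 =
      ∑ i ∈ F, (σ i + s) * ⟪b i, h⟫ ^ 2 := by
    rw [Finset.mul_sum, ← Finset.sum_add_distrib]
    exact Finset.sum_congr rfl fun i _ => by ring
  rw [hB]
  have hB0 : 0 ≤ ∑ i ∈ F, (σ i + s) * ⟪b i, h⟫ ^ 2 :=
    Finset.sum_nonneg fun i _ => mul_nonneg (hpos i).le (sq_nonneg _)
  refine abs_le_of_sq_le_sq ?_ (by positivity)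
  have hCS := Finset.sum_mul_sq_le_sq_mul_sq (F ×ˢ F)
    (fun p => Real.sqrt ((σ p.1 + s) * (σ p.2 + s)) * (⟪b p.1, h⟫ * ⟪b p.2, h⟫))
    (fun p => (Real.sqrt ((σ p.1 + s) * (σ p.2 + s)))⁻¹ * devMat b Ψ σ N zs p.1 p.2)
  have e2 : ∀ p : ι × ι, Real.sqrt ((σ p.1 + s) * (σ p.2 + s)) * (⟪b p.1, h⟫ * ⟪b p.2, h⟫) *
      ((Real.sqrt ((σ p.1 + s) * (σ p.2 + s)))⁻¹ * devMat b Ψ σ N zs p.1 p.2) =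
      (⟪b p.1, h⟫ * ⟪b p.2, h⟫) * devMat b Ψ σ N zs p.1 p.2 := by
    intro p
    have : 0 < Real.sqrt ((σ p.1 + s) * (σ p.2 + s)) := Real.sqrt_pos.2 (mul_pos (hpos _) (hpos _))
    field_simp
  have e3 : ∀ p : ι × ι, (Real.sqrt ((σ p.1 + s) * (σ p.2 + s)) * (⟪b p.1, h⟫ * ⟪b p.2, h⟫)) ^ 2 =
      ((σ p.1 + s) * ⟪b p.1, h⟫ ^ 2) * ((σ p.2 + s) * ⟪b p.2, h⟫ ^ 2) := by
    intro p
    rw [mul_pow, Real.sq_sqrt (mul_pos (hpos _) (hpos _)).le]; ring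
  have e4 : ∀ p : ι × ι, ((Real.sqrt ((σ p.1 + s) * (σ p.2 + s)))⁻¹ * devMat b Ψ σ N zs p.1 p.2) ^ 2 =
      ((σ p.1 + s)⁻¹ * (σ p.2 + s)⁻¹) * devMat b Ψ σ N zs p.1 p.2 ^ 2 := by
    intro p
    rw [mul_pow, inv_pow, Real.sq_sqrt (mul_pos (hpos _) (hpos _)).le, mul_inv]
  simp only [e2, e3, e4] at hCS
  refine hCS.trans ?_
  have e5 : ∑ x ∈ F ×ˢ F, (σ x.1 + s) * ⟪b x.1, h⟫ ^ 2 * ((σ x.2 + s) * ⟪b x.2, h⟫ ^ 2) =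
      (∑ i ∈ F, (σ i + s) * ⟪b i, h⟫ ^ 2) * ∑ i ∈ F, (σ i + s) * ⟪b i, h⟫ ^ 2 := by
    rw [Finset.sum_mul_sum, Finset.sum_product]
  rw [e5]
  have := mul_le_mul_of_nonneg_left hDsum (mul_nonneg hB0 hB0)
  refine this.trans (le_of_eq (by ring))

lemma leverage_prob {Ω D ι H : Type*} [MeasurableSpace Ω] [MeasurableSpace D]
    [NormedAddCommGroup H] [InnerProductSpace ℝ H] [Countable ι]
    (μ : Measure Ω) [IsProbabilityMeasure μ] (P : Measure D) [IsProbabilityMeasure P]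
    (zS : ℕ → Ω → D) (hz : ∀ i, Measurable (zS i))
    (hlaw : ∀ i, μ.map (zS i) = P)
    (b : HilbertBasis ι ℝ H) (Ψ : D → H) [DecidableEq ι] (σ : ι → ℝ) (hσ0 : ∀ i, 0 ≤ σ i)
    (hmeas : ∀ i, Measurable fun z => ⟪b i, Ψ z⟫) (κ : ℝ) (hκ : ∀ z, ‖Ψ z‖ ^ 2 ≤ κ)
    (hσ : ∀ i j, ∫ z, ⟪b i, Ψ z⟫ * ⟪b j, Ψ z⟫ ∂P = if i = j then σ i else 0)
    (r : ℕ) (hr : 1 ≤ r) (s T M : ℝ) (hs : 0 < s) (hT0 : 0 < T) (hM : 0 < M)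
    (hT : ∑' i, ENNReal.ofReal (σ i / (σ i + s)) ≤ ENNReal.ofReal T) :
    μ {ω | ENNReal.ofReal (M * r * T) < ∑ l ∈ Finset.range r,
        ∑' i, ENNReal.ofReal ((σ i + s)⁻¹ * ⟪b i, Ψ (zS l ω)⟫ ^ 2)} ≤ ENNReal.ofReal (1 / M) := by
  have hm : ∀ i, Measurable fun z => ENNReal.ofReal ((σ i + s)⁻¹ * ⟪b i, Ψ z⟫ ^ 2) :=
    fun i => (((hmeas i).pow_const 2).const_mul _).ennreal_ofReal
  have hmt : Measurable fun z => ∑' i, ENNReal.ofReal ((σ i + s)⁻¹ * ⟪b i, Ψ z⟫ ^ 2) :=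
    Measurable.tsum hm
  have hE : ∫⁻ ω, ∑ l ∈ Finset.range r,
        ∑' i, ENNReal.ofReal ((σ i + s)⁻¹ * ⟪b i, Ψ (zS l ω)⟫ ^ 2) ∂μ ≤ ENNReal.ofReal (r * T) := by
    have hmt2 : ∀ l, Measurable fun ω => ∑' i, ENNReal.ofReal ((σ i + s)⁻¹ * ⟪b i, Ψ (zS l ω)⟫ ^ 2) :=
      fun l => hmt.comp (hz l)
    rw [lintegral_finsetSum _ fun l _ => hmt2 l]
    have : ∀ l ∈ Finset.range r, ∫⁻ ω, ∑' i, ENNReal.ofReal ((σ i + s)⁻¹ * ⟪b i, Ψ (zS l ω)⟫ ^ 2) ∂μ ≤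
        ENNReal.ofReal T := by
      intro l _
      have h1 := lintegral_map (μ := μ) hmt (hz l)
      rw [hlaw l] at h1
      rw [← h1, lintegral_tsum fun i => (hm i).aemeasurable]
      refine le_trans (le_of_eq ?_) hT
      exact tsum_congr fun i => lintegral_coord P b Ψ σ hσ0 hmeas κ hκ hσ s hs i
    refine (Finset.sum_le_sum this).trans ?_
    rw [Finset.sum_const, Finset.card_range, nsmul_eq_mul, ENNReal.ofReal_mul (by positivity)]
    simp
  have hr0 : (0 : ℝ) < r := by positivity
  have hmk := mul_meas_ge_le_lintegral₀ (μ := μ) (f := fun ω => ∑ l ∈ Finset.range r,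
        ∑' i, ENNReal.ofReal ((σ i + s)⁻¹ * ⟪b i, Ψ (zS l ω)⟫ ^ 2))
    (Finset.measurable_fun_sum _ fun l _ => hmt.comp (hz l)).aemeasurable (ENNReal.ofReal (M * r * T))
  have h1 : ENNReal.ofReal (M * r * T) * μ {ω | ENNReal.ofReal (M * r * T) < ∑ l ∈ Finset.range r,
        ∑' i, ENNReal.ofReal ((σ i + s)⁻¹ * ⟪b i, Ψ (zS l ω)⟫ ^ 2)} ≤ ENNReal.ofReal (r * T) := by
    refine le_trans ?_ (hmk.trans hE)
    gcongr
    exact fun h => le_of_lt h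
  have h2 := mul_le_mul_right h1 (ENNReal.ofReal (M * r * T)⁻¹)
  rw [← mul_assoc, ← ENNReal.ofReal_mul (by positivity), ← ENNReal.ofReal_mul (by positivity),
    inv_mul_cancel₀ (by positivity), ENNReal.ofReal_one, one_mul] at h2
  refine h2.trans (le_of_eq ?_)
  congr 1
  field_simp

/-- The properties of the kernel smoother that hold with high probability. -/
def GoodSmooth {D : Type*} (k : D → D → ℝ) (f : D → ℝ) (n r : ℕ) (lam β γ K : ℝ) (zs : ℕ → D) :
    Prop :=
    (∑ i ∈ Finset.range n,
      (∑ l ∈ Finset.range r, acoef k zs r lam (zs i) l * f (zs l) - f (zs i)) ^ 2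
        ≤ K * (n * lam ^ β)) ∧
    (∑ i ∈ Finset.range n, ∑ l ∈ Finset.range r, acoef k zs r lam (zs i) l ^ 2
        ≤ K * (n * lam ^ (-γ) / r)) ∧
    (∀ b : ℕ → ℝ, ∑ l ∈ Finset.range r, (∑ i ∈ Finset.range n, acoef k zs r lam (zs i) l * b i) ^ 2
        ≤ K * (n / r) * ∑ i ∈ Finset.range n, b i ^ 2) ∧
    (∀ i, ∑ l ∈ Finset.range r, acoef k zs r lam (zs i) l ^ 2 ≤ K) ∧
    (∀ i, (∑ l ∈ Finset.range r, acoef k zs r lam (zs i) l * f (zs l) - f (zs i)) ^ 2 ≤ K)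

lemma young_basis {ι H : Type*} [NormedAddCommGroup H] [InnerProductSpace ℝ H]
    (b : HilbertBasis ι ℝ H) (σ : ι → ℝ) (hσ0 : ∀ i, 0 ≤ σ i)
    (lam : ℝ) (hlam : 0 < lam) (K : ℝ) (hK : 0 < K) (v h : H) (R : ℝ) (hR : 0 ≤ R)
    (hv : ∑' i, ENNReal.ofReal ((σ i + lam)⁻¹ * ⟪b i, v⟫ ^ 2) ≤ ENNReal.ofReal R)
    (hs : Summable fun i => σ i * ⟪b i, h⟫ ^ 2) :
    2 * ⟪v, h⟫ ≤ K * R + K⁻¹ * (∑' i, σ i * ⟪b i, h⟫ ^ 2 + lam * ‖h‖ ^ 2) := by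
  have hpos : ∀ i, 0 < σ i + lam := fun i => by linarith [hσ0 i]
  have hnn : ∀ i, 0 ≤ (σ i + lam)⁻¹ * ⟪b i, v⟫ ^ 2 := fun i => by
    have := hpos i; positivity
  have hle : ∀ F : Finset ι, ∑ i ∈ F, (σ i + lam)⁻¹ * ⟪b i, v⟫ ^ 2 ≤ R := by
    intro F
    rw [← ENNReal.ofReal_le_ofReal_iff hR, ENNReal.ofReal_sum_of_nonneg fun i _ => hnn i]
    exact (ENNReal.sum_le_tsum F).trans hv
  have hsum := b.hasSum_inner_mul_inner v h
  have h1 : HasSum (fun i => σ i * ⟪b i, h⟫ ^ 2 + lam * ⟪b i, h⟫ ^ 2)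
      (∑' i, σ i * ⟪b i, h⟫ ^ 2 + lam * ‖h‖ ^ 2) :=
    hs.hasSum.add ((hb_hasSum_sq b h).mul_left lam)
  have hl1 : Tendsto (fun F : Finset ι => 2 * ∑ i ∈ F, ⟪v, b i⟫ * ⟪b i, h⟫) atTop (𝓝 (2 * ⟪v, h⟫)) :=
    Tendsto.const_mul _ hsum
  have hl2 : Tendsto (fun F : Finset ι => K * R + K⁻¹ * ∑ i ∈ F, (σ i * ⟪b i, h⟫ ^ 2 + lam * ⟪b i, h⟫ ^ 2))
      atTop (𝓝 (K * R + K⁻¹ * (∑' i, σ i * ⟪b i, h⟫ ^ 2 + lam * ‖h‖ ^ 2))) :=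
    tendsto_const_nhds.add (Tendsto.const_mul _ h1)
  refine le_of_tendsto_of_tendsto' hl1 hl2 fun F => ?_
  refine le_trans ?_ (add_le_add_left (mul_le_mul_of_nonneg_left (hle F) hK.le) _)
  rw [Finset.mul_sum, Finset.mul_sum, Finset.mul_sum, ← Finset.sum_add_distrib]
  refine Finset.sum_le_sum fun i _ => ?_
  rw [real_inner_comm]
  have hp := hpos i
  have : 0 ≤ (K * (σ i + lam))⁻¹ * (K * ⟪b i, v⟫ - (σ i + lam) * ⟪b i, h⟫) ^ 2 := by positivity
  have e : (K * (σ i + lam))⁻¹ * (K * ⟪b i, v⟫ - (σ i + lam) * ⟪b i, h⟫) ^ 2 =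
    K * ((σ i + lam)⁻¹ * ⟪b i, v⟫ ^ 2) + K⁻¹ * (σ i * ⟪b i, h⟫ ^ 2 + lam * ⟪b i, h⟫ ^ 2) -
      2 * (⟪b i, v⟫ * ⟪b i, h⟫) := by
    field_simp
    ring
  linarith

lemma good_det {D ι H : Type*} [NormedAddCommGroup H] [InnerProductSpace ℝ H]
    (b : HilbertBasis ι ℝ H) (Ψ : D → H) [DecidableEq ι] (σ : ι → ℝ) (hσ0 : ∀ i, 0 ≤ σ i)
    (κ : ℝ) (hκ : ∀ z, ‖Ψ z‖ ^ 2 ≤ κ) (hσκ : ∀ i, σ i ≤ κ) (k : D → D → ℝ) (f : D → ℝ) (w : H)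
    (V Q β γ : ℝ) (hV : 0 ≤ V) (hQ : 0 < Q) (hγ0 : 0 ≤ γ)
    (hw : ∀ s, 0 < s → ∑' i, ENNReal.ofReal ((σ i + s)⁻¹ * ⟪b i, w⟫ ^ 2) ≤
      ENNReal.ofReal (V * s ^ (β - 2)))
    (M : ℝ) (hM : 1 ≤ M) (n r : ℕ) (hr : 1 ≤ r) (hrn : r ≤ n) (lam : ℝ)
    (hlam : lam = (r : ℝ) ^ (-(1 / (1 + γ)))) (zs : ℕ → D)
    (hk : ∀ i l, k (zs i) (zs l) = ⟪Ψ (zs i), Ψ (zs l)⟫) (hf : ∀ i, f (zs i) = ⟪w, Ψ (zs i)⟫)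
    (h1 : devHS b Ψ σ (M * lam) r zs ≤ ENNReal.ofReal (1 / 4))
    (h2 : devHS b Ψ σ (M * lam) n zs ≤ ENNReal.ofReal (1 / 4))
    (h3 : ∑ l ∈ Finset.range r, ∑' i, ENNReal.ofReal ((σ i + lam)⁻¹ * ⟪b i, Ψ (zs l)⟫ ^ 2) ≤
      ENNReal.ofReal (M * r * (Q * lam ^ (-γ)))) :
    GoodSmooth k f n r lam β γ ((2 * M + 3) ^ 2 * V + (2 * M + 3) ^ 2 * M * Q + (2 * M + 3) + κ +
      κ * ‖w‖ ^ 2) zs := by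
  have hr0 : (0 : ℝ) < r := by positivity
  have hn0 : (0 : ℝ) < n := by exact_mod_cast (by omega : 0 < n)
  have hlam0 : 0 < lam := by rw [hlam]; positivity
  have hκ0 : 0 ≤ κ := (sq_nonneg _).trans (hκ (zs 0))
  set K0 : ℝ := 2 * M + 3 with hK0
  have hK0p : 0 < K0 := by linarith
  set cr : H → ℝ := fun h => (r : ℝ)⁻¹ * ∑ m ∈ Finset.range r, ⟪Ψ (zs m), h⟫ ^ 2 + lam * ‖h‖ ^ 2 with hcr
  have hMl : 0 < M * lam := by positivity
  have hd1 := fun h => devHS_det b Ψ σ hσ0 κ hσκ (M * lam) hMl r zs h1 h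
  have hd2 := fun h => devHS_det b Ψ σ hσ0 κ hσκ (M * lam) hMl n zs h2 h
  have hcle : ∀ h, ∑' i, σ i * ⟪b i, h⟫ ^ 2 + lam * ‖h‖ ^ 2 ≤ K0 * cr h := by
    intro h
    have := (abs_le.1 (hd1 h).2).1
    have hp : 0 ≤ (r : ℝ)⁻¹ * ∑ m ∈ Finset.range r, ⟪Ψ (zs m), h⟫ ^ 2 := by positivity
    have hq : 0 ≤ lam * ‖h‖ ^ 2 := by positivity
    simp only [hcr]
    nlinarith [mul_nonneg (sub_nonneg.2 hM) hp, mul_nonneg (sub_nonneg.2 hM) hq]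
  have hE2 : ∀ h, ∑ i ∈ Finset.range n, ⟪Ψ (zs i), h⟫ ^ 2 ≤ n * K0 * cr h := by
    intro h
    have e1 := (abs_le.1 (hd1 h).2).1
    have e2 := (abs_le.1 (hd2 h).2).2
    have hp : 0 ≤ (r : ℝ)⁻¹ * ∑ m ∈ Finset.range r, ⟪Ψ (zs m), h⟫ ^ 2 := by positivity
    have hq : 0 ≤ lam * ‖h‖ ^ 2 := by positivity
    have : (n : ℝ)⁻¹ * ∑ i ∈ Finset.range n, ⟪Ψ (zs i), h⟫ ^ 2 ≤ K0 * cr h := by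
      simp only [hcr]
      nlinarith [mul_nonneg (sub_nonneg.2 hM) hp, mul_nonneg (sub_nonneg.2 hM) hq]
    have := mul_le_mul_of_nonneg_left this hn0.le
    rw [← mul_assoc, mul_inv_cancel₀ hn0.ne', one_mul] at this
    linarith
  have hyoung : ∀ v R, 0 ≤ R → ∑' i, ENNReal.ofReal ((σ i + lam)⁻¹ * ⟪b i, v⟫ ^ 2) ≤ ENNReal.ofReal R →
      ∀ h, 2 * ⟪v, h⟫ ≤ K0 * R + cr h := by
    intro v R hR hv h
    refine (young_basis b σ hσ0 lam hlam0 K0 hK0p v h R hR hv (hd1 h).1).trans ?_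
    have := mul_le_mul_of_nonneg_left (hcle h) (inv_nonneg.2 hK0p.le)
    rw [← mul_assoc, inv_mul_cancel₀ hK0p.ne', one_mul] at this
    linarith
  set N : ℕ → ℝ := fun l => (∑' i, ENNReal.ofReal ((σ i + lam)⁻¹ * ⟪b i, Ψ (zs l)⟫ ^ 2)).toReal with hN
  have hfin : ∀ l, ∑' i, ENNReal.ofReal ((σ i + lam)⁻¹ * ⟪b i, Ψ (zs l)⟫ ^ 2) ≠ ⊤ := fun l =>
    ne_top_of_le_ne_top ENNReal.ofReal_ne_top (sum_coord_le b Ψ σ hσ0 lam hlam0 κ hκ (zs l))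
  have hNs : ∑ l ∈ Finset.range r, N l ≤ M * r * (Q * lam ^ (-γ)) := by
    rw [hN]
    simp only
    rw [← ENNReal.toReal_sum fun l _ => hfin l]
    refine ENNReal.toReal_le_of_le_ofReal (by positivity) h3
  obtain ⟨b1, b2, b3, b4, b5⟩ := smoother_bounds k zs (fun i => Ψ (zs i)) hk n r lam hr hlam0 K0 κ hK0p.le
    (fun i => hκ _) cr (fun h => rfl) hE2 w (V * lam ^ (β - 2))
    (hyoung w _ (by positivity) (hw lam hlam0)) N
    (fun l _ => hyoung (Ψ (zs l)) (N l) ENNReal.toReal_nonneg (by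
      rw [hN]; simp only; rw [ENNReal.ofReal_toReal (hfin l)])) f hf
  have c1 : 0 ≤ K0 ^ 2 * V := by positivity
  have c2 : 0 ≤ K0 ^ 2 * M * Q := by positivity
  have c5 : 0 ≤ κ * ‖w‖ ^ 2 := by positivity
  refine ⟨b1.trans ?_, b2.trans ?_, fun bb => (b3 bb).trans ?_, fun i => (b4 i).trans ?_,
    fun i => (b5 i).trans ?_⟩
  · have e : lam ^ 2 * lam ^ (β - 2) = lam ^ β := by
      rw [← Real.rpow_natCast, ← Real.rpow_add hlam0]
      congr 1
      push_cast; ring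
    have : n * K0 ^ 2 * lam ^ 2 * (V * lam ^ (β - 2)) = (K0 ^ 2 * V) * (n * lam ^ β) := by
      rw [← e]; ring
    rw [this]
    refine mul_le_mul_of_nonneg_right ?_ (by positivity)
    linarith
  · have : n * K0 ^ 2 / (r : ℝ) ^ 2 * ∑ l ∈ Finset.range r, N l ≤
        (K0 ^ 2 * M * Q) * (n * lam ^ (-γ) / r) := by
      refine (mul_le_mul_of_nonneg_left hNs (by positivity)).trans (le_of_eq ?_)
      field_simp
    refine this.trans ?_
    refine mul_le_mul_of_nonneg_right ?_ (by positivity)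
    linarith
  · refine mul_le_mul_of_nonneg_right ?_ (by positivity)
    rw [show (n : ℝ) * K0 / r = K0 * (n / r) by ring]
    refine mul_le_mul_of_nonneg_right ?_ (by positivity)
    linarith
  · have : 1 ≤ (r : ℝ) * lam := by
      rw [hlam]
      nth_rewrite 1 [← Real.rpow_one (r : ℝ)]
      rw [← Real.rpow_add hr0]
      refine Real.one_le_rpow (by exact_mod_cast hr) ?_
      have : 1 / (1 + γ) ≤ 1 := by rw [div_le_one (by linarith)]; linarith
      linarith
    have : κ / (r * lam) ≤ κ := div_le_self hκ0 this
    linarith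
  · linarith

lemma good_event {D ι H : Type*} [MeasurableSpace D] [NormedAddCommGroup H] [InnerProductSpace ℝ H]
    [Countable ι] (P : Measure D) [IsProbabilityMeasure P]
    (ρ : Measure (ℕ → D)) [IsProbabilityMeasure ρ]
    (hind : iIndepFun (fun i (x : ℕ → D) => x i) ρ) (hlaw : ∀ i, ρ.map (fun x => x i) = P)
    (b : HilbertBasis ι ℝ H) (Ψ : D → H) [DecidableEq ι] (σ : ι → ℝ) (hσ0 : ∀ i, 0 ≤ σ i)
    (hmeas : ∀ i, Measurable fun z => ⟪b i, Ψ z⟫)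
    (κ : ℝ) (hκ : ∀ z, ‖Ψ z‖ ^ 2 ≤ κ) (hσκ : ∀ i, σ i ≤ κ)
    (hσ : ∀ i j, ∫ z, ⟪b i, Ψ z⟫ * ⟪b j, Ψ z⟫ ∂P = if i = j then σ i else 0)
    (k : D → D → ℝ) (f : D → ℝ) (w : H)
    (S : Set D) (hS : ∀ᵐ z ∂P, z ∈ S) (hSk : ∀ z ∈ S, ∀ z' ∈ S, k z z' = ⟪Ψ z, Ψ z'⟫)
    (hf : ∀ᵐ z ∂P, f z = ⟪w, Ψ z⟫)
    (V Q β γ : ℝ) (hV : 0 ≤ V) (hQ : 0 < Q) (hγ0 : 0 ≤ γ)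
    (hT : ∀ s, 0 < s → ∑' i, ENNReal.ofReal (σ i / (σ i + s)) ≤ ENNReal.ofReal (Q * s ^ (-γ)))
    (hw : ∀ s, 0 < s → ∑' i, ENNReal.ofReal ((σ i + s)⁻¹ * ⟪b i, w⟫ ^ 2) ≤
      ENNReal.ofReal (V * s ^ (β - 2)))
    (η : ℝ) (hη : 0 < η) :
    ∃ K : ℝ, 0 ≤ K ∧ ∀ n r : ℕ, 1 ≤ r → r ≤ n → ∃ G : Set (ℕ → D), MeasurableSet G ∧
      ρ Gᶜ ≤ ENNReal.ofReal η ∧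
      ∀ zs ∈ G, GoodSmooth k f n r ((r : ℝ) ^ (-(1 / (1 + γ)))) β γ K zs := by
  have hκ0 : 0 ≤ κ := by
    have : Nonempty D := by
      by_contra h
      rw [not_nonempty_iff] at h
      have := measure_univ (μ := P)
      simp [Measure.eq_zero_of_isEmpty P] at this
    exact (sq_nonneg _).trans (hκ (Classical.arbitrary D))
  set M : ℝ := max 1 ((8 * κ * Q + 1) / η) with hMdef
  have hM1 : 1 ≤ M := le_max_left _ _
  have hM2 : (8 * κ * Q + 1) / M ≤ η := by
    have : (8 * κ * Q + 1) / η ≤ M := le_max_right _ _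
    rw [div_le_iff₀ hη] at this
    rw [div_le_iff₀ (by linarith)]; linarith
  refine ⟨(2 * M + 3) ^ 2 * V + (2 * M + 3) ^ 2 * M * Q + (2 * M + 3) + κ +
      κ * ‖w‖ ^ 2, by positivity, fun n r hr hrn => ?_⟩
  set lam : ℝ := (r : ℝ) ^ (-(1 / (1 + γ))) with hlam
  set K : ℝ := (2 * M + 3) ^ 2 * V + (2 * M + 3) ^ 2 * M * Q + (2 * M + 3) + κ + κ * ‖w‖ ^ 2 with hK
  have hr0 : (0 : ℝ) < r := by positivity
  have hlam0 : 0 < lam := by positivity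
  set Bad : Set (ℕ → D) := {zs | ¬ GoodSmooth k f n r lam β γ K zs} with hBad
  have hBle : ρ Bad ≤ ENNReal.ofReal η := by
    have hae : ∀ᵐ x ∂ρ, ∀ l, (x l ∈ S ∧ f (x l) = ⟪w, Ψ (x l)⟫) := by
      rw [ae_all_iff]
      intro l
      have hq : Measure.QuasiMeasurePreserving (fun x : ℕ → D => x l) ρ P :=
        ⟨measurable_pi_apply l, by rw [hlaw l]⟩
      exact hq.ae (hS.and hf)
    set B1 : Set (ℕ → D) := {x | ENNReal.ofReal (1 / 4) < devHS b Ψ σ (M * lam) r (fun l => x l)}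
    set B2 : Set (ℕ → D) := {x | ENNReal.ofReal (1 / 4) < devHS b Ψ σ (M * lam) n (fun l => x l)}
    set B3 : Set (ℕ → D) := {x | ENNReal.ofReal (M * r * (Q * lam ^ (-γ))) < ∑ l ∈ Finset.range r,
        ∑' i, ENNReal.ofReal ((σ i + lam)⁻¹ * ⟪b i, Ψ (x l)⟫ ^ 2)}
    have hlamr : lam ^ (-γ) / lam = r := by
      rw [← Real.rpow_sub_one hlam0.ne', hlam, ← Real.rpow_mul hr0.le]
      rw [show -(1 / (1 + γ)) * (-γ - 1) = 1 by field_simp; ring, Real.rpow_one]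
    have hprob : ∀ N : ℕ, r ≤ N → ρ {x | ENNReal.ofReal (1 / 4) < devHS b Ψ σ (M * lam) N (fun l => x l)} ≤
        ENNReal.ofReal (4 * κ * Q / M) := by
      intro N hN
      have hN0 : (0 : ℝ) < N := by exact_mod_cast (by omega : 0 < N)
      refine (devHS_prob ρ P (fun l x => x l) (fun l => measurable_pi_apply l) hind hlaw b Ψ σ hσ0 hmeas κ
        hκ hσ N (hr.trans hN) (M * lam) _ (by positivity) (hT (M * lam) (by positivity))).trans ?_
      refine ENNReal.ofReal_le_ofReal ?_
      have hMg : M ^ (-γ) ≤ 1 := Real.rpow_le_one_of_one_le_of_nonpos hM1 (by linarith)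
      rw [Real.mul_rpow (by linarith) hlam0.le]
      have e : 4 * κ * (Q * (M ^ (-γ) * lam ^ (-γ))) / (N * (M * lam)) =
          4 * κ * Q / M * (M ^ (-γ) * ((lam ^ (-γ) / lam) / N)) := by field_simp
      rw [e, hlamr]
      have : M ^ (-γ) * ((r : ℝ) / N) ≤ 1 := by
        have : (r : ℝ) / N ≤ 1 := by rw [div_le_one hN0]; exact_mod_cast hN
        have h0 : 0 ≤ (r : ℝ) / N := by positivity
        calc M ^ (-γ) * ((r : ℝ) / N) ≤ 1 * 1 := by gcongr
          _ = 1 := one_mul 1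
      have h0 : 0 ≤ 4 * κ * Q / M := by positivity
      nlinarith
    have hsub : Bad ≤ᵐ[ρ] ((B1 ∪ B2) ∪ B3 : Set (ℕ → D)) := by
      filter_upwards [hae] with x hx hxB
      by_contra hcon
      have hcon : ¬ (x ∈ (B1 ∪ B2) ∪ B3) := hcon
      simp only [Set.mem_union, not_or] at hcon
      obtain ⟨⟨n1, n2⟩, n3⟩ := hcon
      have hxB : ¬ GoodSmooth k f n r lam β γ K x := hxB
      apply hxB
      exact good_det b Ψ σ hσ0 κ hκ hσκ k f w V Q β γ hV hQ hγ0 hw M hM1 n r hr hrn lam hlam x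
        (fun i l => hSk _ (hx i).1 _ (hx l).1) (fun i => (hx i).2) (not_lt.1 n1) (not_lt.1 n2)
        (not_lt.1 n3)
    refine (measure_mono_ae hsub).trans ?_
    refine (measure_union_le _ _).trans ?_
    refine (add_le_add_left (measure_union_le _ _) _).trans ?_
    refine (add_le_add (add_le_add (hprob r le_rfl) (hprob n hrn))
      (leverage_prob ρ P (fun l x => x l) (fun l => measurable_pi_apply l) hlaw b Ψ σ hσ0 hmeas κ hκ hσ r hr
        lam (Q * lam ^ (-γ)) M hlam0 (by positivity) (by linarith) (hT lam hlam0))).trans ?_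
    rw [← ENNReal.ofReal_add (by positivity) (by positivity),
      ← ENNReal.ofReal_add (by positivity) (by positivity)]
    refine ENNReal.ofReal_le_ofReal (le_trans (le_of_eq ?_) hM2)
    ring
  refine ⟨(toMeasurable ρ Bad)ᶜ, (measurableSet_toMeasurable _ _).compl, ?_, fun zs hzs => ?_⟩
  · rw [compl_compl, measure_toMeasurable]; exact hBle
  · by_contra hcon
    exact hzs (subset_toMeasurable ρ Bad hcon)

/-! ### Part C : spectral decomposition -/

lemma exists_feature {D : Type} (k : D → D → ℝ) (hs : ∀ x y, k x y = k y x) (hpd : PosDefKernel k) :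
    ∃ (H : Type) (_ : NormedAddCommGroup H) (_ : InnerProductSpace ℝ H) (_ : CompleteSpace H)
      (Φ : D → H), (∀ x y, ⟪Φ x, Φ y⟫ = k x y) ∧
        (Submodule.span ℝ (Set.range Φ)).topologicalClosure = ⊤ := by
  let K : Matrix D D (ℝ →L[ℝ] ℝ) := Matrix.of fun x y => k x y • ContinuousLinearMap.id ℝ ℝ
  have hK : K.PosSemidef := by
    have htf := (RKHS.posSemidef_tfae (K := K)).out 0 2
    refine htf.mpr ?_
    refine ⟨?_, fun vv => ?_⟩
    · ext x y : 1
      have hid : star (ContinuousLinearMap.id ℝ ℝ) = ContinuousLinearMap.id ℝ ℝ :=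
        star_one (R := ℝ →L[ℝ] ℝ)
      simp [K, Matrix.conjTranspose_apply, hs y x, hid]
    · have h := hpd vv.support.card (fun i => (vv.support.equivFin.symm i).1)
        (fun i => vv (vv.support.equivFin.symm i).1)
      rw [RCLike.re_to_real]
      refine h.trans (le_of_eq ?_)
      have e : ∀ g : D → ℝ, ∑ i : Fin vv.support.card, g (vv.support.equivFin.symm i).1 =
          ∑ x ∈ vv.support, g x := by
        intro g
        rw [Equiv.sum_comp vv.support.equivFin.symm (fun x : vv.support => g x.1)]
        exact Finset.sum_coe_sort vv.support g
      rw [e (fun x => ∑ j : Fin vv.support.card, vv x * vv (vv.support.equivFin.symm j).1 *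
        k x (vv.support.equivFin.symm j).1), Finsupp.sum]
      refine Finset.sum_congr rfl fun x _ => ?_
      rw [e (fun y => vv x * vv y * k x y), Finsupp.sum]
      refine Finset.sum_congr rfl fun y _ => ?_
      simp [K, hs x y]
      ring
  have : Fact K.PosSemidef := ⟨hK⟩
  refine ⟨RKHS.OfKernel K, inferInstance, inferInstance, inferInstance,
    fun x => RKHS.kerFun (RKHS.OfKernel K) x 1, fun x y => ?_, ?_⟩
  · have h := RKHS.kernel_inner (RKHS.OfKernel K) y x (1 : ℝ) (1 : ℝ)
    rw [RKHS.OfKernel.kernel_ofKernel] at h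
    rw [← h]
    simp [K, hs x y]
  · have h := RKHS.kerFun_dense (RKHS.OfKernel K)
    rw [eq_top_iff, ← h]
    refine Submodule.topologicalClosure_mono (Submodule.span_le.2 ?_)
    rintro _ ⟨x, v, rfl⟩
    have : RKHS.kerFun (RKHS.OfKernel K) x v = v • RKHS.kerFun (RKHS.OfKernel K) x 1 := by
      rw [← map_smul]; simp
    rw [SetLike.mem_coe, this]
    exact Submodule.smul_mem _ _ (Submodule.subset_span ⟨x, rfl⟩)

lemma compact_of_HS {E ι : Type*} [NormedAddCommGroup E] [InnerProductSpace ℝ E] [CompleteSpace E]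
    (L : E →L[ℝ] E) (e : HilbertBasis ι ℝ E) (C : ℝ) (hC : ∀ F : Finset ι, ∑ i ∈ F, ‖L (e i)‖ ^ 2 ≤ C) :
    IsCompactOperator L := by
  classical
  have hsum : Summable fun i => ‖L (e i)‖ ^ 2 :=
    summable_of_sum_le (fun i => sq_nonneg _) hC
  let LF : Finset ι → (E →L[ℝ] E) := fun F => ∑ i ∈ F, (innerSL ℝ (e i)).smulRight (L (e i))
  have hLF : ∀ F, IsCompactOperator (LF F) := by
    intro F
    have hrank : ∀ i, IsCompactOperator ((innerSL ℝ (e i)).smulRight (L (e i)) : E →L[ℝ] E) := by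
      intro i
      have h1 : IsCompactOperator (ContinuousLinearMap.toSpanSingleton ℝ (L (e i)) : ℝ →L[ℝ] E) :=
        isCompactOperator_of_locallyCompactSpace_rng _
      have h2 := h1.comp_clm (innerSL ℝ (e i))
      have : (((innerSL ℝ (e i)).smulRight (L (e i)) : E →L[ℝ] E) : E → E) =
          (ContinuousLinearMap.toSpanSingleton ℝ (L (e i))) ∘ (innerSL ℝ (e i)) := by
        ext x; simp
      rw [this]; exact h2
    induction F using Finset.induction_on with
    | empty => simp only [LF, Finset.sum_empty]; exact isCompactOperator_zero
    | insert a s ha ih =>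
      have : LF (insert a s) = (innerSL ℝ (e a)).smulRight (L (e a)) + LF s := by
        simp only [LF, Finset.sum_insert ha]
      rw [this]
      have h3 := (hrank a).add ih
      exact h3
  have hlim : Tendsto LF atTop (𝓝 L) := by
    rw [Metric.tendsto_atTop]
    intro ε hε
    have hcau := hsum.tendsto_cofinite_zero
    obtain ⟨F0, hF0⟩ : ∃ F0 : Finset ι, ∀ t : Finset ι, Disjoint t F0 →
        ∑ i ∈ t, ‖L (e i)‖ ^ 2 < (ε / 2) ^ 2 := by
      obtain ⟨s, hs⟩ := summable_iff_vanishing_norm.1 hsum ((ε / 2) ^ 2) (by positivity)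
      refine ⟨s, fun t ht => ?_⟩
      exact lt_of_le_of_lt (le_abs_self _) (hs t ht)
    refine ⟨F0, fun F hF => ?_⟩
    rw [dist_eq_norm]
    refine lt_of_le_of_lt (ContinuousLinearMap.opNorm_le_bound _ (M := ε / 2) (by positivity)
      fun x => ?_) (by linarith)
    have hx : HasSum (fun i => ⟪e i, x⟫ • L (e i)) (L x) := by
      have := (e.hasSum_repr x).mapL L
      simpa [e.repr_apply_apply] using this
    have hx2 : Tendsto (fun G : Finset ι => ‖LF F x - ∑ i ∈ G, ⟪e i, x⟫ • L (e i)‖) atTop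
        (𝓝 ‖LF F x - L x‖) := (tendsto_const_nhds.sub hx).norm
    have : LF F x - L x = (LF F - L) x := by simp
    rw [← this]
    refine le_of_tendsto hx2 ?_
    filter_upwards [eventually_ge_atTop F] with G hG
    have e1 : LF F x = ∑ i ∈ F, ⟪e i, x⟫ • L (e i) := by
      simp [LF]
    rw [e1, norm_sub_rev, ← Finset.sum_sdiff hG, add_sub_cancel_right]
    have hdis : Disjoint (G \ F) F0 :=
      Finset.disjoint_of_subset_right hF Finset.sdiff_disjoint
    refine (norm_sum_le _ _).trans ?_
    refine (Finset.sum_le_sum fun i _ => (norm_smul_le _ _)).trans ?_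
    refine le_of_sq_le_sq ?_ (by positivity)
    refine (Finset.sum_mul_sq_le_sq_mul_sq _ _ _).trans ?_
    have hb1 : ∑ i ∈ G \ F, ‖⟪e i, x⟫‖ ^ 2 ≤ ‖x‖ ^ 2 := by
      have := e.orthonormal.sum_inner_products_le x (s := G \ F)
      exact this
    have hb2 := (hF0 _ hdis).le
    calc _ ≤ ‖x‖ ^ 2 * (ε / 2) ^ 2 := by gcongr
      _ = _ := by ring
  exact isCompactOperator_of_tendsto hlim (Filter.Eventually.of_forall hLF)

lemma exists_eigenbasis {E : Type} [NormedAddCommGroup E] [InnerProductSpace ℝ E] [CompleteSpace E]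
    (L : E →L[ℝ] E) (hsymm : ∀ v w, ⟪L v, w⟫ = ⟪v, L w⟫) (hc : IsCompactOperator L) :
    ∃ (ι : Type) (e : HilbertBasis ι ℝ E) (σ : ι → ℝ), ∀ i, L (e i) = σ i • e i := by
  have hT : (L : E →ₗ[ℝ] E).IsSymmetric := fun v w => hsymm v w
  have hcl : ∀ c : ℝ, CompleteSpace (Module.End.eigenspace (L : E →ₗ[ℝ] E) c) := by
    intro c
    have : IsClosed ((Module.End.eigenspace (L : E →ₗ[ℝ] E) c : Submodule ℝ E) : Set E) := by
      have e : ((Module.End.eigenspace (L : E →ₗ[ℝ] E) c : Submodule ℝ E) : Set E) =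
          {x | L x = c • x} := by
        ext x; simp
      rw [e]
      exact isClosed_eq L.continuous (continuous_const_smul c)
    exact this.completeSpace_coe
  have hB := fun c : ℝ => exists_hilbertBasis ℝ (Module.End.eigenspace (L : E →ₗ[ℝ] E) c)
  choose w bb hbb using hB
  have hon : Orthonormal ℝ fun a : Σ c : ℝ, w c =>
      ((bb a.1 a.2 : Module.End.eigenspace (L : E →ₗ[ℝ] E) a.1) : E) :=
    hT.orthogonalFamily_eigenspaces.orthonormal_sigma_orthonormal (fun c => (bb c).orthonormal)
  have hcomp : (Submodule.span ℝ (Set.range fun a : Σ c : ℝ, w c =>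
      ((bb a.1 a.2 : Module.End.eigenspace (L : E →ₗ[ℝ] E) a.1) : E)))ᗮ = ⊥ := by
    rw [eq_bot_iff, ← ContinuousLinearMap.orthogonalComplement_iSup_eigenspaces_eq_bot hc hT]
    intro x hx
    rw [Submodule.mem_orthogonal] at hx ⊢
    have hx' : ∀ c, ∀ u ∈ Module.End.eigenspace (L : E →ₗ[ℝ] E) c, ⟪u, x⟫ = 0 := by
      intro c u hu
      have hsum := (bb c).hasSum_repr ⟨u, hu⟩
      have h2 := hsum.mapL ((innerSL ℝ x) ∘L (Submodule.subtypeL _))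
      rw [real_inner_comm]
      have h3 : ∀ i, ((innerSL ℝ x) ∘L (Submodule.subtypeL _)) ((bb c).repr ⟨u, hu⟩ i • bb c i) = 0 := by
        intro i
        rw [map_smul]
        have := hx _ (Submodule.subset_span ⟨⟨c, i⟩, rfl⟩)
        rw [real_inner_comm] at this
        simp [this]
      simp only [h3] at h2
      exact h2.unique hasSum_zero
    intro u hu
    have : (⨆ c, Module.End.eigenspace (L : E →ₗ[ℝ] E) c) ≤ (Submodule.span ℝ {x})ᗮ := by
      refine iSup_le fun c u hu => ?_
      rw [Submodule.mem_orthogonal_singleton_iff_inner_right, real_inner_comm]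
      exact hx' c u hu
    have := this hu
    rw [Submodule.mem_orthogonal_singleton_iff_inner_right, real_inner_comm] at this
    exact this
  refine ⟨Σ c : ℝ, w c, HilbertBasis.mkOfOrthogonalEqBot hon hcomp, fun a => a.1, fun a => ?_⟩
  rw [HilbertBasis.coe_mkOfOrthogonalEqBot]
  have := (bb a.1 a.2 : Module.End.eigenspace (L : E →ₗ[ℝ] E) a.1).2
  rw [Module.End.mem_eigenspace_iff] at this
  exact this

lemma countable_of_hilbertBasis {E ι : Type*} [NormedAddCommGroup E] [InnerProductSpace ℝ E]
    [TopologicalSpace.SeparableSpace E] (e : HilbertBasis ι ℝ E) : Countable ι := by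
  have hd : Pairwise fun i j => Disjoint (Metric.ball (e i) (1 / 2)) (Metric.ball (e j) (1 / 2)) := by
    intro i j hij
    refine Metric.ball_disjoint_ball ?_
    rw [dist_eq_norm]
    have h : ‖e i - e j‖ ^ 2 = 2 := by
      rw [norm_sub_sq_real, e.orthonormal.1 i, e.orthonormal.1 j, e.orthonormal.2 hij]; norm_num
    nlinarith [norm_nonneg (e i - e j)]
  exact Pairwise.countable_of_isOpen_disjoint hd (fun i => Metric.isOpen_ball)
    (fun i => ⟨e i, Metric.mem_ball_self (by norm_num)⟩)


/-! ### Part C2 : singular value decomposition and consequences -/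

section SVD

variable {H G ι : Type} [NormedAddCommGroup H] [InnerProductSpace ℝ H] [CompleteSpace H]
  [NormedAddCommGroup G] [InnerProductSpace ℝ G] [CompleteSpace G]

lemma svd_inner (A : H →L[ℝ] G) (b : HilbertBasis ι ℝ H) (σ : ι → ℝ)
    (hσ : ∀ u, A.adjoint (A (b u)) = σ u • b u) [DecidableEq ι] (u v : ι) :
    ⟪A (b u), A (b v)⟫ = if u = v then σ u else 0 := by
  rw [← ContinuousLinearMap.adjoint_inner_left, hσ, real_inner_smul_left,
    orthonormal_iff_ite.1 b.orthonormal u v]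
  split_ifs <;> simp

lemma svd_nonneg (A : H →L[ℝ] G) (b : HilbertBasis ι ℝ H) (σ : ι → ℝ)
    (hσ : ∀ u, A.adjoint (A (b u)) = σ u • b u) (u : ι) : 0 ≤ σ u := by
  classical
  have := svd_inner A b σ hσ u u
  rw [if_pos rfl] at this
  rw [← this]; exact real_inner_self_nonneg

lemma svd_basis (A : H →L[ℝ] G) (b : HilbertBasis ι ℝ H) (σ : ι → ℝ)
    (hσ : ∀ u, A.adjoint (A (b u)) = σ u • b u) :
    ∃ (w2 : Set G) (B : HilbertBasis w2 ℝ G) (em : {u // 0 < σ u} → w2), Function.Injective em ∧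
      (∀ u, B (em u) = (Real.sqrt (σ u))⁻¹ • A (b u)) ∧
      (∀ x, x ∉ Set.range em → A.adjoint (B x) = 0) := by
  classical
  set ee : {u // 0 < σ u} → G := fun u => (Real.sqrt (σ u))⁻¹ • A (b u) with hee
  have hon : Orthonormal ℝ ee := by
    rw [orthonormal_iff_ite]
    intro u v
    simp only [hee, real_inner_smul_left, real_inner_smul_right, svd_inner A b σ hσ]
    by_cases h : u = v
    · subst h
      have h1 := u.2
      have h2 : Real.sqrt (σ u) ≠ 0 := (Real.sqrt_pos.2 h1).ne'
      rw [if_pos rfl, if_pos rfl]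
      field_simp
      rw [Real.sq_sqrt h1.le]
    · rw [if_neg h, if_neg (fun h' => h (Subtype.ext h'))]; simp
  obtain ⟨w2, B, hsub, hB⟩ := hon.toSubtypeRange.exists_hilbertBasis_extension
  refine ⟨w2, B, fun u => ⟨ee u, hsub ⟨u, rfl⟩⟩, ?_, ?_, ?_⟩
  · intro u v huv
    exact hon.linearIndependent.injective (Subtype.ext_iff.1 huv)
  · intro u; rw [hB]
  · intro x hx
    have hz : ∀ u, ⟪b u, A.adjoint (B x)⟫ = 0 := by
      intro u
      rw [ContinuousLinearMap.adjoint_inner_right]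
      rcases (svd_nonneg A b σ hσ u).lt_or_eq with h | h
      · have hne : (⟨ee ⟨u, h⟩, hsub ⟨⟨u, h⟩, rfl⟩⟩ : w2) ≠ x := fun h' => hx ⟨⟨u, h⟩, h'⟩
        have := B.orthonormal.2 hne
        rw [hB] at this ⊢
        simp only [hee, real_inner_smul_left] at this
        rcases mul_eq_zero.1 this with h3 | h3
        · exact absurd h3 (inv_ne_zero (Real.sqrt_pos.2 h).ne')
        · exact h3
      · have := svd_inner A b σ hσ u u
        rw [if_pos rfl, ← h, inner_self_eq_zero] at this
        rw [this, inner_zero_left]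
    have hsum := b.hasSum_repr (A.adjoint (B x))
    simp only [b.repr_apply_apply, hz, zero_smul] at hsum
    exact hsum.unique hasSum_zero

lemma svd_isUnit (A : H →L[ℝ] G) (s : ℝ) (hs : 0 < s) :
    IsUnit ((A ∘L A.adjoint) + s • (1 : G →L[ℝ] G)) := by
  refine ContinuousLinearMap.isUnit_of_forall_le_norm_inner_map _ (c := ⟨s, hs.le⟩) hs fun x => ?_
  have h : ⟪((A ∘L A.adjoint) + s • (1 : G →L[ℝ] G)) x, x⟫ = ‖A.adjoint x‖ ^ 2 + s * ‖x‖ ^ 2 := by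
    simp only [add_apply, ContinuousLinearMap.coe_comp, Function.comp, smul_apply,
      ContinuousLinearMap.one_apply, inner_add_left, real_inner_smul_left, real_inner_self_eq_norm_sq]
    rw [← ContinuousLinearMap.adjoint_inner_right, real_inner_self_eq_norm_sq]
  rw [h, Real.norm_of_nonneg (by positivity)]
  change ‖x‖ ^ 2 * s ≤ _
  nlinarith [sq_nonneg ‖A.adjoint x‖]

lemma svd_trace (A : H →L[ℝ] G) (b : HilbertBasis ι ℝ H) (σ : ι → ℝ)
    (hσ : ∀ u, A.adjoint (A (b u)) = σ u • b u) (hsum : Summable σ) (s : ℝ) (hs : 0 < s) (M : ℝ)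
    (hM : ∀ (κ : Type) (e : HilbertBasis κ ℝ G),
      ∑' i, ⟪(Ring.inverse ((A ∘L A.adjoint) + s • (1 : G →L[ℝ] G)) * (A ∘L A.adjoint)) (e i), e i⟫ ≤ M) :
    ∑' u, ENNReal.ofReal (σ u / (σ u + s)) ≤ ENNReal.ofReal M := by
  classical
  obtain ⟨w2, B, em, hinj, hem, hex⟩ := svd_basis A b σ hσ
  have h0 := svd_nonneg A b σ hσ
  have hU := svd_isUnit A s hs
  set U := (A ∘L A.adjoint) + s • (1 : G →L[ℝ] G) with hUdef
  have hval : ∀ u, ⟪(Ring.inverse U * (A ∘L A.adjoint)) (B (em u)), B (em u)⟫ = σ u / (σ u + s) := by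
    intro u
    have hL : (A ∘L A.adjoint) (B (em u)) = σ u • B (em u) := by
      rw [hem, map_smul, ContinuousLinearMap.coe_comp, Function.comp, hσ, map_smul, smul_comm]
    have hUe : U (B (em u)) = (σ u + s) • B (em u) := by
      rw [hUdef, add_apply, hL, smul_apply, ContinuousLinearMap.one_apply, add_smul]
    have hpos : 0 < σ u + s := by have := h0 u; positivity
    have hinv : Ring.inverse U (B (em u)) = (σ u + s)⁻¹ • B (em u) := by
      have h1 : Ring.inverse U (U (B (em u))) = B (em u) := by
        have := Ring.inverse_mul_cancel U hU
        exact congrArg (fun T : G →L[ℝ] G => T (B (em u))) this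
      rw [hUe, map_smul] at h1
      rw [← h1, smul_smul, inv_mul_cancel₀ hpos.ne', one_smul, h1]
    rw [ContinuousLinearMap.mul_apply, hL, map_smul, hinv, real_inner_smul_left,
      real_inner_smul_left, real_inner_self_eq_norm_sq, B.orthonormal.1]
    field_simp
  have hzero : ∀ x, x ∉ Set.range em → ⟪(Ring.inverse U * (A ∘L A.adjoint)) (B x), B x⟫ = 0 := by
    intro x hx
    rw [ContinuousLinearMap.mul_apply, ContinuousLinearMap.coe_comp, Function.comp, hex x hx]
    simp
  have hq : ∀ u, 0 ≤ σ u / (σ u + s) := fun u => div_nonneg (h0 u) (by have := h0 u; positivity)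
  have hsq : Summable fun u => σ u / (σ u + s) := by
    refine Summable.of_nonneg_of_le hq (fun u => ?_) (hsum.mul_left s⁻¹)
    rw [div_eq_inv_mul]
    exact mul_le_mul_of_nonneg_right (inv_anti₀ hs (by linarith [h0 u])) (h0 u)
  have h1 := hM w2 B
  have h2 : ∑' i, ⟪(Ring.inverse U * (A ∘L A.adjoint)) (B i), B i⟫ =
      ∑' u : {u // 0 < σ u}, σ u / (σ u + s) := by
    rw [← hinj.tsum_eq (f := fun i => ⟪(Ring.inverse U * (A ∘L A.adjoint)) (B i), B i⟫)]
    · exact tsum_congr hval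
    · intro x hx
      by_contra hx'
      exact hx (hzero x hx')
  have h3 : ∑' u : {u // 0 < σ u}, σ u / (σ u + s) = ∑' u, σ u / (σ u + s) := by
    refine Subtype.val_injective.tsum_eq (f := fun u => σ u / (σ u + s)) ?_
    intro u hu
    rcases (h0 u).lt_or_eq with h | h
    · exact ⟨⟨u, h⟩, rfl⟩
    · exfalso; apply hu; simp [← h]
  rw [← ENNReal.ofReal_tsum_of_nonneg hq hsq]
  refine ENNReal.ofReal_le_ofReal ?_
  rw [← h3, ← h2]; exact h1

lemma svd_source (A : H →L[ℝ] G) (b : HilbertBasis ι ℝ H) (σ : ι → ℝ)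
    (hσ : ∀ u, A.adjoint (A (b u)) = σ u • b u) (κ : ℝ) (hκ : ∀ u, σ u ≤ κ)
    (β : ℝ) (hβ1 : 1 < β) (hβ2 : β ≤ 2) (P : G →L[ℝ] G)
    (hP : IsFracPower (A ∘L A.adjoint) (β / 2) P) (g : G) :
    ∃ w : H, A w = P g ∧ ∀ s : ℝ, 0 < s →
      ∑' u, ENNReal.ofReal ((σ u + s)⁻¹ * ⟪b u, w⟫ ^ 2) ≤ ENNReal.ofReal (‖g‖ ^ 2 * s ^ (β - 2)) := by
  classical
  obtain ⟨w2, B, em, hinj, hem, hex⟩ := svd_basis A b σ hσ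
  have h0 := svd_nonneg A b σ hσ
  let gg : ι → ℝ := fun u => if h : 0 < σ u then ⟪B (em ⟨u, h⟩), g⟫ else 0
  have hggsum : ∀ F : Finset ι, ∑ u ∈ F, gg u ^ 2 ≤ ‖g‖ ^ 2 := by
    intro F
    have e1 : ∑ u ∈ F, gg u ^ 2 = ∑ u ∈ F.subtype (fun u => 0 < σ u), ‖⟪B (em u), g⟫‖ ^ 2 := by
      have : ∀ u : {u // 0 < σ u}, ‖⟪B (em u), g⟫‖ ^ 2 = gg u ^ 2 := by
        intro u
        simp only [gg, dif_pos u.2, Real.norm_eq_abs, sq_abs]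
      simp only [this]
      rw [Finset.sum_subtype_eq_sum_filter (fun u => gg u ^ 2), Finset.sum_filter]
      refine Finset.sum_congr rfl fun u _ => ?_
      split_ifs with h
      · rfl
      · simp [gg, h]
    rw [e1]
    exact (B.orthonormal.comp em hinj).sum_inner_products_le g
  let c : ι → ℝ := fun u => σ u ^ ((β - 1) / 2) * gg u
  have hc2 : ∀ u, c u ^ 2 = σ u ^ (β - 1) * gg u ^ 2 := by
    intro u
    simp only [c, mul_pow]
    rw [← Real.rpow_natCast, ← Real.rpow_mul (h0 u)]
    norm_num
  have hsum : Summable fun u => gg u ^ 2 := summable_of_sum_le (fun u => sq_nonneg _) hggsum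
  have hcsum : Summable fun u => c u ^ 2 := by
    refine Summable.of_nonneg_of_le (fun u => sq_nonneg _) (fun u => ?_) (hsum.mul_left (κ ^ (β - 1)))
    rw [hc2]
    exact mul_le_mul_of_nonneg_right (Real.rpow_le_rpow (h0 u) (hκ u) (by linarith)) (sq_nonneg _)
  have hmem : Memℓp c 2 := by
    rw [memℓp_gen_iff (by norm_num)]
    simpa using hcsum
  let w : H := b.repr.symm ⟨c, hmem⟩
  have hw : ∀ u, ⟪b u, w⟫ = c u := by
    intro u
    rw [← b.repr_apply_apply]
    simp [w]
  refine ⟨w, ?_, ?_⟩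
  · have key : ∀ x, ⟪B x, A w⟫ = ⟪B x, P g⟫ := by
      intro x
      rw [← hP.1 (B x) g, ← ContinuousLinearMap.adjoint_inner_left]
      by_cases hx : x ∈ Set.range em
      · obtain ⟨u, rfl⟩ := hx
        have hL : (A ∘L A.adjoint) (B (em u)) = σ u • B (em u) := by
          rw [hem, map_smul, ContinuousLinearMap.coe_comp, Function.comp, hσ, map_smul, smul_comm]
        rw [hP.2 _ _ hL, real_inner_smul_left]
        have : A.adjoint (B (em u)) = (Real.sqrt (σ u))⁻¹ • σ u • b u := by
          rw [hem, map_smul, hσ]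
        rw [this, real_inner_smul_left, real_inner_smul_left, hw]
        have hu := u.2
        simp only [c, gg, dif_pos hu]
        have e2 : (Real.sqrt (σ u))⁻¹ * (σ u * (σ u ^ ((β - 1) / 2) * ⟪B (em u), g⟫)) =
          ((Real.sqrt (σ u))⁻¹ * σ u * σ u ^ ((β - 1) / 2)) * ⟪B (em u), g⟫ := by ring
        have e3 : (Real.sqrt (σ u))⁻¹ * σ u = σ u ^ ((1 : ℝ) / 2) := by
          rw [← Real.sqrt_eq_rpow]
          have h2 : Real.sqrt (σ u) ≠ 0 := (Real.sqrt_pos.2 hu).ne'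
          field_simp
          rw [Real.sq_sqrt hu.le]
        rw [e2, e3, ← Real.rpow_add hu]
        congr 2
        ring
      · have hL : (A ∘L A.adjoint) (B x) = (0 : ℝ) • B x := by
          rw [ContinuousLinearMap.coe_comp, Function.comp, hex x hx]; simp
        rw [hP.2 _ _ hL, hex x hx, Real.zero_rpow (by linarith), zero_smul]
        simp
    refine B.repr.injective ?_
    ext x
    rw [B.repr_apply_apply, B.repr_apply_apply, key]
  · intro s hs
    have hb : ∀ u, (σ u + s)⁻¹ * ⟪b u, w⟫ ^ 2 ≤ s ^ (β - 2) * gg u ^ 2 := by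
      intro u
      rw [hw, hc2]
      have hp : 0 < σ u + s := by have := h0 u; positivity
      have h1 : (σ u + s)⁻¹ * σ u ^ (β - 1) ≤ s ^ (β - 2) := by
        calc (σ u + s)⁻¹ * σ u ^ (β - 1) ≤ (σ u + s)⁻¹ * (σ u + s) ^ (β - 1) := by
              refine mul_le_mul_of_nonneg_left (Real.rpow_le_rpow (h0 u) (by linarith) (by linarith))
                (by positivity)
          _ = (σ u + s) ^ (β - 2) := by
              rw [← Real.rpow_neg_one, ← Real.rpow_add hp]; congr 1; ring
          _ ≤ s ^ (β - 2) := Real.rpow_le_rpow_of_nonpos hs (by linarith [h0 u]) (by linarith)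
      calc _ = ((σ u + s)⁻¹ * σ u ^ (β - 1)) * gg u ^ 2 := by ring
        _ ≤ _ := mul_le_mul_of_nonneg_right h1 (sq_nonneg _)
    refine (ENNReal.tsum_le_tsum fun u => ENNReal.ofReal_le_ofReal (hb u)).trans ?_
    rw [← ENNReal.ofReal_tsum_of_nonneg (fun u => by positivity) (hsum.mul_left _), tsum_mul_left]
    refine ENNReal.ofReal_le_ofReal ?_
    rw [mul_comm]
    exact mul_le_mul_of_nonneg_right (hsum.tsum_le_of_sum_le hggsum) (by positivity)

end SVD


/-! ### Part C3 : the good event for a continuous kernel -/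

lemma feature_continuous {D H : Type} [TopologicalSpace D] [NormedAddCommGroup H]
    [InnerProductSpace ℝ H] (k : D → D → ℝ) (hcont : Continuous fun q : D × D => k q.1 q.2)
    (Φ : D → H) (hΦ : ∀ x y, ⟪Φ x, Φ y⟫ = k x y) : Continuous Φ := by
  rw [continuous_iff_continuousAt]
  intro x
  rw [ContinuousAt, tendsto_iff_norm_sub_tendsto_zero]
  have h1 : ∀ y, ‖Φ y - Φ x‖ = Real.sqrt (k y y - 2 * k y x + k x x) := by
    intro y
    rw [← hΦ, ← hΦ, ← hΦ, real_inner_self_eq_norm_sq, real_inner_self_eq_norm_sq,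
      ← norm_sub_sq_real, Real.sqrt_sq (norm_nonneg _)]
  simp only [h1]
  have h2 : Continuous fun y => Real.sqrt (k y y - 2 * k y x + k x x) := by
    refine Real.continuous_sqrt.comp ?_
    have ha : Continuous fun y => k y y :=
      hcont.comp (Continuous.prodMk continuous_id continuous_id)
    have hb : Continuous fun y => k y x :=
      hcont.comp (Continuous.prodMk continuous_id continuous_const)
    exact (ha.sub (hb.const_mul 2)).add continuous_const
  have h3 := h2.tendsto x
  have h4 : Real.sqrt (k x x - 2 * k x x + k x x) = 0 := by
    rw [show k x x - 2 * k x x + k x x = 0 by ring, Real.sqrt_zero]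
  rwa [h4] at h3

lemma good_event_kernel {D : Type} [TopologicalSpace D] [TopologicalSpace.SeparableSpace D]
    [MeasurableSpace D] [BorelSpace D] (P : Measure D) [IsProbabilityMeasure P]
    (ρ : Measure (ℕ → D)) [IsProbabilityMeasure ρ]
    (hind : iIndepFun (fun i (x : ℕ → D) => x i) ρ) (hlaw : ∀ i, ρ.map (fun x => x i) = P)
    (k : D → D → ℝ) (hs : ∀ x y, k x y = k y x) (hpd : PosDefKernel k) (hbdd : BoundedKernel k)
    (hcont : Continuous fun q : D × D => k q.1 q.2)
    (L Lβ : Lp ℝ 2 P →L[ℝ] Lp ℝ 2 P)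
    (hL : ∀ g : Lp ℝ 2 P, (L g : D → ℝ) =ᵐ[P] fun z => ∫ z', k z z' * g z' ∂P)
    (Q γ β : ℝ) (hQ : 0 < Q) (hγ0 : 0 ≤ γ) (hβ1 : 1 < β) (hβ2 : β ≤ 2)
    (hTr : TraceAssumption P L Q γ) (hLβ : IsFracPower L (β / 2) Lβ)
    (f f' : D → ℝ) (hff' : f' =ᵐ[P] f) (hfm : MemLp f 2 P) (hf : MemLp.toLp f hfm ∈ Set.range Lβ)
    (η : ℝ) (hη : 0 < η) :
    ∃ K : ℝ, 0 ≤ K ∧ ∀ n r : ℕ, 1 ≤ r → r ≤ n → ∃ G : Set (ℕ → D), MeasurableSet G ∧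
      ρ Gᶜ ≤ ENNReal.ofReal η ∧
      ∀ zs ∈ G, GoodSmooth k f' n r ((r : ℝ) ^ (-(1 / (1 + γ)))) β γ K zs := by
  classical
  obtain ⟨H, i1, i2, i3, Φ, hΦ, hdense⟩ := exists_feature k hs hpd
  have hΦc := feature_continuous k hcont Φ hΦ
  have hsep : TopologicalSpace.SeparableSpace H := by
    rw [← TopologicalSpace.isSeparable_univ_iff]
    have h1 := ((TopologicalSpace.isSeparable_range hΦc).span (R := ℝ)).closure
    rw [← Submodule.topologicalClosure_coe, hdense] at h1
    simpa using h1
  obtain ⟨κ, hκ⟩ := hbdd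
  have hκΦ : ∀ z, ‖Φ z‖ ^ 2 ≤ κ := by
    intro z
    rw [← real_inner_self_eq_norm_sq, hΦ]
    exact (le_abs_self _).trans (hκ z z)
  have hne : Nonempty D := by
    by_contra h
    rw [not_nonempty_iff] at h
    have := measure_univ (μ := P)
    simp [Measure.eq_zero_of_isEmpty P] at this
  have hκ0 : 0 ≤ κ := (sq_nonneg _).trans (hκΦ (Classical.arbitrary D))
  have hΦn : ∀ z, ‖Φ z‖ ≤ Real.sqrt κ := fun z => Real.le_sqrt_of_sq_le (hκΦ z)
  have hcm : ∀ h : H, Continuous fun z => ⟪h, Φ z⟫ := fun h => continuous_const.inner hΦc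
  have hbd : ∀ (h : H) z, ‖⟪h, Φ z⟫‖ ≤ Real.sqrt κ * ‖h‖ := by
    intro h z
    refine (norm_inner_le_norm _ _).trans ?_
    rw [mul_comm]; exact mul_le_mul_of_nonneg_right (hΦn z) (norm_nonneg _)
  have hmem : ∀ h : H, MemLp (fun z => ⟪h, Φ z⟫) 2 P := fun h =>
    MemLp.of_bound (hcm h).measurable.aestronglyMeasurable (Real.sqrt κ * ‖h‖)
      (Filter.Eventually.of_forall (hbd h))
  let A0 : H →ₗ[ℝ] Lp ℝ 2 P :=
    { toFun := fun h => (hmem h).toLp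
      map_add' := by
        intro u v
        rw [← MemLp.toLp_add]
        congr 1
        ext z; simp [inner_add_left]
      map_smul' := by
        intro c v
        rw [RingHom.id_apply, ← MemLp.toLp_const_smul]
        congr 1
        ext z; simp [real_inner_smul_left] }
  let A : H →L[ℝ] Lp ℝ 2 P := A0.mkContinuous (Real.sqrt κ) (by
    intro h
    refine (Lp.norm_le_of_ae_bound (C := Real.sqrt κ * ‖h‖) (by positivity) ?_).trans (le_of_eq ?_)
    · filter_upwards [(hmem h).coeFn_toLp] with z hz
      change ‖((hmem h).toLp : D → ℝ) z‖ ≤ _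
      rw [hz]; exact hbd h z
    · simp [measureUnivNNReal])
  have hA : ∀ h, (A h : D → ℝ) =ᵐ[P] fun z => ⟪h, Φ z⟫ := fun h => (hmem h).coeFn_toLp
  have hAA : ∀ u v : H, ⟪A u, A v⟫ = ∫ z, ⟪u, Φ z⟫ * ⟪v, Φ z⟫ ∂P := by
    intro u v
    rw [L2.inner_def]
    refine integral_congr_ae ?_
    filter_upwards [hA u, hA v] with z h1 h2
    rw [h1, h2]; simp [mul_comm]
  have hLA : L = A ∘L A.adjoint := by
    ext1 g
    refine Lp.ext ?_
    refine (hL g).trans ?_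
    refine EventuallyEq.trans ?_ (hA (A.adjoint g)).symm
    refine Filter.Eventually.of_forall fun z => ?_
    change _ = ⟪A.adjoint g, Φ z⟫
    rw [ContinuousLinearMap.adjoint_inner_left, L2.inner_def]
    refine integral_congr_ae ?_
    filter_upwards [hA (Φ z)] with z' h1
    rw [h1, hΦ]; simp
  -- compactness of the covariance operator
  have hC : IsCompactOperator (A.adjoint ∘L A) := by
    obtain ⟨w0, e, he⟩ := exists_hilbertBasis ℝ H
    refine compact_of_HS _ e (‖A.adjoint‖ ^ 2 * κ) fun F => ?_
    have h1 : ∀ u : w0, ‖(A.adjoint ∘L A) (e u)‖ ^ 2 ≤ ‖A.adjoint‖ ^ 2 * ∫ z, ⟪e u, Φ z⟫ ^ 2 ∂P := by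
      intro u
      have h2 : ‖A (e u)‖ ^ 2 = ∫ z, ⟪e u, Φ z⟫ ^ 2 ∂P := by
        rw [← real_inner_self_eq_norm_sq, hAA]; simp only [sq]
      rw [← h2, ← mul_pow]
      exact pow_le_pow_left₀ (norm_nonneg _) (A.adjoint.le_opNorm _) 2
    refine (Finset.sum_le_sum fun u _ => h1 u).trans ?_
    rw [← Finset.mul_sum]
    refine mul_le_mul_of_nonneg_left ?_ (sq_nonneg _)
    rw [← integral_finsetSum _ fun u _ => (hmem (e u)).integrable_sq]
    calc ∫ z, ∑ u ∈ F, ⟪e u, Φ z⟫ ^ 2 ∂P ≤ ∫ _, κ ∂P := by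
          refine integral_mono (integrable_finsetSum _ fun u _ => (hmem (e u)).integrable_sq)
            (integrable_const _) fun z => ?_
          have h3 := e.orthonormal.sum_inner_products_le (Φ z) (s := F)
          simp only [Real.norm_eq_abs, sq_abs] at h3
          exact h3.trans (hκΦ z)
      _ = κ := by simp
  obtain ⟨ι, b, σ, hb⟩ := exists_eigenbasis (A.adjoint ∘L A) (by
    intro v w
    simp only [ContinuousLinearMap.coe_comp, Function.comp]
    rw [ContinuousLinearMap.adjoint_inner_left, ContinuousLinearMap.adjoint_inner_right]) hC
  have hσ : ∀ u, A.adjoint (A (b u)) = σ u • b u := hb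
  have hcount := countable_of_hilbertBasis b
  have h0 := svd_nonneg A b σ hσ
  have hσint : ∀ i j, ∫ z, ⟪b i, Φ z⟫ * ⟪b j, Φ z⟫ ∂P = if i = j then σ i else 0 := by
    intro i j
    rw [← hAA, svd_inner A b σ hσ]
  have hσF : ∀ F : Finset ι, ∑ u ∈ F, σ u ≤ κ := by
    intro F
    have h1 : ∀ u, σ u = ∫ z, ⟪b u, Φ z⟫ ^ 2 ∂P := by
      intro u
      have := hσint u u
      rw [if_pos rfl] at this
      rw [← this]; simp only [sq]
    simp only [h1]
    rw [← integral_finsetSum _ fun u _ => (hmem (b u)).integrable_sq]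
    calc ∫ z, ∑ u ∈ F, ⟪b u, Φ z⟫ ^ 2 ∂P ≤ ∫ _, κ ∂P := by
          refine integral_mono (integrable_finsetSum _ fun u _ => (hmem (b u)).integrable_sq)
            (integrable_const _) fun z => ?_
          have h3 := b.orthonormal.sum_inner_products_le (Φ z) (s := F)
          simp only [Real.norm_eq_abs, sq_abs] at h3
          exact h3.trans (hκΦ z)
      _ = κ := by simp
  have hsumm : Summable σ := summable_of_sum_le h0 hσF
  have hσκ : ∀ u, σ u ≤ κ := fun u => by simpa using hσF {u}
  obtain ⟨g, hg⟩ := hf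
  rw [hLA] at hLβ
  obtain ⟨w, hw1, hw2⟩ := svd_source A b σ hσ κ hσκ β hβ1 hβ2 Lβ hLβ g
  have hfw : ∀ᵐ z ∂P, f' z = ⟪w, Φ z⟫ := by
    have h1 : A w = MemLp.toLp f hfm := by rw [hw1, hg]
    have h2 := hA w
    rw [h1] at h2
    filter_upwards [h2, hfm.coeFn_toLp, hff'] with z h3 h4 h5
    rw [h5, ← h4, h3]
  refine good_event P ρ hind hlaw b Φ σ h0 (fun i => (hcm (b i)).measurable) κ hκΦ hσκ hσint k f' w
    Set.univ (Filter.Eventually.of_forall fun _ => trivial) (fun z _ z' _ => (hΦ z z').symm) hfw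
    (‖g‖ ^ 2) Q β γ (sq_nonneg _) hQ hγ0 (fun s hs => ?_) hw2 η hη
  refine svd_trace A b σ hσ hsumm s hs (Q * s ^ (-γ)) fun κ' e => ?_
  have := hTr s hs κ' e
  rwa [hLA] at this


/-! ### Part D : bounded measurable functions and conditional variance bounds -/

def BM {X : Type*} [MeasurableSpace X] (f : X → ℝ) : Prop :=
  Measurable f ∧ ∃ C : ℝ, ∀ x, |f x| ≤ C

namespace BM

variable {X X' : Type*} [MeasurableSpace X] [MeasurableSpace X']

lemma const (c : ℝ) : BM fun _ : X => c := ⟨measurable_const, |c|, fun _ => le_rfl⟩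

lemma add {f g : X → ℝ} (hf : BM f) (hg : BM g) : BM fun x => f x + g x := by
  obtain ⟨hf, C, hC⟩ := hf
  obtain ⟨hg, D, hD⟩ := hg
  exact ⟨hf.add hg, C + D, fun x => (abs_add_le _ _).trans (add_le_add (hC x) (hD x))⟩

lemma neg {f : X → ℝ} (hf : BM f) : BM fun x => - f x := by
  obtain ⟨hf, C, hC⟩ := hf
  exact ⟨hf.neg, C, fun x => by rw [abs_neg]; exact hC x⟩

lemma sub {f g : X → ℝ} (hf : BM f) (hg : BM g) : BM fun x => f x - g x := by
  simpa only [sub_eq_add_neg] using hf.add hg.neg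

lemma mul {f g : X → ℝ} (hf : BM f) (hg : BM g) : BM fun x => f x * g x := by
  obtain ⟨hf, C, hC⟩ := hf
  obtain ⟨hg, D, hD⟩ := hg
  refine ⟨hf.mul hg, C * D, fun x => ?_⟩
  rw [abs_mul]
  exact mul_le_mul (hC x) (hD x) (abs_nonneg _) ((abs_nonneg _).trans (hC x))

lemma sq {f : X → ℝ} (hf : BM f) : BM fun x => f x ^ 2 := by
  simpa only [pow_two] using hf.mul hf

lemma sum {ι : Type*} {f : ι → X → ℝ} (s : Finset ι) (hf : ∀ i ∈ s, BM (f i)) :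
    BM fun x => ∑ i ∈ s, f i x := by
  classical
  induction s using Finset.induction_on with
  | empty => simpa using const (X := X) 0
  | insert a s ha ih =>
    simp only [Finset.sum_insert ha]
    exact (hf a (Finset.mem_insert_self _ _)).add (ih fun i hi => hf i (Finset.mem_insert_of_mem hi))

lemma comp {f : X → ℝ} (hf : BM f) {g : X' → X} (hg : Measurable g) : BM fun x => f (g x) :=
  ⟨hf.1.comp hg, hf.2.choose, fun x => hf.2.choose_spec _⟩

lemma integrable {f : X → ℝ} (hf : BM f) (μ : Measure X) [IsFiniteMeasure μ] : Integrable f μ := by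
  obtain ⟨hf, C, hC⟩ := hf
  exact Integrable.of_bound hf.aestronglyMeasurable C (Filter.Eventually.of_forall hC)

lemma of_sq_le {f : X → ℝ} (hf : Measurable f) (K : ℝ) (h : ∀ x, f x ^ 2 ≤ K) : BM f :=
  ⟨hf, Real.sqrt K, fun x => Real.abs_le_sqrt (h x)⟩

end BM

section IID

variable {VV PP : Type*} [MeasurableSpace VV] [MeasurableSpace PP]

lemma indep_update (τ : Measure (ℕ → VV)) [IsProbabilityMeasure τ]
    (hind : iIndepFun (fun i (y : ℕ → VV) => y i) τ) (i : ℕ) (v0 : VV) :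
    IndepFun (fun y : ℕ → VV => Function.update y i v0) (fun y : ℕ → VV => y i) τ := by
  have h1 : Indep (⨆ l ∈ ({i}ᶜ : Set ℕ), MeasurableSpace.comap (fun y : ℕ → VV => y l) inferInstance)
      (⨆ l ∈ ({i} : Set ℕ), MeasurableSpace.comap (fun y : ℕ → VV => y l) inferInstance) τ :=
    indep_iSup_of_disjoint (fun l => (measurable_pi_apply l).comap_le) hind
      (by simp)
  rw [IndepFun_iff_Indep]
  refine indep_of_indep_of_le_left (indep_of_indep_of_le_right h1 ?_) ?_
  · simp
  · rw [← measurable_iff_comap_le]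
    refine @measurable_pi_iff _ _ _ (_) _ _ |>.2 fun l => ?_
    by_cases hl : l = i
    · subst hl; simp
    · simp only [Function.update_of_ne hl]
      refine Measurable.mono (comap_measurable (fun y : ℕ → VV => y l)) ?_ le_rfl
      exact le_iSup₂_of_le l hl le_rfl

lemma integral_resample (ρ : Measure VV) [IsProbabilityMeasure ρ]
    (τ : Measure (ℕ → VV)) [IsProbabilityMeasure τ]
    (hind : iIndepFun (fun i (y : ℕ → VV) => y i) τ) (hlaw : ∀ i, τ.map (fun y => y i) = ρ)
    (i : ℕ) (h : (ℕ → VV) → ℝ) (hh : BM h) (hz : ∀ y, ∫ v, h (Function.update y i v) ∂ρ = 0) :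
    ∫ y, h y ∂τ = 0 := by
  have hne : Nonempty VV := by
    by_contra hn
    rw [not_nonempty_iff] at hn
    have := measure_univ (μ := ρ)
    simp [Measure.eq_zero_of_isEmpty ρ] at this
  let v0 : VV := Classical.arbitrary VV
  have hm1 : Measurable fun y : ℕ → VV => Function.update y i v0 := by
    exact measurable_update_left
  have hm2 : Measurable fun y : ℕ → VV => y i := measurable_pi_apply i
  have hmu : Measurable fun q : (ℕ → VV) × VV => Function.update q.1 i q.2 := measurable_update'
  have hI := indep_update τ hind i v0
  rw [indepFun_iff_map_prod_eq_prod_map_map hm1.aemeasurable hm2.aemeasurable, hlaw] at hI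
  have e1 : ∀ y : ℕ → VV, h y = (fun q : (ℕ → VV) × VV => h (Function.update q.1 i q.2))
      (Function.update y i v0, y i) := by
    intro y; simp
  have e2 : ∫ y, h y ∂τ = ∫ y, (fun q : (ℕ → VV) × VV => h (Function.update q.1 i q.2))
      (Function.update y i v0, y i) ∂τ := integral_congr_ae (Filter.Eventually.of_forall e1)
  rw [e2, ← integral_map (φ := fun y : ℕ → VV => (Function.update y i v0, y i))
    (hm1.prodMk hm2).aemeasurable (hh.comp hmu).1.aestronglyMeasurable, hI]
  have : IsProbabilityMeasure (τ.map fun y : ℕ → VV => Function.update y i v0) :=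
    Measure.isProbabilityMeasure_map hm1.aemeasurable
  rw [integral_prod _ ((hh.comp hmu).integrable _)]
  simp [hz]

lemma condvar_bound (ρ : Measure VV) [IsProbabilityMeasure ρ]
    (τ : Measure (ℕ → VV)) [IsProbabilityMeasure τ]
    (hind : iIndepFun (fun i (y : ℕ → VV) => y i) τ) (hlaw : ∀ i, τ.map (fun y => y i) = ρ)
    (π : VV → PP) (hπ : Measurable π) (g : VV → ℝ) (hg : BM g) (M : ℝ) (hM : ∀ v, |g v| ≤ M)
    (horth : ∀ q : PP → ℝ, BM q → ∫ v, q (π v) * g v ∂ρ = 0)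
    (c : ℕ → (ℕ → PP) → ℝ) (n : ℕ) (hc : ∀ i, i < n → BM (c i)) :
    ∫ y, (∑ i ∈ Finset.range n, c i (fun l => π (y l)) * g (y i)) ^ 2 ∂τ ≤
      M ^ 2 * ∫ y, ∑ i ∈ Finset.range n, c i (fun l => π (y l)) ^ 2 ∂τ := by
  have hπm : Measurable fun (y : ℕ → VV) (l : ℕ) => π (y l) :=
    measurable_pi_lambda _ fun l => hπ.comp (measurable_pi_apply l)
  have hcc : ∀ i, i < n → BM fun y : ℕ → VV => c i (fun l => π (y l)) := fun i hi => (hc i hi).comp hπm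
  have hgg : ∀ i : ℕ, BM fun y : ℕ → VV => g (y i) := fun i => hg.comp (measurable_pi_apply i)
  have hcross : ∀ i < n, ∀ j < n, i ≠ j →
      ∫ y, (c i (fun l => π (y l)) * g (y i)) * (c j (fun l => π (y l)) * g (y j)) ∂τ = 0 := by
    intro i hi j hj hij
    refine integral_resample ρ τ hind hlaw i _ (((hcc i hi).mul (hgg i)).mul ((hcc j hj).mul (hgg j)))
      fun y => ?_
    have hupd : ∀ v, (fun l => π (Function.update y i v l)) =
        Function.update (fun l => π (y l)) i (π v) := by
      intro v; ext l
      by_cases hl : l = i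
      · subst hl; simp
      · simp [Function.update_of_ne hl]
    have := horth (fun s => c i (Function.update (fun l => π (y l)) i s) *
      c j (Function.update (fun l => π (y l)) i s) * g (y j))
      ((((hc i hi).comp (measurable_update _)).mul ((hc j hj).comp (measurable_update _))).mul
        (BM.const _))
    rw [← this]
    refine integral_congr_ae (Filter.Eventually.of_forall fun v => ?_)
    simp only [hupd, Function.update_self, Function.update_of_ne hij.symm]
    ring
  have hsq : ∀ y : ℕ → VV, (∑ i ∈ Finset.range n, c i (fun l => π (y l)) * g (y i)) ^ 2 =
      ∑ i ∈ Finset.range n, ∑ j ∈ Finset.range n,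
        (c i (fun l => π (y l)) * g (y i)) * (c j (fun l => π (y l)) * g (y j)) := by
    intro y; rw [pow_two, Finset.sum_mul_sum]
  simp only [hsq]
  have hb : ∀ i ∈ Finset.range n, ∀ j ∈ Finset.range n, BM fun y : ℕ → VV =>
      (c i (fun l => π (y l)) * g (y i)) * (c j (fun l => π (y l)) * g (y j)) := fun i hi j hj =>
    ((hcc i (Finset.mem_range.1 hi)).mul (hgg i)).mul ((hcc j (Finset.mem_range.1 hj)).mul (hgg j))
  rw [integral_finsetSum _ fun i hi => (BM.sum _ (hb i hi)).integrable τ,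
    integral_finsetSum _ fun i hi => ((hcc i (Finset.mem_range.1 hi)).sq).integrable τ,
    Finset.mul_sum]
  refine Finset.sum_le_sum fun i hi => ?_
  rw [integral_finsetSum _ fun j hj => (hb i hi j hj).integrable τ,
    Finset.sum_eq_single_of_mem i hi fun j hj hji =>
      hcross i (Finset.mem_range.1 hi) j (Finset.mem_range.1 hj) hji.symm,
    ← integral_const_mul]
  refine integral_mono ((hb i hi i hi).integrable τ)
    ((BM.const (M ^ 2)).mul ((hcc i (Finset.mem_range.1 hi)).sq) |>.integrable τ) fun y => ?_
  have h1 : g (y i) ^ 2 ≤ M ^ 2 := by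
    rw [← sq_abs]; exact pow_le_pow_left₀ (abs_nonneg _) (hM _) 2
  calc _ = g (y i) ^ 2 * c i (fun l => π (y l)) ^ 2 := by ring
    _ ≤ _ := mul_le_mul_of_nonneg_right h1 (sq_nonneg _)

end IID


/-! ### Part F1 : second moment bounds for the remainder terms -/

section Remainder

variable {VV P1 P2 DZ : Type*} [MeasurableSpace VV] [MeasurableSpace P1] [MeasurableSpace P2]
  [MeasurableSpace DZ]

/-- The noise model: `ε` is a function of `π1`, orthogonal to functions of `π2`. -/
structure Noise (ρ : Measure VV) (π1 : VV → P1) (π2 : VV → P2) (ζ : VV → DZ) (z1 : P1 → DZ)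
    (z2 : P2 → DZ) (ε : P1 → ℝ) (M : ℝ) : Prop where
  mπ1 : Measurable π1
  mπ2 : Measurable π2
  mζ : Measurable ζ
  mz1 : Measurable z1
  mz2 : Measurable z2
  hz1 : ∀ v, ζ v = z1 (π1 v)
  hz2 : ∀ v, ζ v = z2 (π2 v)
  bε : BM ε
  hM : ∀ v, |ε v| ≤ M
  orth : ∀ q : P2 → ℝ, BM q → ∫ v, q (π2 v) * ε (π1 v) ∂ρ = 0

/-- Linear smoother applied to the noise. -/
def smo (A : ℕ → ℕ → (ℕ → DZ) → ℝ) (π1 : VV → P1) (ζ : VV → DZ) (ε : P1 → ℝ) (r i : ℕ)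
    (y : ℕ → VV) : ℝ :=
  ∑ l ∈ Finset.range r, A i l (fun m => ζ (y m)) * ε (π1 (y l))

variable {ρ : Measure VV} [IsProbabilityMeasure ρ]
    {τ : Measure (ℕ → VV)} [IsProbabilityMeasure τ]
    {π1 : VV → P1} {π2 : VV → P2} {ζ : VV → DZ} {z1 : P1 → DZ}
    {z2 : P2 → DZ} {ε : P1 → ℝ} {et : P2 → ℝ} {M : ℝ}

lemma meas_seq {X Y : Type*} [MeasurableSpace X] [MeasurableSpace Y] {f : X → Y} (hf : Measurable f) :
    Measurable fun (y : ℕ → X) (m : ℕ) => f (y m) :=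
  measurable_pi_lambda _ fun l => hf.comp (measurable_pi_apply l)

lemma meas_at {X Y : Type*} [MeasurableSpace X] [MeasurableSpace Y] {f : X → Y} (hf : Measurable f)
    (i : ℕ) : Measurable fun (y : ℕ → X) => f (y i) :=
  hf.comp (measurable_pi_apply i)

lemma smo_BM (h : Noise ρ π1 π2 ζ z1 z2 ε M) (A : ℕ → ℕ → (ℕ → DZ) → ℝ) (hA : ∀ i l, BM (A i l))
    (r i : ℕ) : BM (smo A π1 ζ ε r i) :=
  BM.sum _ fun l _ => ((hA i l).comp (meas_seq h.mζ)).mul (h.bε.comp (meas_at h.mπ1 l))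

/-- `smo` as a function of the `π1` data only -/
lemma smo_eq (h : Noise ρ π1 π2 ζ z1 z2 ε M) (A : ℕ → ℕ → (ℕ → DZ) → ℝ) (r i : ℕ) (y : ℕ → VV) :
    smo A π1 ζ ε r i y = smo A id z1 ε r i (fun l => π1 (y l)) := by
  simp [smo, h.hz1]

lemma smo_BM' (h : Noise ρ π1 π2 ζ z1 z2 ε M) (A : ℕ → ℕ → (ℕ → DZ) → ℝ) (hA : ∀ i l, BM (A i l))
    (r i : ℕ) : BM (smo A id z1 ε r i) :=
  BM.sum _ fun l _ => ((hA i l).comp (meas_seq h.mz1)).mul (h.bε.comp (meas_at measurable_id l))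


/-- conditioning on `π2` -/
lemma cond2 (hind : iIndepFun (fun i (y : ℕ → VV) => y i) τ)
    (hlaw : ∀ i, τ.map (fun y => y i) = ρ) (h : Noise ρ π1 π2 ζ z1 z2 ε M) (c : ℕ → (ℕ → P2) → ℝ) (r : ℕ)
    (hc : ∀ l, l < r → BM (c l)) :
    ∫ y, (∑ l ∈ Finset.range r, c l (fun m => π2 (y m)) * ε (π1 (y l))) ^ 2 ∂τ ≤
      M ^ 2 * ∫ y, ∑ l ∈ Finset.range r, c l (fun m => π2 (y m)) ^ 2 ∂τ :=
  condvar_bound ρ τ hind hlaw π2 h.mπ2 (fun v => ε (π1 v)) (h.bε.comp h.mπ1) M (fun _ => h.hM _)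
    h.orth c r hc

/-- conditioning on `ζ` -/
lemma condz (hind : iIndepFun (fun i (y : ℕ → VV) => y i) τ)
    (hlaw : ∀ i, τ.map (fun y => y i) = ρ) (h : Noise ρ π1 π2 ζ z1 z2 ε M) (c : ℕ → (ℕ → DZ) → ℝ) (r : ℕ)
    (hc : ∀ l, l < r → BM (c l)) :
    ∫ y, (∑ l ∈ Finset.range r, c l (fun m => ζ (y m)) * ε (π1 (y l))) ^ 2 ∂τ ≤
      M ^ 2 * ∫ y, ∑ l ∈ Finset.range r, c l (fun m => ζ (y m)) ^ 2 ∂τ := by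
  have := cond2 hind hlaw h (fun l s => c l (fun m => z2 (s m))) r
    (fun l hl => (hc l hl).comp (meas_seq h.mz2))
  simpa only [← h.hz2] using this

lemma smo_sq (hind : iIndepFun (fun i (y : ℕ → VV) => y i) τ)
    (hlaw : ∀ i, τ.map (fun y => y i) = ρ) (h : Noise ρ π1 π2 ζ z1 z2 ε M) (A : ℕ → ℕ → (ℕ → DZ) → ℝ) (hA : ∀ i l, BM (A i l))
    (n r : ℕ) (φ : ℝ)
    (hφ : ∀ zs, ∑ i ∈ Finset.range n, ∑ l ∈ Finset.range r, A i l zs ^ 2 ≤ φ) :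
    ∫ y, ∑ i ∈ Finset.range n, smo A π1 ζ ε r i y ^ 2 ∂τ ≤ M ^ 2 * φ := by
  rw [integral_finsetSum _ fun i _ => ((smo_BM h A hA r i).sq).integrable τ]
  have hbm : ∀ i, BM fun y : ℕ → VV => ∑ l ∈ Finset.range r, A i l (fun m => ζ (y m)) ^ 2 := fun i =>
    BM.sum _ fun l _ => ((hA i l).comp (meas_seq h.mζ)).sq
  calc _ ≤ ∑ i ∈ Finset.range n, M ^ 2 * ∫ y, ∑ l ∈ Finset.range r, A i l (fun m => ζ (y m)) ^ 2 ∂τ :=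
        Finset.sum_le_sum fun i _ => condz hind hlaw h (A i) r fun l _ => hA i l
    _ = M ^ 2 * ∫ y, ∑ i ∈ Finset.range n, ∑ l ∈ Finset.range r, A i l (fun m => ζ (y m)) ^ 2 ∂τ := by
        rw [← Finset.mul_sum, integral_finsetSum _ fun i _ => (hbm i).integrable τ]
    _ ≤ M ^ 2 * ∫ _, φ ∂τ := by
        refine mul_le_mul_of_nonneg_left ?_ (sq_nonneg _)
        exact integral_mono ((BM.sum _ fun i _ => hbm i).integrable τ) (integrable_const _)
          fun y => hφ _
    _ = _ := by simp

lemma dev_sq (hind : iIndepFun (fun i (y : ℕ → VV) => y i) τ)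
    (hlaw : ∀ i, τ.map (fun y => y i) = ρ) (h : Noise ρ π1 π2 ζ z1 z2 ε M) (A : ℕ → ℕ → (ℕ → DZ) → ℝ) (hA : ∀ i l, BM (A i l))
    (a : ℕ → (ℕ → DZ) → ℝ) (ha : ∀ i, BM (a i)) (n r : ℕ) (φ α : ℝ)
    (hφ : ∀ zs, ∑ i ∈ Finset.range n, ∑ l ∈ Finset.range r, A i l zs ^ 2 ≤ φ)
    (hα : ∀ zs, ∑ i ∈ Finset.range n, a i zs ^ 2 ≤ α) :
    ∫ y, ∑ i ∈ Finset.range n, (a i (fun m => ζ (y m)) + smo A π1 ζ ε r i y) ^ 2 ∂τ ≤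
      2 * α + 2 * (M ^ 2 * φ) := by
  have h1 := smo_sq hind hlaw h A hA n r φ hφ
  have hb1 : BM fun y : ℕ → VV => ∑ i ∈ Finset.range n, smo A π1 ζ ε r i y ^ 2 :=
    BM.sum _ fun i _ => (smo_BM h A hA r i).sq
  calc _ ≤ ∫ y, (2 * α + 2 * ∑ i ∈ Finset.range n, smo A π1 ζ ε r i y ^ 2) ∂τ := by
        refine integral_mono ((BM.sum _ fun i _ => (((ha i).comp (meas_seq h.mζ)).add
          (smo_BM h A hA r i)).sq).integrable τ) (((BM.const _).add ((BM.const 2).mul hb1)).integrable τ)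
          fun y => ?_
        calc _ ≤ ∑ i ∈ Finset.range n, (2 * a i (fun m => ζ (y m)) ^ 2 + 2 * smo A π1 ζ ε r i y ^ 2) := by
              refine Finset.sum_le_sum fun i _ => ?_
              nlinarith [sq_nonneg (a i (fun m => ζ (y m)) - smo A π1 ζ ε r i y)]
          _ = 2 * ∑ i ∈ Finset.range n, a i (fun m => ζ (y m)) ^ 2 +
              2 * ∑ i ∈ Finset.range n, smo A π1 ζ ε r i y ^ 2 := by
              rw [Finset.sum_add_distrib, ← Finset.mul_sum, ← Finset.mul_sum]
          _ ≤ _ := by have := hα (fun m => ζ (y m)); linarith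
    _ = 2 * α + 2 * ∫ y, ∑ i ∈ Finset.range n, smo A π1 ζ ε r i y ^ 2 ∂τ := by
        rw [integral_add (integrable_const _) (((BM.const 2).mul hb1).integrable τ),
          integral_const_mul 2 (fun y : ℕ → VV => ∑ i ∈ Finset.range n, smo A π1 ζ ε r i y ^ 2)]
        simp
    _ ≤ _ := by linarith

/-- `Σ d1_i η_i` -/
lemma term_dev_noise (hind : iIndepFun (fun i (y : ℕ → VV) => y i) τ)
    (hlaw : ∀ i, τ.map (fun y => y i) = ρ) (h : Noise ρ π1 π2 ζ z1 z2 ε M) (h' : Noise ρ π2 π1 ζ z2 z1 et M)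
    (A : ℕ → ℕ → (ℕ → DZ) → ℝ) (hA : ∀ i l, BM (A i l))
    (a : ℕ → (ℕ → DZ) → ℝ) (ha : ∀ i, BM (a i)) (n r : ℕ) (φ α : ℝ)
    (hφ : ∀ zs, ∑ i ∈ Finset.range n, ∑ l ∈ Finset.range r, A i l zs ^ 2 ≤ φ)
    (hα : ∀ zs, ∑ i ∈ Finset.range n, a i zs ^ 2 ≤ α) :
    ∫ y, (∑ i ∈ Finset.range n, (a i (fun m => ζ (y m)) + smo A π1 ζ ε r i y) * et (π2 (y i))) ^ 2 ∂τ ≤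
      M ^ 2 * (2 * α + 2 * (M ^ 2 * φ)) := by
  have h1 := cond2 hind hlaw h' (fun i s => a i (fun m => z1 (s m)) + smo A id z1 ε r i s) n
    (fun i _ => ((ha i).comp (meas_seq h.mz1)).add (smo_BM' h A hA r i))
  simp only [← h.hz1, ← smo_eq h] at h1
  exact h1.trans (mul_le_mul_of_nonneg_left (dev_sq hind hlaw h A hA a ha n r φ α hφ hα) (sq_nonneg _))

/-- `Σ p_i b_i` -/
lemma term_smo_bias (hind : iIndepFun (fun i (y : ℕ → VV) => y i) τ)
    (hlaw : ∀ i, τ.map (fun y => y i) = ρ) (h : Noise ρ π1 π2 ζ z1 z2 ε M)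
    (A : ℕ → ℕ → (ℕ → DZ) → ℝ) (hA : ∀ i l, BM (A i l))
    (b : ℕ → (ℕ → DZ) → ℝ) (hb : ∀ i, BM (b i)) (n r : ℕ) (ψ α : ℝ) (hψ0 : 0 ≤ ψ)
    (hψ : ∀ zs (v : ℕ → ℝ), ∑ l ∈ Finset.range r, (∑ i ∈ Finset.range n, A i l zs * v i) ^ 2 ≤
      ψ * ∑ i ∈ Finset.range n, v i ^ 2)
    (hα : ∀ zs, ∑ i ∈ Finset.range n, b i zs ^ 2 ≤ α) :
    ∫ y, (∑ i ∈ Finset.range n, smo A π1 ζ ε r i y * b i (fun m => ζ (y m))) ^ 2 ∂τ ≤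
      M ^ 2 * (ψ * α) := by
  have hbm : ∀ l, BM fun zs : ℕ → DZ => ∑ i ∈ Finset.range n, A i l zs * b i zs := fun l =>
    BM.sum _ fun i _ => (hA i l).mul (hb i)
  have h1 := condz hind hlaw h (fun l zs => ∑ i ∈ Finset.range n, A i l zs * b i zs) r
    (fun l _ => hbm l)
  have e : ∀ y : ℕ → VV, ∑ l ∈ Finset.range r, (∑ i ∈ Finset.range n, A i l (fun m => ζ (y m)) *
      b i (fun m => ζ (y m))) * ε (π1 (y l)) =
      ∑ i ∈ Finset.range n, smo A π1 ζ ε r i y * b i (fun m => ζ (y m)) := by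
    intro y
    simp only [smo, Finset.sum_mul]
    rw [Finset.sum_comm]
    exact Finset.sum_congr rfl fun i _ => Finset.sum_congr rfl fun l _ => by ring
  simp only [e] at h1
  refine h1.trans (mul_le_mul_of_nonneg_left ?_ (sq_nonneg _))
  calc _ ≤ ∫ _, ψ * α ∂τ := by
        refine integral_mono ((BM.sum _ fun l _ => ((hbm l).comp (meas_seq h.mζ)).sq).integrable τ)
          (integrable_const _) fun y => ?_
        exact (hψ _ _).trans (mul_le_mul_of_nonneg_left (hα _) hψ0)
    _ = _ := by simp

/-- `Σ p_i q_i` -/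
lemma term_smo_smo (hind : iIndepFun (fun i (y : ℕ → VV) => y i) τ)
    (hlaw : ∀ i, τ.map (fun y => y i) = ρ) (h : Noise ρ π1 π2 ζ z1 z2 ε M) (h' : Noise ρ π2 π1 ζ z2 z1 et M)
    (A B : ℕ → ℕ → (ℕ → DZ) → ℝ) (hA : ∀ i l, BM (A i l)) (hB : ∀ i l, BM (B i l))
    (n r : ℕ) (ψ φ : ℝ) (hψ0 : 0 ≤ ψ)
    (hφ : ∀ zs, ∑ i ∈ Finset.range n, ∑ l ∈ Finset.range r, A i l zs ^ 2 ≤ φ)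
    (hψ : ∀ zs (v : ℕ → ℝ), ∑ l ∈ Finset.range r, (∑ i ∈ Finset.range n, B i l zs * v i) ^ 2 ≤
      ψ * ∑ i ∈ Finset.range n, v i ^ 2) :
    ∫ y, (∑ i ∈ Finset.range n, smo A π1 ζ ε r i y * smo B π2 ζ et r i y) ^ 2 ∂τ ≤
      M ^ 2 * (ψ * (M ^ 2 * φ)) := by
  have hbm : ∀ l, BM fun s : ℕ → P1 =>
      ∑ i ∈ Finset.range n, B i l (fun m => z1 (s m)) * smo A id z1 ε r i s := fun l =>
    BM.sum _ fun i _ => ((hB i l).comp (meas_seq h.mz1)).mul (smo_BM' h A hA r i)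
  have h1 := cond2 hind hlaw h' (fun l s => ∑ i ∈ Finset.range n, B i l (fun m => z1 (s m)) *
    smo A id z1 ε r i s) r (fun l _ => hbm l)
  simp only [← h.hz1, ← smo_eq h] at h1
  have e : ∀ y : ℕ → VV, ∑ l ∈ Finset.range r, (∑ i ∈ Finset.range n, B i l (fun m => ζ (y m)) *
      smo A π1 ζ ε r i y) * et (π2 (y l)) =
      ∑ i ∈ Finset.range n, smo A π1 ζ ε r i y * smo B π2 ζ et r i y := by
    intro y
    simp only [Finset.sum_mul]
    rw [Finset.sum_comm]
    refine Finset.sum_congr rfl fun i _ => ?_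
    rw [show smo B π2 ζ et r i y = ∑ l ∈ Finset.range r, B i l (fun m => ζ (y m)) * et (π2 (y l)) from rfl,
      Finset.mul_sum]
    exact Finset.sum_congr rfl fun l _ => by ring
  simp only [e] at h1
  refine h1.trans (mul_le_mul_of_nonneg_left ?_ (sq_nonneg _))
  have hb1 : BM fun y : ℕ → VV => ∑ i ∈ Finset.range n, smo A π1 ζ ε r i y ^ 2 :=
    BM.sum _ fun i _ => (smo_BM h A hA r i).sq
  calc _ ≤ ∫ y, ψ * ∑ i ∈ Finset.range n, smo A π1 ζ ε r i y ^ 2 ∂τ := by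
        refine integral_mono ((BM.sum _ fun l _ => (BM.sum _ fun i _ =>
          ((hB i l).comp (meas_seq h.mζ)).mul (smo_BM h A hA r i)).sq).integrable τ)
          (((BM.const ψ).mul hb1).integrable τ) fun y => ?_
        exact hψ _ _
    _ = ψ * ∫ y, ∑ i ∈ Finset.range n, smo A π1 ζ ε r i y ^ 2 ∂τ := integral_const_mul _ _
    _ ≤ _ := mul_le_mul_of_nonneg_left (smo_sq hind hlaw h A hA n r φ hφ) hψ0

/-- `Σ p_i² q_i²` -/
lemma term_smo4 (hind : iIndepFun (fun i (y : ℕ → VV) => y i) τ)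
    (hlaw : ∀ i, τ.map (fun y => y i) = ρ) (h : Noise ρ π1 π2 ζ z1 z2 ε M) (h' : Noise ρ π2 π1 ζ z2 z1 et M)
    (A B : ℕ → ℕ → (ℕ → DZ) → ℝ) (hA : ∀ i l, BM (A i l)) (hB : ∀ i l, BM (B i l))
    (n r : ℕ) (K φ : ℝ) (hK0 : 0 ≤ K)
    (hφ : ∀ zs, ∑ i ∈ Finset.range n, ∑ l ∈ Finset.range r, A i l zs ^ 2 ≤ φ)
    (hK : ∀ zs i, ∑ l ∈ Finset.range r, B i l zs ^ 2 ≤ K) :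
    ∫ y, ∑ i ∈ Finset.range n, smo A π1 ζ ε r i y ^ 2 * smo B π2 ζ et r i y ^ 2 ∂τ ≤
      M ^ 2 * (K * (M ^ 2 * φ)) := by
  have key : ∀ i, ∫ y, smo A π1 ζ ε r i y ^ 2 * smo B π2 ζ et r i y ^ 2 ∂τ ≤
      M ^ 2 * (K * ∫ y, smo A π1 ζ ε r i y ^ 2 ∂τ) := by
    intro i
    have h1 := cond2 hind hlaw h' (fun l s => B i l (fun m => z1 (s m)) *
      smo A id z1 ε r i s) r (fun l _ => ((hB i l).comp (meas_seq h.mz1)).mul (smo_BM' h A hA r i))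
    simp only [← h.hz1, ← smo_eq h] at h1
    have e : ∀ y : ℕ → VV, (∑ l ∈ Finset.range r, B i l (fun m => ζ (y m)) *
      smo A π1 ζ ε r i y * et (π2 (y l))) ^ 2 = smo A π1 ζ ε r i y ^ 2 * smo B π2 ζ et r i y ^ 2 := by
      intro y
      rw [← mul_pow]
      congr 1
      rw [show smo B π2 ζ et r i y = ∑ l ∈ Finset.range r, B i l (fun m => ζ (y m)) * et (π2 (y l)) from rfl,
        Finset.mul_sum]
      exact Finset.sum_congr rfl fun l _ => by ring
    simp only [e] at h1
    refine h1.trans (mul_le_mul_of_nonneg_left ?_ (sq_nonneg _))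
    rw [← integral_const_mul]
    refine integral_mono ((BM.sum _ fun l _ =>
          (((hB i l).comp (meas_seq h.mζ)).mul (smo_BM h A hA r i)).sq).integrable τ)
          (((BM.const K).mul (smo_BM h A hA r i).sq).integrable τ) fun y => ?_
    simp only [mul_pow, ← Finset.sum_mul]
    exact mul_le_mul_of_nonneg_right (hK _ _) (sq_nonneg _)
  rw [integral_finsetSum _ fun i _ =>
    ((smo_BM h A hA r i).sq.mul (smo_BM h' B hB r i).sq).integrable τ]
  refine (Finset.sum_le_sum fun i _ => key i).trans ?_
  rw [← Finset.mul_sum, ← Finset.mul_sum, ← integral_finsetSum _ fun i _ =>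
    ((smo_BM h A hA r i).sq).integrable τ]
  refine mul_le_mul_of_nonneg_left (mul_le_mul_of_nonneg_left ?_ hK0) (sq_nonneg _)
  exact smo_sq hind hlaw h A hA n r φ hφ

end Remainder


section Remainder2

variable {VV P1 P2 DZ : Type*} [MeasurableSpace VV] [MeasurableSpace P1] [MeasurableSpace P2]
  [MeasurableSpace DZ]

/-- bounds for a bounded smoother together with its bias -/
structure SmBound (A : ℕ → ℕ → (ℕ → DZ) → ℝ) (a : ℕ → (ℕ → DZ) → ℝ) (n r : ℕ) (α φ ψ K : ℝ) :
    Prop where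
  hA : ∀ i l, BM (A i l)
  ha : ∀ i, BM (a i)
  hα : ∀ zs, ∑ i ∈ Finset.range n, a i zs ^ 2 ≤ α
  hφ : ∀ zs, ∑ i ∈ Finset.range n, ∑ l ∈ Finset.range r, A i l zs ^ 2 ≤ φ
  hψ : ∀ zs (v : ℕ → ℝ), ∑ l ∈ Finset.range r, (∑ i ∈ Finset.range n, A i l zs * v i) ^ 2 ≤
      ψ * ∑ i ∈ Finset.range n, v i ^ 2
  hK : ∀ zs i, ∑ l ∈ Finset.range r, A i l zs ^ 2 ≤ K
  haK : ∀ zs i, a i zs ^ 2 ≤ K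

/-- deviation of the estimator -/
def devi (A : ℕ → ℕ → (ℕ → DZ) → ℝ) (a : ℕ → (ℕ → DZ) → ℝ) (π1 : VV → P1) (ζ : VV → DZ)
    (ε : P1 → ℝ) (r i : ℕ) (y : ℕ → VV) : ℝ :=
  a i (fun m => ζ (y m)) + smo A π1 ζ ε r i y

variable {ρ : Measure VV} [IsProbabilityMeasure ρ]
    {τ : Measure (ℕ → VV)} [IsProbabilityMeasure τ]
    {π1 : VV → P1} {π2 : VV → P2} {ζ : VV → DZ} {z1 : P1 → DZ}
    {z2 : P2 → DZ} {ε : P1 → ℝ} {et : P2 → ℝ} {M : ℝ}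

lemma sq_sum6 (a b c d e f : ℝ) : (a + b + c + d + e + f) ^ 2 ≤
    6 * (a ^ 2 + b ^ 2 + c ^ 2 + d ^ 2 + e ^ 2 + f ^ 2) := by
  nlinarith [sq_nonneg (a - b), sq_nonneg (a - c), sq_nonneg (a - d), sq_nonneg (a - e),
    sq_nonneg (a - f), sq_nonneg (b - c), sq_nonneg (b - d), sq_nonneg (b - e), sq_nonneg (b - f),
    sq_nonneg (c - d), sq_nonneg (c - e), sq_nonneg (c - f), sq_nonneg (d - e), sq_nonneg (d - f),
    sq_nonneg (e - f)]

lemma rem_first (hind : iIndepFun (fun i (y : ℕ → VV) => y i) τ)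
    (hlaw : ∀ i, τ.map (fun y => y i) = ρ) (h : Noise ρ π1 π2 ζ z1 z2 ε M)
    (h' : Noise ρ π2 π1 ζ z2 z1 et M) (A B : ℕ → ℕ → (ℕ → DZ) → ℝ) (a b : ℕ → (ℕ → DZ) → ℝ)
    (n r : ℕ) (α φ ψ K : ℝ) (hψ0 : 0 ≤ ψ) (hA : SmBound A a n r α φ ψ K)
    (hB : SmBound B b n r α φ ψ K) :
    ∫ y, (∑ i ∈ Finset.range n, (devi A a π1 ζ ε r i y * devi B b π2 ζ et r i y -
      devi A a π1 ζ ε r i y * et (π2 (y i)) - ε (π1 (y i)) * devi B b π2 ζ et r i y)) ^ 2 ∂τ ≤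
      6 * (2 * (M ^ 2 * (2 * α + 2 * (M ^ 2 * φ))) + α ^ 2 + 2 * (M ^ 2 * (ψ * α)) +
        M ^ 2 * (ψ * (M ^ 2 * φ))) := by
  have T1 := term_dev_noise hind hlaw h h' A hA.hA a hA.ha n r φ α hA.hφ hA.hα
  have T2 := term_dev_noise hind hlaw h' h B hB.hA b hB.ha n r φ α hB.hφ hB.hα
  have T3 := term_smo_bias hind hlaw h A hA.hA b hB.ha n r ψ α hψ0 hA.hψ hB.hα
  have T4 := term_smo_bias hind hlaw h' B hB.hA a hA.ha n r ψ α hψ0 hB.hψ hA.hα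
  have T5 := term_smo_smo hind hlaw h h' A B hA.hA hB.hA n r ψ φ hψ0 hA.hφ hB.hψ
  have ba : ∀ i, BM fun y : ℕ → VV => a i (fun m => ζ (y m)) := fun i => (hA.ha i).comp (meas_seq h.mζ)
  have bb : ∀ i, BM fun y : ℕ → VV => b i (fun m => ζ (y m)) := fun i => (hB.ha i).comp (meas_seq h.mζ)
  have bp : ∀ i, BM fun y : ℕ → VV => smo A π1 ζ ε r i y := fun i => smo_BM h A hA.hA r i
  have bq : ∀ i, BM fun y : ℕ → VV => smo B π2 ζ et r i y := fun i => smo_BM h' B hB.hA r i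
  have be : ∀ i : ℕ, BM fun y : ℕ → VV => ε (π1 (y i)) := fun i => h.bε.comp (meas_at h.mπ1 i)
  have bt : ∀ i : ℕ, BM fun y : ℕ → VV => et (π2 (y i)) := fun i => h'.bε.comp (meas_at h.mπ2 i)
  set t1 : (ℕ → VV) → ℝ := fun y => ∑ i ∈ Finset.range n,
    (a i (fun m => ζ (y m)) + smo A π1 ζ ε r i y) * et (π2 (y i)) with ht1
  set t2 : (ℕ → VV) → ℝ := fun y => ∑ i ∈ Finset.range n,
    (b i (fun m => ζ (y m)) + smo B π2 ζ et r i y) * ε (π1 (y i)) with ht2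
  set t3 : (ℕ → VV) → ℝ := fun y => ∑ i ∈ Finset.range n,
    smo A π1 ζ ε r i y * b i (fun m => ζ (y m)) with ht3
  set t4 : (ℕ → VV) → ℝ := fun y => ∑ i ∈ Finset.range n,
    smo B π2 ζ et r i y * a i (fun m => ζ (y m)) with ht4
  set t5 : (ℕ → VV) → ℝ := fun y => ∑ i ∈ Finset.range n,
    smo A π1 ζ ε r i y * smo B π2 ζ et r i y with ht5
  set t6 : (ℕ → VV) → ℝ := fun y => ∑ i ∈ Finset.range n,
    a i (fun m => ζ (y m)) * b i (fun m => ζ (y m)) with ht6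
  have b1 : BM t1 := BM.sum _ fun i _ => ((ba i).add (bp i)).mul (bt i)
  have b2 : BM t2 := BM.sum _ fun i _ => ((bb i).add (bq i)).mul (be i)
  have b3 : BM t3 := BM.sum _ fun i _ => (bp i).mul (bb i)
  have b4 : BM t4 := BM.sum _ fun i _ => (bq i).mul (ba i)
  have b5 : BM t5 := BM.sum _ fun i _ => (bp i).mul (bq i)
  have b6 : BM t6 := BM.sum _ fun i _ => (ba i).mul (bb i)
  have T6 : ∫ y, t6 y ^ 2 ∂τ ≤ α ^ 2 := by
    calc _ ≤ ∫ _, α ^ 2 ∂τ := by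
          refine integral_mono (b6.sq.integrable τ) (integrable_const _) fun y => ?_
          refine (Finset.sum_mul_sq_le_sq_mul_sq _ _ _).trans ?_
          rw [pow_two]
          have h1 := hA.hα (fun m => ζ (y m))
          have h2 := hB.hα (fun m => ζ (y m))
          have h3 : 0 ≤ ∑ i ∈ Finset.range n, b i (fun m => ζ (y m)) ^ 2 :=
            Finset.sum_nonneg fun _ _ => sq_nonneg _
          have h4 : 0 ≤ ∑ i ∈ Finset.range n, a i (fun m => ζ (y m)) ^ 2 :=
            Finset.sum_nonneg fun _ _ => sq_nonneg _
          exact mul_le_mul h1 h2 h3 (h4.trans h1)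
      _ = _ := by simp
  have e : ∀ y : ℕ → VV, ∑ i ∈ Finset.range n, (devi A a π1 ζ ε r i y * devi B b π2 ζ et r i y -
      devi A a π1 ζ ε r i y * et (π2 (y i)) - ε (π1 (y i)) * devi B b π2 ζ et r i y) =
      - t1 y + - t2 y + t3 y + t4 y + t5 y + t6 y := by
    intro y
    simp only [ht1, ht2, ht3, ht4, ht5, ht6, devi, ← Finset.sum_add_distrib, ← Finset.sum_neg_distrib]
    exact Finset.sum_congr rfl fun i _ => by ring
  simp only [e]
  calc _ ≤ ∫ y, 6 * (t1 y ^ 2 + t2 y ^ 2 + t3 y ^ 2 + t4 y ^ 2 + t5 y ^ 2 + t6 y ^ 2) ∂τ := by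
        refine integral_mono (((((((b1.neg).add b2.neg).add b3).add b4).add b5).add b6).sq.integrable τ)
          (((BM.const 6).mul (((((b1.sq.add b2.sq).add b3.sq).add b4.sq).add b5.sq).add b6.sq)).integrable τ)
          fun y => ?_
        have := sq_sum6 (-t1 y) (-t2 y) (t3 y) (t4 y) (t5 y) (t6 y)
        simpa using this
    _ = 6 * (∫ y, t1 y ^ 2 ∂τ + ∫ y, t2 y ^ 2 ∂τ + ∫ y, t3 y ^ 2 ∂τ + ∫ y, t4 y ^ 2 ∂τ +
          ∫ y, t5 y ^ 2 ∂τ + ∫ y, t6 y ^ 2 ∂τ) := by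
        rw [integral_const_mul, integral_add
          (((((b1.sq.add b2.sq).add b3.sq).add b4.sq).add b5.sq).integrable τ) (b6.sq.integrable τ),
          integral_add ((((b1.sq.add b2.sq).add b3.sq).add b4.sq).integrable τ) (b5.sq.integrable τ),
          integral_add (((b1.sq.add b2.sq).add b3.sq).integrable τ) (b4.sq.integrable τ),
          integral_add ((b1.sq.add b2.sq).integrable τ) (b3.sq.integrable τ),
          integral_add (b1.sq.integrable τ) (b2.sq.integrable τ)]
    _ ≤ _ := by linarith

lemma rem_second (hind : iIndepFun (fun i (y : ℕ → VV) => y i) τ)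
    (hlaw : ∀ i, τ.map (fun y => y i) = ρ) (h : Noise ρ π1 π2 ζ z1 z2 ε M)
    (h' : Noise ρ π2 π1 ζ z2 z1 et M) (A B : ℕ → ℕ → (ℕ → DZ) → ℝ) (a b : ℕ → (ℕ → DZ) → ℝ)
    (n r : ℕ) (α φ ψ K : ℝ) (hK0 : 0 ≤ K) (hA : SmBound A a n r α φ ψ K)
    (hB : SmBound B b n r α φ ψ K) :
    ∫ y, ∑ i ∈ Finset.range n, (devi A a π1 ζ ε r i y * devi B b π2 ζ et r i y -
      devi A a π1 ζ ε r i y * et (π2 (y i)) - ε (π1 (y i)) * devi B b π2 ζ et r i y) ^ 2 ∂τ ≤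
      12 * (K * α + 2 * (K * (M ^ 2 * φ)) + M ^ 2 * (K * (M ^ 2 * φ))) +
        6 * (M ^ 2 * (2 * α + 2 * (M ^ 2 * φ))) := by
  have T1 := dev_sq hind hlaw h A hA.hA a hA.ha n r φ α hA.hφ hA.hα
  have T2 := dev_sq hind hlaw h' B hB.hA b hB.ha n r φ α hB.hφ hB.hα
  have T3 := smo_sq hind hlaw h A hA.hA n r φ hA.hφ
  have T4 := smo_sq hind hlaw h' B hB.hA n r φ hB.hφ
  have T5 := term_smo4 hind hlaw h h' A B hA.hA hB.hA n r K φ hK0 hA.hφ hB.hK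
  have ba : ∀ i, BM fun y : ℕ → VV => a i (fun m => ζ (y m)) := fun i => (hA.ha i).comp (meas_seq h.mζ)
  have bb : ∀ i, BM fun y : ℕ → VV => b i (fun m => ζ (y m)) := fun i => (hB.ha i).comp (meas_seq h.mζ)
  have bp : ∀ i, BM fun y : ℕ → VV => smo A π1 ζ ε r i y := fun i => smo_BM h A hA.hA r i
  have bq : ∀ i, BM fun y : ℕ → VV => smo B π2 ζ et r i y := fun i => smo_BM h' B hB.hA r i
  have be : ∀ i : ℕ, BM fun y : ℕ → VV => ε (π1 (y i)) := fun i => h.bε.comp (meas_at h.mπ1 i)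
  have bt : ∀ i : ℕ, BM fun y : ℕ → VV => et (π2 (y i)) := fun i => h'.bε.comp (meas_at h.mπ2 i)
  have bd1 : ∀ i, BM fun y : ℕ → VV => devi A a π1 ζ ε r i y := fun i => (ba i).add (bp i)
  have bd2 : ∀ i, BM fun y : ℕ → VV => devi B b π2 ζ et r i y := fun i => (bb i).add (bq i)
  set t1 : (ℕ → VV) → ℝ := fun y => ∑ i ∈ Finset.range n,
    (a i (fun m => ζ (y m)) + smo A π1 ζ ε r i y) ^ 2 with ht1
  set t2 : (ℕ → VV) → ℝ := fun y => ∑ i ∈ Finset.range n,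
    (b i (fun m => ζ (y m)) + smo B π2 ζ et r i y) ^ 2 with ht2
  set t3 : (ℕ → VV) → ℝ := fun y => ∑ i ∈ Finset.range n, smo A π1 ζ ε r i y ^ 2 with ht3
  set t4 : (ℕ → VV) → ℝ := fun y => ∑ i ∈ Finset.range n, smo B π2 ζ et r i y ^ 2 with ht4
  set t5 : (ℕ → VV) → ℝ := fun y => ∑ i ∈ Finset.range n,
    smo A π1 ζ ε r i y ^ 2 * smo B π2 ζ et r i y ^ 2 with ht5
  have b1 : BM t1 := BM.sum _ fun i _ => ((ba i).add (bp i)).sq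
  have b2 : BM t2 := BM.sum _ fun i _ => ((bb i).add (bq i)).sq
  have b3 : BM t3 := BM.sum _ fun i _ => (bp i).sq
  have b4 : BM t4 := BM.sum _ fun i _ => (bq i).sq
  have b5 : BM t5 := BM.sum _ fun i _ => (bp i).sq.mul (bq i).sq
  calc _ ≤ ∫ y, (12 * (K * α + K * t4 y + K * t3 y + t5 y) + 3 * M ^ 2 * (t1 y + t2 y)) ∂τ := by
        refine integral_mono ((BM.sum _ fun i _ => ((((bd1 i).mul (bd2 i)).sub
          ((bd1 i).mul (bt i))).sub ((be i).mul (bd2 i))).sq).integrable τ)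
          ((((BM.const 12).mul ((((BM.const _).add ((BM.const _).mul b4)).add ((BM.const _).mul b3)).add
            b5)).add ((BM.const _).mul (b1.add b2))).integrable τ) fun y => ?_
        have hsum : 12 * (K * ∑ i ∈ Finset.range n, a i (fun m => ζ (y m)) ^ 2 + K * t4 y + K * t3 y + t5 y)
            + 3 * M ^ 2 * (t1 y + t2 y) = ∑ i ∈ Finset.range n, (12 * (K * a i (fun m => ζ (y m)) ^ 2 +
              K * smo B π2 ζ et r i y ^ 2 + K * smo A π1 ζ ε r i y ^ 2 +
              smo A π1 ζ ε r i y ^ 2 * smo B π2 ζ et r i y ^ 2) + 3 * M ^ 2 *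
              ((a i (fun m => ζ (y m)) + smo A π1 ζ ε r i y) ^ 2 +
                (b i (fun m => ζ (y m)) + smo B π2 ζ et r i y) ^ 2)) := by
          simp only [ht1, ht2, ht3, ht4, ht5, Finset.mul_sum, ← Finset.sum_add_distrib]
        have hα := hA.hα (fun m => ζ (y m))
        have hKα := mul_le_mul_of_nonneg_left hα hK0
        refine le_trans ?_ (le_trans (le_of_eq hsum.symm) (by linarith))
        refine Finset.sum_le_sum fun i _ => ?_
        simp only [devi]
        have ga := hA.haK (fun m => ζ (y m)) i
        have gb := hB.haK (fun m => ζ (y m)) i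
        have ge : ε (π1 (y i)) ^ 2 ≤ M ^ 2 := by
          rw [← sq_abs]; exact pow_le_pow_left₀ (abs_nonneg _) (h.hM _) 2
        have gt : et (π2 (y i)) ^ 2 ≤ M ^ 2 := by
          rw [← sq_abs]; exact pow_le_pow_left₀ (abs_nonneg _) (h'.hM _) 2
        generalize a i (fun m => ζ (y m)) = a' at *
        generalize b i (fun m => ζ (y m)) = b' at *
        generalize smo A π1 ζ ε r i y = p at *
        generalize smo B π2 ζ et r i y = q at *
        generalize ε (π1 (y i)) = e' at *
        generalize et (π2 (y i)) = t' at *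
        have s1 : ((a' + p) * (b' + q) - (a' + p) * t' - e' * (b' + q)) ^ 2 ≤
            3 * ((a' + p) ^ 2 * (b' + q) ^ 2 + (a' + p) ^ 2 * t' ^ 2 + e' ^ 2 * (b' + q) ^ 2) := by
          nlinarith [sq_nonneg ((a' + p) * (b' + q) + (a' + p) * t'),
            sq_nonneg ((a' + p) * (b' + q) + e' * (b' + q)),
            sq_nonneg ((a' + p) * t' - e' * (b' + q))]
        have s2 : (a' + p) ^ 2 * (b' + q) ^ 2 ≤ (2 * a' ^ 2 + 2 * p ^ 2) * (2 * b' ^ 2 + 2 * q ^ 2) := by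
          refine mul_le_mul ?_ ?_ (sq_nonneg _) (by positivity)
          · nlinarith [sq_nonneg (a' - p)]
          · nlinarith [sq_nonneg (b' - q)]
        have s3 := mul_le_mul_of_nonneg_left gb (sq_nonneg a')
        have s4 := mul_le_mul_of_nonneg_right ga (sq_nonneg q)
        have s5 := mul_le_mul_of_nonneg_left gb (sq_nonneg p)
        have s6 := mul_le_mul_of_nonneg_left gt (sq_nonneg (a' + p))
        have s7 := mul_le_mul_of_nonneg_right ge (sq_nonneg (b' + q))
        nlinarith
    _ = 12 * (K * α + K * ∫ y, t4 y ∂τ + K * ∫ y, t3 y ∂τ + ∫ y, t5 y ∂τ) +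
          3 * M ^ 2 * (∫ y, t1 y ∂τ + ∫ y, t2 y ∂τ) := by
        have bk4 : BM fun y => K * t4 y := (BM.const K).mul b4
        have bk3 : BM fun y => K * t3 y := (BM.const K).mul b3
        have bk : BM fun _ : ℕ → VV => K * α := BM.const _
        rw [integral_add (((BM.const 12).mul (((bk.add bk4).add bk3).add b5)).integrable τ)
          (((BM.const _).mul (b1.add b2)).integrable τ),
          integral_const_mul 12 (fun y => K * α + K * t4 y + K * t3 y + t5 y),
          integral_const_mul (3 * M ^ 2) (fun y => t1 y + t2 y),
          integral_add (((bk.add bk4).add bk3).integrable τ) (b5.integrable τ),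
          integral_add ((bk.add bk4).integrable τ) (bk3.integrable τ),
          integral_add (bk.integrable τ) (bk4.integrable τ),
          integral_add (b1.integrable τ) (b2.integrable τ), integral_const_mul K (fun y => t4 y),
          integral_const_mul K (fun y => t3 y)]
        simp
    _ ≤ _ := by
        have s1 := mul_le_mul_of_nonneg_left T3 hK0
        have s2 := mul_le_mul_of_nonneg_left T4 hK0
        have s3 := mul_le_mul_of_nonneg_left T1 (sq_nonneg M)
        have s4 := mul_le_mul_of_nonneg_left T2 (sq_nonneg M)
        nlinarith

end Remainder2


/-! ### Part F3 : remainder tails -/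

lemma measurable_matrix_det {X : Type*} [MeasurableSpace X] {ι : Type*} [Fintype ι] [DecidableEq ι]
    (M : X → Matrix ι ι ℝ) (hM : ∀ i j, Measurable fun x => M x i j) :
    Measurable fun x => (M x).det := by
  simp only [Matrix.det_apply]
  refine Finset.measurable_fun_sum _ fun σ _ => ?_
  refine Measurable.const_smul ?_ _
  exact Finset.measurable_fun_prod _ fun i _ => hM _ _

lemma measurable_matrix_inv {X : Type*} [MeasurableSpace X] {ι : Type*} [Fintype ι] [DecidableEq ι]
    (M : X → Matrix ι ι ℝ) (hM : ∀ i j, Measurable fun x => M x i j) (i j : ι) :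
    Measurable fun x => (M x)⁻¹ i j := by
  simp only [Matrix.inv_def, Matrix.smul_apply, Matrix.adjugate_apply, smul_eq_mul, Ring.inverse_eq_inv']
  refine (measurable_matrix_det M hM).inv.mul (measurable_matrix_det _ fun a b => ?_)
  by_cases h : a = j
  · subst h; simp
  · simp [Matrix.updateRow_ne h, hM]

lemma measurable_acoef {D : Type*} [MeasurableSpace D] (k : D → D → ℝ)
    (hk : Measurable fun q : D × D => k q.1 q.2) (r : ℕ) (lam : ℝ) (i l : ℕ) :
    Measurable fun zs : ℕ → D => acoef k zs r lam (zs i) l := by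
  have hk' : ∀ a b : ℕ, Measurable fun zs : ℕ → D => k (zs a) (zs b) := fun a b =>
    hk.comp (g := fun q : D × D => k q.1 q.2) (f := fun zs : ℕ → D => (zs a, zs b))
      ((measurable_pi_apply a).prodMk (measurable_pi_apply b))
  unfold acoef
  split_ifs with h
  · refine Finset.measurable_fun_sum _ fun m _ => Measurable.mul ?_ (hk' _ _)
    refine measurable_matrix_inv (fun zs : ℕ → D => (Matrix.of fun i l : Fin r => k (zs i) (zs l)) +
        ((r : ℝ) * lam) • (1 : Matrix (Fin r) (Fin r) ℝ)) (fun a b => ?_) _ _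
    simp only [Matrix.add_apply, Matrix.of_apply]
    exact (hk' _ _).add measurable_const
  · exact measurable_const

lemma GoodSmooth.mono {D : Type*} {k : D → D → ℝ} {f : D → ℝ} {n r : ℕ} {lam β γ K K' : ℝ}
    {zs : ℕ → D} (h : GoodSmooth k f n r lam β γ K zs) (hlam : 0 < lam) (hK : K ≤ K') :
    GoodSmooth k f n r lam β γ K' zs := by
  obtain ⟨h1, h2, h3, h4, h5⟩ := h
  refine ⟨h1.trans ?_, h2.trans ?_, fun b => (h3 b).trans ?_, fun i => (h4 i).trans hK,
    fun i => (h5 i).trans hK⟩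
  · exact mul_le_mul_of_nonneg_right hK (by positivity)
  · exact mul_le_mul_of_nonneg_right hK (by positivity)
  · refine mul_le_mul_of_nonneg_right (mul_le_mul_of_nonneg_right hK (by positivity)) ?_
    exact Finset.sum_nonneg fun _ _ => sq_nonneg _

/-- indicator version of the coefficients -/
def indA {D : Type*} (k : D → D → ℝ) (r : ℕ) (lam : ℝ) (G : Set (ℕ → D)) (i l : ℕ) : (ℕ → D) → ℝ :=
  G.indicator fun zs => acoef k zs r lam (zs i) l

def inda {D : Type*} (k : D → D → ℝ) (f : D → ℝ) (r : ℕ) (lam : ℝ) (G : Set (ℕ → D)) (i : ℕ) :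
    (ℕ → D) → ℝ :=
  G.indicator fun zs => ∑ l ∈ Finset.range r, acoef k zs r lam (zs i) l * f (zs l) - f (zs i)

lemma smBound_of_good {D : Type*} [MeasurableSpace D] (k : D → D → ℝ)
    (hk : Measurable fun q : D × D => k q.1 q.2) (f : D → ℝ) (hf : Measurable f) (n r : ℕ)
    (lam β γ K : ℝ) (hlam : 0 < lam) (hK : 0 ≤ K) (G : Set (ℕ → D)) (hG : MeasurableSet G)
    (hgood : ∀ zs ∈ G, GoodSmooth k f n r lam β γ K zs) :
    SmBound (indA k r lam G) (inda k f r lam G) n r (K * (n * lam ^ β)) (K * (n * lam ^ (-γ) / r))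
      (K * (n / r)) K := by
  have hKi : ∀ zs i, ∑ l ∈ Finset.range r, indA k r lam G i l zs ^ 2 ≤ K := by
    intro zs i
    by_cases h : zs ∈ G
    · simpa [indA, h] using (hgood zs h).2.2.2.1 i
    · simp [indA, h, hK]
  have hKa : ∀ zs i, inda k f r lam G i zs ^ 2 ≤ K := by
    intro zs i
    by_cases h : zs ∈ G
    · simpa [inda, h] using (hgood zs h).2.2.2.2 i
    · simp [inda, h, hK]
  constructor
  · intro i l
    refine BM.of_sq_le ((measurable_acoef k hk r lam i l).indicator hG) K fun zs => ?_
    by_cases hl : l < r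
    · exact (Finset.single_le_sum (f := fun l => indA k r lam G i l zs ^ 2)
        (fun _ _ => sq_nonneg _) (Finset.mem_range.2 hl)).trans (hKi zs i)
    · have : indA k r lam G i l zs = 0 := by
        simp [indA, acoef, hl]
      rw [this]; simpa using hK
  · intro i
    refine BM.of_sq_le (Measurable.indicator ?_ hG) K fun zs => hKa zs i
    refine (Finset.measurable_fun_sum _ fun l _ => (measurable_acoef k hk r lam i l).mul ?_).sub ?_
    · exact hf.comp (measurable_pi_apply l)
    · exact hf.comp (measurable_pi_apply i)
  · intro zs
    by_cases h : zs ∈ G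
    · simpa [inda, h] using (hgood zs h).1
    · simp [inda, h]; positivity
  · intro zs
    by_cases h : zs ∈ G
    · simpa [indA, h] using (hgood zs h).2.1
    · simp [indA, h]; positivity
  · intro zs v
    by_cases h : zs ∈ G
    · simpa [indA, h] using (hgood zs h).2.2.1 v
    · simp [indA, h]
      exact mul_nonneg (by positivity) (Finset.sum_nonneg fun _ _ => sq_nonneg _)
  · exact hKi
  · exact hKa

section Remainder3

variable {VV P1 P2 DZ : Type*} [MeasurableSpace VV] [MeasurableSpace P1] [MeasurableSpace P2]
  [MeasurableSpace DZ]

/-- the difference of plug-in and oracle statistics -/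
def uDiff (k1 k2 : DZ → DZ → ℝ) (f1 f2 : DZ → ℝ) (g1 : P1 → ℝ) (g2 : P2 → ℝ)
    (π1 : VV → P1) (π2 : VV → P2) (ζ : VV → DZ) (r : ℕ) (lam : ℝ) (i : ℕ) (y : ℕ → VV) : ℝ :=
  (g1 (π1 (y i)) - rls k1 (fun l => ζ (y l)) (fun l => g1 (π1 (y l))) r lam (ζ (y i))) *
    (g2 (π2 (y i)) - rls k2 (fun l => ζ (y l)) (fun l => g2 (π2 (y l))) r lam (ζ (y i))) -
  (g1 (π1 (y i)) - f1 (ζ (y i))) * (g2 (π2 (y i)) - f2 (ζ (y i)))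

lemma resid_eq (k1 : DZ → DZ → ℝ) (f1 : DZ → ℝ) (g1 : P1 → ℝ) (z1 : P1 → DZ)
    (π1 : VV → P1) (ζ : VV → DZ) (hz : ∀ v, ζ v = z1 (π1 v)) (r : ℕ) (lam : ℝ) (i : ℕ) (y : ℕ → VV)
    (G : Set (ℕ → DZ)) (hy : (fun m => ζ (y m)) ∈ G) :
    g1 (π1 (y i)) - rls k1 (fun l => ζ (y l)) (fun l => g1 (π1 (y l))) r lam (ζ (y i)) =
    (g1 (π1 (y i)) - f1 (ζ (y i))) -
      devi (indA k1 r lam G) (inda k1 f1 r lam G) π1 ζ (fun p => g1 p - f1 (z1 p)) r i y := by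
  rw [rls_eq_acoef]
  simp only [devi, smo, indA, inda, Set.indicator_of_mem hy, ← hz]
  simp only [mul_sub, Finset.sum_sub_distrib]
  ring

lemma uDiff_eq (k1 k2 : DZ → DZ → ℝ) (f1 f2 : DZ → ℝ) (g1 : P1 → ℝ) (g2 : P2 → ℝ)
    (z1 : P1 → DZ) (z2 : P2 → DZ)
    (π1 : VV → P1) (π2 : VV → P2) (ζ : VV → DZ) (hz1 : ∀ v, ζ v = z1 (π1 v))
    (hz2 : ∀ v, ζ v = z2 (π2 v)) (r : ℕ) (lam : ℝ) (i : ℕ) (y : ℕ → VV)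
    (G : Set (ℕ → DZ)) (hy : (fun m => ζ (y m)) ∈ G) :
    uDiff k1 k2 f1 f2 g1 g2 π1 π2 ζ r lam i y =
    devi (indA k1 r lam G) (inda k1 f1 r lam G) π1 ζ (fun p => g1 p - f1 (z1 p)) r i y *
      devi (indA k2 r lam G) (inda k2 f2 r lam G) π2 ζ (fun p => g2 p - f2 (z2 p)) r i y -
    devi (indA k1 r lam G) (inda k1 f1 r lam G) π1 ζ (fun p => g1 p - f1 (z1 p)) r i y *
      (fun p => g2 p - f2 (z2 p)) (π2 (y i)) -
    (fun p => g1 p - f1 (z1 p)) (π1 (y i)) *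
      devi (indA k2 r lam G) (inda k2 f2 r lam G) π2 ζ (fun p => g2 p - f2 (z2 p)) r i y := by
  unfold uDiff
  rw [resid_eq k1 f1 g1 z1 π1 ζ hz1 r lam i y G hy, resid_eq k2 f2 g2 z2 π2 ζ hz2 r lam i y G hy]
  simp only [← hz1, ← hz2]
  ring

def bnd1 (n r : ℕ) (lam β γ M K : ℝ) : ℝ :=
  6 * (2 * (M ^ 2 * (2 * (K * (n * lam ^ β)) + 2 * (M ^ 2 * (K * (n * lam ^ (-γ) / r))))) +
    (K * (n * lam ^ β)) ^ 2 + 2 * (M ^ 2 * ((K * (n / r)) * (K * (n * lam ^ β)))) +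
        M ^ 2 * ((K * (n / r)) * (M ^ 2 * (K * (n * lam ^ (-γ) / r)))))

def bnd2 (n r : ℕ) (lam β γ M K : ℝ) : ℝ :=
      12 * (K * (K * (n * lam ^ β)) + 2 * (K * (M ^ 2 * (K * (n * lam ^ (-γ) / r)))) +
        M ^ 2 * (K * (M ^ 2 * (K * (n * lam ^ (-γ) / r))))) +
        6 * (M ^ 2 * (2 * (K * (n * lam ^ β)) + 2 * (M ^ 2 * (K * (n * lam ^ (-γ) / r)))))

lemma tail_of_split {Y : Type*} [MeasurableSpace Y] (τ : Measure Y) [IsProbabilityMeasure τ]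
    (F H : Y → ℝ) (hH0 : ∀ y, 0 ≤ H y) (hHi : Integrable H τ) (S : Set Y) (hFH : ∀ y ∈ S, F y = H y)
    (B c η : ℝ) (hc : 0 < c) (hB : ∫ y, H y ∂τ ≤ B) (hS : τ Sᶜ ≤ ENNReal.ofReal η) :
    τ {y | c ≤ F y} ≤ ENNReal.ofReal η + ENNReal.ofReal (B / c) := by
  have h1 : {y | c ≤ F y} ⊆ Sᶜ ∪ {y | c ≤ H y} := by
    intro y hy
    by_cases h : y ∈ S
    · right
      simpa [← hFH y h] using hy
    · left; exact h
  refine (measure_mono h1).trans ((measure_union_le _ _).trans (add_le_add hS ?_))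
  have h2 := mul_meas_ge_le_integral_of_nonneg (μ := τ) (Filter.Eventually.of_forall hH0) hHi c
  rw [← ofReal_measureReal]
  refine ENNReal.ofReal_le_ofReal ?_
  rw [le_div_iff₀ hc]
  linarith

variable {ρ : Measure VV} [IsProbabilityMeasure ρ]
    {τ : Measure (ℕ → VV)} [IsProbabilityMeasure τ]
    {π1 : VV → P1} {π2 : VV → P2} {ζ : VV → DZ} {z1 : P1 → DZ}
    {z2 : P2 → DZ} {M : ℝ}

lemma remainder_tail (hind : iIndepFun (fun i (y : ℕ → VV) => y i) τ)
    (hlaw : ∀ i, τ.map (fun y => y i) = ρ) (k1 k2 : DZ → DZ → ℝ)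
    (hk1 : Measurable fun q : DZ × DZ => k1 q.1 q.2) (hk2 : Measurable fun q : DZ × DZ => k2 q.1 q.2)
    (f1 f2 : DZ → ℝ) (hf1 : Measurable f1) (hf2 : Measurable f2) (g1 : P1 → ℝ) (g2 : P2 → ℝ)
    (h : Noise ρ π1 π2 ζ z1 z2 (fun p => g1 p - f1 (z1 p)) M)
    (h' : Noise ρ π2 π1 ζ z2 z1 (fun p => g2 p - f2 (z2 p)) M)
    (n r : ℕ) (lam β γ K η : ℝ) (hlam : 0 < lam) (hK : 0 ≤ K) (G : Set (ℕ → DZ)) (hG : MeasurableSet G)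
    (hgood1 : ∀ zs ∈ G, GoodSmooth k1 f1 n r lam β γ K zs)
    (hgood2 : ∀ zs ∈ G, GoodSmooth k2 f2 n r lam β γ K zs)
    (hτG : τ {y | (fun m => ζ (y m)) ∈ G}ᶜ ≤ ENNReal.ofReal η) (c : ℝ) (hc : 0 < c) :
    τ {y | c ≤ (∑ i ∈ Finset.range n, uDiff k1 k2 f1 f2 g1 g2 π1 π2 ζ r lam i y) ^ 2} ≤
      ENNReal.ofReal η + ENNReal.ofReal (bnd1 n r lam β γ M K / c) ∧
    τ {y | c ≤ ∑ i ∈ Finset.range n, uDiff k1 k2 f1 f2 g1 g2 π1 π2 ζ r lam i y ^ 2} ≤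
      ENNReal.ofReal η + ENNReal.ofReal (bnd2 n r lam β γ M K / c) := by
  have hA := smBound_of_good k1 hk1 f1 hf1 n r lam β γ K hlam hK G hG hgood1
  have hB := smBound_of_good k2 hk2 f2 hf2 n r lam β γ K hlam hK G hG hgood2
  have ba : ∀ i, BM fun y : ℕ → VV => devi (indA k1 r lam G) (inda k1 f1 r lam G) π1 ζ
      (fun p => g1 p - f1 (z1 p)) r i y := fun i =>
    ((hA.ha i).comp (meas_seq h.mζ)).add (smo_BM h _ hA.hA r i)
  have bb : ∀ i, BM fun y : ℕ → VV => devi (indA k2 r lam G) (inda k2 f2 r lam G) π2 ζ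
      (fun p => g2 p - f2 (z2 p)) r i y := fun i =>
    ((hB.ha i).comp (meas_seq h.mζ)).add (smo_BM h' _ hB.hA r i)
  have be : ∀ i : ℕ, BM fun y : ℕ → VV => (fun p => g1 p - f1 (z1 p)) (π1 (y i)) :=
    fun i => h.bε.comp (meas_at h.mπ1 i)
  have bt : ∀ i : ℕ, BM fun y : ℕ → VV => (fun p => g2 p - f2 (z2 p)) (π2 (y i)) :=
    fun i => h'.bε.comp (meas_at h.mπ2 i)
  have bD := fun i => (((ba i).mul (bb i)).sub ((ba i).mul (bt i))).sub ((be i).mul (bb i))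
  constructor
  · refine tail_of_split τ _ _ (fun y => sq_nonneg _)
      ((BM.sum (Finset.range n) fun i _ => bD i).sq.integrable τ) _ ?_ _ c η hc ?_ hτG
    · intro y hy
      simp only [uDiff_eq k1 k2 f1 f2 g1 g2 z1 z2 π1 π2 ζ h.hz1 h.hz2 r lam _ y G hy]
    · exact rem_first hind hlaw h h' _ _ _ _ n r _ _ _ K (by positivity) hA hB
  · refine tail_of_split τ _ _ (fun y => Finset.sum_nonneg fun i _ => sq_nonneg _)
      ((BM.sum (Finset.range n) fun i _ => (bD i).sq).integrable τ) _ ?_ _ c η hc ?_ hτG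
    · intro y hy
      simp only [uDiff_eq k1 k2 f1 f2 g1 g2 z1 z2 π1 π2 ζ h.hz1 h.hz2 r lam _ y G hy]
    · exact rem_second hind hlaw h h' _ _ _ _ n r _ _ _ K hK hA hB

end Remainder3


/-! ### Part F4 : rates -/

lemma rates (β γ : ℝ) (hβ1 : 1 < β) (hβ2 : β ≤ 2) (hγ0 : 0 ≤ γ) (rn : ℕ → ℕ)
    (hro : (fun n : ℕ => (n : ℝ) ^ ((β + γ) / (2 * β))) =o[atTop] fun n => (rn n : ℝ)) :
    (∀ᶠ n in atTop, 1 ≤ rn n) ∧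
    (∀ s : ℝ, 0 < s → Tendsto (fun n => (rn n : ℝ) ^ (-s)) atTop (𝓝 0)) ∧
    (∀ s : ℝ, 2 * β / (β + γ) ≤ s → Tendsto (fun n : ℕ => n * (rn n : ℝ) ^ (-s)) atTop (𝓝 0)) := by
  have hθ : 0 < (β + γ) / (2 * β) := by positivity
  have hN : Tendsto (fun n : ℕ => (n : ℝ) ^ ((β + γ) / (2 * β))) atTop atTop :=
    (tendsto_rpow_atTop hθ).comp tendsto_natCast_atTop_atTop
  have hr : Tendsto (fun n => (rn n : ℝ)) atTop atTop := by
    have hb := hro.bound (c := 1) one_pos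
    refine tendsto_atTop_mono' _ ?_ hN
    filter_upwards [hb] with n hn
    rw [Real.norm_of_nonneg (by positivity), Real.norm_of_nonneg (by positivity)] at hn
    linarith
  have hr1 : ∀ᶠ n in atTop, 1 ≤ rn n := by
    filter_upwards [hr.eventually_ge_atTop 1] with n hn
    exact_mod_cast hn
  refine ⟨hr1, fun s hs => (tendsto_rpow_neg_atTop hs).comp hr, fun s hs => ?_⟩
  have hq : Tendsto (fun n : ℕ => (n : ℝ) ^ ((β + γ) / (2 * β)) / (rn n : ℝ)) atTop (𝓝 0) :=
    hro.tendsto_div_nhds_zero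
  have hinv : 0 < 2 * β / (β + γ) := by positivity
  have hq2 := hq.rpow_const (p := 2 * β / (β + γ)) (Or.inr hinv.le)
  rw [Real.zero_rpow hinv.ne'] at hq2
  refine squeeze_zero' (Filter.Eventually.of_forall fun n => by positivity) ?_ hq2
  filter_upwards [hr1] with n hn
  have hn' : (1 : ℝ) ≤ rn n := by exact_mod_cast hn
  rw [Real.div_rpow (by positivity) (by positivity), ← Real.rpow_mul (by positivity)]
  have : (β + γ) / (2 * β) * (2 * β / (β + γ)) = 1 := by field_simp
  rw [this, Real.rpow_one, div_eq_mul_inv, ← Real.rpow_neg (by positivity)]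
  refine mul_le_mul_of_nonneg_left ?_ (by positivity)
  exact Real.rpow_le_rpow_of_exponent_le hn' (by linarith)

lemma rates' (β γ : ℝ) (hβ1 : 1 < β) (hβ2 : β ≤ 2) (hγ0 : 0 ≤ γ) (rn : ℕ → ℕ)
    (hro : (fun n : ℕ => (n : ℝ) ^ ((β + γ) / (2 * β))) =o[atTop] fun n => (rn n : ℝ)) (M K : ℝ) :
    Tendsto (fun n : ℕ => bnd1 n (rn n) ((rn n : ℝ) ^ (-(1 / (1 + γ)))) β γ M K / n) atTop (𝓝 0) ∧
    Tendsto (fun n : ℕ => bnd2 n (rn n) ((rn n : ℝ) ^ (-(1 / (1 + γ)))) β γ M K / n) atTop (𝓝 0) := by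
  obtain ⟨h1, h2, h3⟩ := rates β γ hβ1 hβ2 hγ0 rn hro
  have a1 := h2 (β / (1 + γ)) (by positivity)
  have a2 := h2 (1 / (1 + γ)) (by positivity)
  have a3 := h3 (2 * β / (1 + γ)) (by
    apply div_le_div_of_nonneg_left <;> linarith)
  have a4 := h3 (β / (1 + γ) + 1) (by
    rw [div_add_one (by positivity), div_le_div_iff₀ (by positivity) (by positivity)]
    nlinarith [mul_nonneg hγ0 hγ0])
  have a5 := h3 (2 - γ / (1 + γ)) (by
    rw [show 2 - γ / (1 + γ) = (2 + γ) / (1 + γ) by field_simp; ring,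
      div_le_div_iff₀ (by positivity) (by positivity)]
    nlinarith [mul_nonneg hγ0 hγ0])
  have ev : ∀ᶠ n : ℕ in atTop, (0 : ℝ) < n ∧ (0 : ℝ) < rn n := by
    filter_upwards [h1, eventually_ge_atTop 1] with n hn hn1
    exact ⟨by exact_mod_cast hn1, by exact_mod_cast hn⟩
  have e1 : ∀ n, ((rn n : ℝ) ^ (-(1 / (1 + γ)))) ^ β = (rn n : ℝ) ^ (-(β / (1 + γ))) := by
    intro n
    rw [← Real.rpow_mul (by positivity)]; congr 1; ring
  have e2 : ∀ n, 0 < (rn n : ℝ) →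
      ((rn n : ℝ) ^ (-(1 / (1 + γ)))) ^ (-γ) / (rn n) = (rn n : ℝ) ^ (-(1 / (1 + γ))) := by
    intro n hn
    rw [← Real.rpow_mul (by positivity)]
    nth_rewrite 2 [← Real.rpow_one (rn n : ℝ)]
    rw [← Real.rpow_sub hn]; congr 1; field_simp; ring
  have e3 : ∀ n, 0 < (rn n : ℝ) → ((rn n : ℝ) ^ (-(β / (1 + γ)))) ^ 2 =
      (rn n : ℝ) ^ (-(2 * β / (1 + γ))) := by
    intro n hn
    rw [pow_two, ← Real.rpow_add hn]; congr 1; ring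
  have e4 : ∀ n, 0 < (rn n : ℝ) → (rn n : ℝ) ^ (-(β / (1 + γ))) / (rn n) =
      (rn n : ℝ) ^ (-(β / (1 + γ) + 1)) := by
    intro n hn
    nth_rewrite 2 [← Real.rpow_one (rn n : ℝ)]
    rw [← Real.rpow_sub hn]; congr 1; ring
  have e5 : ∀ n, 0 < (rn n : ℝ) → (rn n : ℝ) ^ (-(1 / (1 + γ))) / (rn n) =
      (rn n : ℝ) ^ (-(2 - γ / (1 + γ))) := by
    intro n hn
    nth_rewrite 2 [← Real.rpow_one (rn n : ℝ)]
    rw [← Real.rpow_sub hn]; congr 1; field_simp; ring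
  constructor
  · have := (((((a1.const_mul (2 * K)).add (a2.const_mul (2 * (M ^ 2 * K)))).const_mul (2 * M ^ 2)).add
      (a3.const_mul (K ^ 2))).add ((a4.const_mul (2 * M ^ 2 * K ^ 2)).add
        (a5.const_mul (M ^ 4 * K ^ 2)))).const_mul 6
    simp only [mul_zero, add_zero] at this
    refine this.congr' ?_
    filter_upwards [ev] with n ⟨hn, hr⟩
    unfold bnd1
    rw [← e3 n hr, ← e4 n hr, ← e5 n hr, mul_div_assoc (n : ℝ), e2 n hr, e1 n]
    field_simp
    try ring
  · have := ((a1.const_mul (K * K)).add (a2.const_mul (2 * K * M ^ 2 * K + M ^ 4 * K * K))).const_mul 12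
    have := this.add (((a1.const_mul (2 * K)).add (a2.const_mul (2 * M ^ 2 * K))).const_mul (6 * M ^ 2))
    simp only [mul_zero, add_zero] at this
    refine this.congr' ?_
    filter_upwards [ev] with n ⟨hn, hr⟩
    unfold bnd2
    rw [mul_div_assoc (n : ℝ), e2 n hr, e1 n]
    field_simp
    try ring

lemma tail_tendsto {Y : Type*} [MeasurableSpace Y] (τ : Measure Y) (F : ℕ → Y → ℝ)
    (h : ∀ η : ℝ, 0 < η → ∃ B : ℕ → ℝ, Tendsto (fun n : ℕ => B n / n) atTop (𝓝 0) ∧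
      ∀ᶠ n : ℕ in atTop, ∀ c : ℝ, 0 < c →
        τ {y | c ≤ F n y} ≤ ENNReal.ofReal η + ENNReal.ofReal (B n / c)) (c : ℝ) (hc : 0 < c) :
    Tendsto (fun n : ℕ => τ {y | c * n ≤ F n y}) atTop (𝓝 0) := by
  rw [ENNReal.tendsto_nhds_zero]
  intro ε hε
  obtain ⟨η, hη0, hη⟩ : ∃ η : ℝ, 0 < η ∧ ENNReal.ofReal (2 * η) ≤ ε := by
    rcases eq_or_ne ε ⊤ with rfl | hne
    · exact ⟨1, one_pos, le_top⟩
    · refine ⟨ε.toReal / 2, by have := ENNReal.toReal_pos hε.ne' hne; positivity, ?_⟩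
      rw [mul_div_cancel₀ _ two_ne_zero, ENNReal.ofReal_toReal hne]
  obtain ⟨B, hB, hev⟩ := h η hη0
  have hB' : Tendsto (fun n : ℕ => B n / (c * n)) atTop (𝓝 0) := by
    have := hB.const_mul c⁻¹
    rw [mul_zero] at this
    refine this.congr fun n => ?_
    rw [mul_comm c, ← div_div, div_eq_mul_inv _ c, mul_comm]
  filter_upwards [hev, hB'.eventually_le_const hη0, eventually_ge_atTop 1] with n h1 h2 h3
  have hn : (0 : ℝ) < n := by exact_mod_cast h3
  refine (h1 (c * n) (by positivity)).trans (le_trans ?_ hη)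
  rw [two_mul, ENNReal.ofReal_add hη0.le hη0.le]
  gcongr


/-! ### Part F5 : the remainder is negligible -/

lemma remainder_negligible {VV P1 P2 DZ : Type} [MeasurableSpace VV] [MeasurableSpace P1]
    [MeasurableSpace P2] [TopologicalSpace DZ] [SecondCountableTopology DZ]
    [MeasurableSpace DZ] [BorelSpace DZ]
    {ρ : Measure VV} [IsProbabilityMeasure ρ]
    {τ : Measure (ℕ → VV)} [IsProbabilityMeasure τ]
    {π1 : VV → P1} {π2 : VV → P2} {ζ : VV → DZ} {z1 : P1 → DZ}
    {z2 : P2 → DZ} {M : ℝ} (hind : iIndepFun (fun i (y : ℕ → VV) => y i) τ)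
    (hlaw : ∀ i, τ.map (fun y => y i) = ρ) (k1 k2 : DZ → DZ → ℝ)
    (hs1 : ∀ x y, k1 x y = k1 y x) (hs2 : ∀ x y, k2 x y = k2 y x)
    (hpd1 : PosDefKernel k1) (hpd2 : PosDefKernel k2)
    (hb1 : BoundedKernel k1) (hb2 : BoundedKernel k2)
    (hc1 : Continuous fun q : DZ × DZ => k1 q.1 q.2) (hc2 : Continuous fun q : DZ × DZ => k2 q.1 q.2)
    (P : Measure DZ) [IsProbabilityMeasure P] (hP : ρ.map ζ = P)
    (L1 L2 Lβ1 Lβ2 : Lp ℝ 2 P →L[ℝ] Lp ℝ 2 P)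
    (hL1 : ∀ g : Lp ℝ 2 P, (L1 g : DZ → ℝ) =ᵐ[P] fun z => ∫ z', k1 z z' * g z' ∂P)
    (hL2 : ∀ g : Lp ℝ 2 P, (L2 g : DZ → ℝ) =ᵐ[P] fun z => ∫ z', k2 z z' * g z' ∂P)
    (Q γ β : ℝ) (hQ : 0 < Q) (hγ0 : 0 ≤ γ) (hβ1 : 1 < β) (hβ2 : β ≤ 2)
    (hT1 : TraceAssumption P L1 Q γ) (hT2 : TraceAssumption P L2 Q γ)
    (hF1 : IsFracPower L1 (β / 2) Lβ1) (hF2 : IsFracPower L2 (β / 2) Lβ2)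
    (e1 e2 f1 f2 : DZ → ℝ) (hf1 : Measurable f1) (hf2 : Measurable f2)
    (hef1 : f1 =ᵐ[P] e1) (hef2 : f2 =ᵐ[P] e2) (hm1 : MemLp e1 2 P) (hm2 : MemLp e2 2 P)
    (hr1 : MemLp.toLp e1 hm1 ∈ Set.range Lβ1) (hr2 : MemLp.toLp e2 hm2 ∈ Set.range Lβ2)
    (g1 : P1 → ℝ) (g2 : P2 → ℝ)
    (h : Noise ρ π1 π2 ζ z1 z2 (fun p => g1 p - f1 (z1 p)) M)
    (h' : Noise ρ π2 π1 ζ z2 z1 (fun p => g2 p - f2 (z2 p)) M)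
    (rn : ℕ → ℕ) (hrn : ∀ n, rn n ≤ n)
    (hro : (fun n : ℕ => (n : ℝ) ^ ((β + γ) / (2 * β))) =o[atTop] fun n => (rn n : ℝ))
    (c : ℝ) (hc : 0 < c) :
    Tendsto (fun n : ℕ => τ {y | c * n ≤ (∑ i ∈ Finset.range n,
      uDiff k1 k2 f1 f2 g1 g2 π1 π2 ζ (rn n) ((rn n : ℝ) ^ (-(1 / (1 + γ)))) i y) ^ 2}) atTop (𝓝 0) ∧
    Tendsto (fun n : ℕ => τ {y | c * n ≤ ∑ i ∈ Finset.range n,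
      uDiff k1 k2 f1 f2 g1 g2 π1 π2 ζ (rn n) ((rn n : ℝ) ^ (-(1 / (1 + γ)))) i y ^ 2}) atTop (𝓝 0) := by
  have hmz : Measurable fun (y : ℕ → VV) (m : ℕ) => ζ (y m) := meas_seq h.mζ
  set σ : Measure (ℕ → DZ) := τ.map fun y m => ζ (y m) with hσ
  haveI : IsProbabilityMeasure σ := Measure.isProbabilityMeasure_map hmz.aemeasurable
  have hσlaw : ∀ i, σ.map (fun x => x i) = P := by
    intro i
    rw [hσ, Measure.map_map (measurable_pi_apply i) hmz, ← hP, ← hlaw i,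
      Measure.map_map h.mζ (measurable_pi_apply i)]
    rfl
  have hσind : iIndepFun (fun i (x : ℕ → DZ) => x i) σ := by
    have h0 : iIndepFun (fun i (y : ℕ → VV) => ζ (y i)) τ := hind.comp (fun _ => ζ) fun _ => h.mζ
    rw [iIndepFun_iff_map_fun_eq_infinitePi_map (fun i => measurable_pi_apply i)]
    rw [iIndepFun_iff_map_fun_eq_infinitePi_map (X := fun (i : ℕ) (y : ℕ → VV) => ζ (y i))
      (fun i => h.mζ.comp (measurable_pi_apply i))] at h0
    have e : (fun i => σ.map (fun x : ℕ → DZ => x i)) = fun i => τ.map (fun y : ℕ → VV => ζ (y i)) := by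
      funext i
      rw [hσ, Measure.map_map (measurable_pi_apply i) hmz]
      rfl
    rw [e, ← h0]
    exact Measure.map_id
  have key : ∀ η : ℝ, 0 < η → ∃ K : ℝ, ∀ᶠ n : ℕ in atTop, ∀ c : ℝ, 0 < c →
      τ {y | c ≤ (∑ i ∈ Finset.range n, uDiff k1 k2 f1 f2 g1 g2 π1 π2 ζ (rn n)
          ((rn n : ℝ) ^ (-(1 / (1 + γ)))) i y) ^ 2} ≤
        ENNReal.ofReal η + ENNReal.ofReal (bnd1 n (rn n) ((rn n : ℝ) ^ (-(1 / (1 + γ)))) β γ M K / c) ∧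
      τ {y | c ≤ ∑ i ∈ Finset.range n, uDiff k1 k2 f1 f2 g1 g2 π1 π2 ζ (rn n)
          ((rn n : ℝ) ^ (-(1 / (1 + γ)))) i y ^ 2} ≤
        ENNReal.ofReal η + ENNReal.ofReal (bnd2 n (rn n) ((rn n : ℝ) ^ (-(1 / (1 + γ)))) β γ M K / c) := by
    intro η hη
    obtain ⟨K1, hK10, hK1⟩ := good_event_kernel P σ hσind hσlaw k1 hs1 hpd1 hb1 hc1 L1 Lβ1 hL1 Q γ β hQ
      hγ0 hβ1 hβ2 hT1 hF1 e1 f1 hef1 hm1 hr1 (η / 2) (half_pos hη)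
    obtain ⟨K2, hK20, hK2⟩ := good_event_kernel P σ hσind hσlaw k2 hs2 hpd2 hb2 hc2 L2 Lβ2 hL2 Q γ β hQ
      hγ0 hβ1 hβ2 hT2 hF2 e2 f2 hef2 hm2 hr2 (η / 2) (half_pos hη)
    refine ⟨max K1 K2, ?_⟩
    filter_upwards [(rates β γ hβ1 hβ2 hγ0 rn hro).1] with n hn c hc
    obtain ⟨G1, hG1, hG1p, hG1g⟩ := hK1 n (rn n) hn (hrn n)
    obtain ⟨G2, hG2, hG2p, hG2g⟩ := hK2 n (rn n) hn (hrn n)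
    have hlam : 0 < (rn n : ℝ) ^ (-(1 / (1 + γ))) :=
      Real.rpow_pos_of_pos (by exact_mod_cast hn) _
    refine remainder_tail hind hlaw k1 k2 hc1.measurable hc2.measurable f1 f2 hf1 hf2 g1 g2 h h' n (rn n)
      _ β γ (max K1 K2) η hlam (hK10.trans (le_max_left _ _)) (G1 ∩ G2) (hG1.inter hG2)
      (fun zs hzs => (hG1g zs hzs.1).mono hlam (le_max_left _ _))
      (fun zs hzs => (hG2g zs hzs.2).mono hlam (le_max_right _ _)) ?_ c hc
    have : {y : ℕ → VV | (fun m => ζ (y m)) ∈ G1 ∩ G2}ᶜ = (fun y m => ζ (y m)) ⁻¹' (G1 ∩ G2)ᶜ := rfl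
    rw [this, ← Measure.map_apply hmz (hG1.inter hG2).compl, Set.compl_inter]
    refine (measure_union_le _ _).trans ((add_le_add hG1p hG2p).trans ?_)
    rw [← ENNReal.ofReal_add (by positivity) (by positivity), add_halves]
  constructor
  · refine tail_tendsto τ _ (fun η hη => ?_) c hc
    obtain ⟨K, hK⟩ := key η hη
    exact ⟨_, (rates' β γ hβ1 hβ2 hγ0 rn hro M K).1, hK.mono fun n hn c hc => (hn c hc).1⟩
  · refine tail_tendsto τ _ (fun η hη => ?_) c hc
    obtain ⟨K, hK⟩ := key η hη
    exact ⟨_, (rates' β γ hβ1 hβ2 hγ0 rn hro M K).2, hK.mono fun n hn c hc => (hn c hc).2⟩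


/-! ### Part D2 : consequences of conditional independence and kernel regularity -/

lemma orth_of_condIndep {Ω A B C : Type*} [MeasurableSpace Ω] [StandardBorelSpace Ω]
    [MeasurableSpace A] [MeasurableSpace B] [MeasurableSpace C] [StandardBorelSpace A] [Nonempty A]
    [StandardBorelSpace B] [Nonempty B]
    (μ : Measure Ω) [IsProbabilityMeasure μ] (X : Ω → A) (Y : Ω → B) (Z : Ω → C)
    (hX : Measurable X) (hY : Measurable Y) (hZ : Measurable Z)
    (hH0 : CondIndepFun (MeasurableSpace.comap Z inferInstance) hZ.comap_le X Y μ)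
    (g : A × C → ℝ) (hg : BM g) (f : C → ℝ) (hf : BM f)
    (hfe : (fun ω => f (Z ω)) =ᵐ[μ]
      μ[fun ω' => g (X ω', Z ω') | MeasurableSpace.comap Z inferInstance])
    (q : B × C → ℝ) (hq : BM q) :
    ∫ ω, q (Y ω, Z ω) * (g (X ω, Z ω) - f (Z ω)) ∂μ = 0 := by
  have h1 := (condIndepFun_iff_condDistrib_prod_ae_eq_prodMkRight hX hY hZ).1 hH0.symm
  have h2 := ae_of_ae_map (hZ.prodMk hY).aemeasurable h1
  have bg : BM fun p : (C × B) × A => g (p.2, p.1.1) := hg.comp (by fun_prop)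
  have bg' : BM fun p : C × A => g (p.2, p.1) := hg.comp (by fun_prop)
  have h3 := condExp_prod_ae_eq_integral_condDistrib (μ := μ) (hZ.prodMk hY) hX.aemeasurable
    (f := fun p : (C × B) × A => g (p.2, p.1.1)) bg.1.stronglyMeasurable
    ((bg.comp ((hZ.prodMk hY).prodMk hX)).integrable μ)
  have h4 := condExp_prod_ae_eq_integral_condDistrib (μ := μ) hZ hX.aemeasurable
    (f := fun p : C × A => g (p.2, p.1)) bg'.1.stronglyMeasurable
    ((bg'.comp (hZ.prodMk hX)).integrable μ)
  have hmle := (hZ.prodMk hY).comap_le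
  have h5 : μ[fun ω => g (X ω, Z ω) | MeasurableSpace.comap (fun ω => (Z ω, Y ω)) inferInstance] =ᵐ[μ] fun ω => f (Z ω) := by
    filter_upwards [h2, h3, h4, hfe] with ω h2 h3 h4 h5
    rw [h5, h4, h3, h2]
    rfl
  have bG : BM fun ω => g (X ω, Z ω) := hg.comp (hX.prodMk hZ)
  have bq : BM fun ω => q (Y ω, Z ω) := hq.comp (hY.prodMk hZ)
  have bf : BM fun ω => f (Z ω) := hf.comp hZ
  have hqm : StronglyMeasurable[MeasurableSpace.comap (fun ω => (Z ω, Y ω)) inferInstance] fun ω => q (Y ω, Z ω) := by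
    have : Measurable[MeasurableSpace.comap (fun ω => (Z ω, Y ω)) inferInstance] fun ω => q (Y ω, Z ω) := by
      refine (hq.1.comp (measurable_swap : Measurable (Prod.swap : C × B → B × C))).comp
        (comap_measurable (fun ω => (Z ω, Y ω)))
    exact this.stronglyMeasurable
  have h6 : μ[fun ω => q (Y ω, Z ω) * g (X ω, Z ω) | MeasurableSpace.comap (fun ω => (Z ω, Y ω)) inferInstance] =ᵐ[μ]
      fun ω => q (Y ω, Z ω) * (μ[fun ω => g (X ω, Z ω) | MeasurableSpace.comap (fun ω => (Z ω, Y ω)) inferInstance]) ω :=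
    condExp_mul_of_stronglyMeasurable_left hqm ((bq.mul bG).integrable μ) (bG.integrable μ)
  have h7 : ∫ ω, q (Y ω, Z ω) * g (X ω, Z ω) ∂μ = ∫ ω, q (Y ω, Z ω) * f (Z ω) ∂μ := by
    rw [← integral_condExp hmle]
    refine integral_congr_ae ?_
    filter_upwards [h6, h5] with ω h6 h5
    rw [h6, h5]
  simp only [mul_sub]
  rw [integral_sub ((bq.mul bG).integrable μ) ((bq.mul bf).integrable μ), h7, sub_self]

lemma kernel_regular {DX DY : Type*} [MeasurableSpace DX] [MeasurableSpace DY]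
    [NormedAddCommGroup DX] [NormedSpace ℝ DX] [NormedAddCommGroup DY] [NormedSpace ℝ DY]
    [MeasurableSingletonClass DX] [MeasurableSingletonClass DY] [Nontrivial DX]
    (kX : DX → DX → ℝ) (kY : DY → DY → ℝ) (hk : Assumption1 kX kY) :
    ∃ C, (∀ x x', |kX x x'| ≤ C) ∧ (∀ y y', |kY y y'| ≤ C) ∧
      (∀ x, Continuous (kX x)) ∧ (∀ y, Continuous (kY y)) := by
  have hne : ∃ x x' y y', kX x x' * kY y y' ≠ 0 := by
    by_contra hcon
    push Not at hcon
    obtain ⟨a, b, hab⟩ := exists_pair_ne DX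
    have := hk.charac (Measure.dirac (a, 0)) (Measure.dirac (b, 0)) inferInstance inferInstance
      (fun t => by simp [meanEmbed, hcon])
    refine dirac_ne_dirac (x := (a, (0 : DY))) (y := (b, 0)) (by simp [hab]) this
  obtain ⟨x0, x0', y0, y0', h0⟩ := hne
  have hx0 : kX x0 x0' ≠ 0 := left_ne_zero_of_mul h0
  have hy0 : kY y0 y0' ≠ 0 := right_ne_zero_of_mul h0
  obtain ⟨C, hC⟩ := hk.bounded
  refine ⟨max (C / |kY y0 y0'|) (C / |kX x0 x0'|), fun x x' => ?_, fun y y' => ?_, fun x => ?_, fun y => ?_⟩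
  · refine le_trans ?_ (le_max_left _ _)
    rw [le_div_iff₀ (abs_pos.2 hy0), ← abs_mul]
    exact hC (x, y0) (x', y0')
  · refine le_trans ?_ (le_max_right _ _)
    rw [le_div_iff₀ (abs_pos.2 hx0), mul_comm, ← abs_mul]
    exact hC (x0, y) (x0', y')
  · have h1 : Continuous fun x' : DX => kX x x' * kY y0 y0' :=
      hk.continuous.comp (f := fun x' : DX => (((x, y0), (x', y0')) : (DX × DY) × (DX × DY)))
        (by fun_prop)
    have := h1.mul_const (kY y0 y0')⁻¹
    refine this.congr fun x' => ?_
    field_simp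
  · have h1 : Continuous fun y' : DY => kX x0 x0' * kY y y' :=
      hk.continuous.comp (f := fun y' : DY => (((x0, y), (x0', y')) : (DX × DY) × (DX × DY)))
        (by fun_prop)
    have := h1.const_mul (kX x0 x0')⁻¹
    refine this.congr fun x' => ?_
    field_simp

theorem cramer_wold {Ω : Type} [MeasurableSpace Ω] (μ : Measure Ω) [IsProbabilityMeasure μ]
    {J : ℕ} {Ω' : Type} [MeasurableSpace Ω'] (ν : Measure Ω') [IsProbabilityMeasure ν]
    (V : ℕ → Ω → Fin J → ℝ) (W : Ω' → Fin J → ℝ) (hV : ∀ n, Measurable (V n))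
    (hW : Measurable W)
    (h : ∀ a : Fin J → ℝ, MeasureTheory.TendstoInDistribution
      (fun n ω => ∑ j, a j * V n ω j) atTop (fun x => ∑ j, a j * W x j) (fun _ => μ) ν) :
    MeasureTheory.TendstoInDistribution V atTop W (fun _ => μ) ν := by
  have hcont : Continuous (fun v : Fin J → ℝ => (WithLp.toLp 2 v : EuclideanSpace ℝ (Fin J))) :=
    PiLp.continuous_toLp 2 _
  have key : MeasureTheory.TendstoInDistribution
      (fun n ω => (WithLp.toLp 2 (V n ω) : EuclideanSpace ℝ (Fin J))) atTop
      (fun x => (WithLp.toLp 2 (W x) : EuclideanSpace ℝ (Fin J))) (fun _ => μ) ν := by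
    refine ⟨fun n => (hcont.measurable.comp (hV n)).aemeasurable,
      (hcont.measurable.comp hW).aemeasurable, ?_⟩
    refine ProbabilityMeasure.tendsto_iff_tendsto_charFun.2 fun s => ?_
    have h1 := ProbabilityMeasure.tendsto_iff_tendsto_charFun.1 (h (fun j => s j)).tendsto
    have h2 := h1 1
    simp only [ProbabilityMeasure.coe_mk] at h2
    change Tendsto (fun n => charFun (μ.map (fun ω =>
      (WithLp.toLp 2 (V n ω) : EuclideanSpace ℝ (Fin J)))) s) atTop
      (𝓝 (charFun (ν.map (fun x => (WithLp.toLp 2 (W x) : EuclideanSpace ℝ (Fin J)))) s))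
    have hmV : ∀ n, Measurable (fun ω => ∑ j, s j * V n ω j) := fun n =>
      Finset.measurable_sum _ fun j _ => ((measurable_pi_apply j).comp (hV n)).const_mul _
    have hmW : Measurable (fun ω => ∑ j, s j * W ω j) :=
      Finset.measurable_sum _ fun j _ => ((measurable_pi_apply j).comp hW).const_mul _
    convert h2 using 2
    · rw [charFun_apply, charFun_apply, integral_map, integral_map]
      · congr 1
        ext ω
        simp [PiLp.inner_apply, mul_comm]
      · exact (hmV _).aemeasurable
      · fun_prop
      · exact (hcont.measurable.comp (hV _)).aemeasurable
      · fun_prop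
    · rw [charFun_apply, charFun_apply, integral_map, integral_map]
      · congr 1
        ext ω
        simp [PiLp.inner_apply, mul_comm]
      · exact hmW.aemeasurable
      · fun_prop
      · exact (hcont.measurable.comp hW).aemeasurable
      · fun_prop
  exact key.continuous_comp (g := fun v : EuclideanSpace ℝ (Fin J) => (WithLp.ofLp v : Fin J → ℝ))
    (PiLp.continuous_ofLp 2 _)

/-- Multivariate central limit theorem. -/
theorem multi_clt {Ω : Type} [MeasurableSpace Ω] (μ : Measure Ω) [IsProbabilityMeasure μ]
    {J : ℕ} (ν : Measure (Fin J → ℝ)) [IsProbabilityMeasure ν]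
    (hν : IsCenteredGaussian (1 : Matrix (Fin J) (Fin J) ℝ) ν)
    (U : ℕ → Ω → Fin J → ℝ) (hU : ∀ n, Measurable (U n)) (C : ℝ) (hC : ∀ n ω j, |U n ω j| ≤ C)
    (hind : iIndepFun U μ) (hid : ∀ i, IdentDistrib (U i) (U 0) μ μ)
    (hmean : ∀ j, ∫ ω, U 0 ω j ∂μ = 0)
    (A : Matrix (Fin J) (Fin J) ℝ)
    (hA : ∀ i j, (A * A.transpose) i j = ∫ ω, U 0 ω i * U 0 ω j ∂μ) :
    MeasureTheory.TendstoInDistribution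
      (fun (n : ℕ) ω => fun j => (Real.sqrt n)⁻¹ * ∑ i ∈ Finset.range n, U i ω j) atTop
      (fun x => A.mulVec x) (fun _ => μ) ν := by
  have hUj : ∀ n j, Measurable (fun ω => U n ω j) := fun n j => (measurable_pi_apply j).comp (hU n)
  refine cramer_wold μ ν _ _ ?_ ?_ ?_
  · intro n
    exact measurable_pi_lambda _ fun j =>
      (Finset.measurable_sum _ fun i _ => hUj i j).const_mul _
  · exact (Continuous.matrix_mulVec continuous_const continuous_id).measurable
  intro a
  have hga : Measurable (fun v : Fin J → ℝ => ∑ j, a j * v j) :=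
    Finset.measurable_sum _ fun j _ => (measurable_pi_apply j).const_mul _
  set T : ℕ → Ω → ℝ := fun n ω => ∑ j, a j * U n ω j with hT
  have hTm : ∀ n, Measurable (T n) := fun n => hga.comp (hU n)
  have hTb : ∀ n ω, |T n ω| ≤ ∑ j, |a j| * C := fun n ω => by
    refine (Finset.abs_sum_le_sum_abs _ _).trans (Finset.sum_le_sum fun j _ => ?_)
    rw [abs_mul]
    exact mul_le_mul_of_nonneg_left (hC n ω j) (abs_nonneg _)
  have hInt : ∀ j, Integrable (fun ω => U 0 ω j) μ := fun j =>
    Integrable.of_bound (hUj 0 j).aestronglyMeasurable C (ae_of_all _ fun ω => hC 0 ω j)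
  have hInt2 : ∀ i j, Integrable (fun ω => U 0 ω i * U 0 ω j) μ := fun i j =>
    Integrable.of_bound ((hUj 0 i).mul (hUj 0 j)).aestronglyMeasurable (C * C)
      (ae_of_all _ fun ω => by
        rw [Real.norm_eq_abs, abs_mul]
        exact mul_le_mul (hC 0 ω i) (hC 0 ω j) (abs_nonneg _) ((abs_nonneg _).trans (hC 0 ω i)))
  have hT0 : ∫ ω, T 0 ω ∂μ = 0 := by
    rw [hT]
    simp only
    rw [integral_finsetSum _ fun j _ => (hInt j).const_mul _]
    simp [integral_const_mul, hmean]
  have hMem : MemLp (T 0) 2 μ :=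
    MemLp.of_bound (hTm 0).aestronglyMeasurable _ (ae_of_all _ fun ω => hTb 0 ω)
  have hVar : Var[T 0; μ] = ∑ i, ∑ j, a i * (A * A.transpose) i j * a j := by
    rw [variance_of_integral_eq_zero (hTm 0).aemeasurable hT0]
    have : ∀ ω, T 0 ω ^ 2 = ∑ i, ∑ j, a i * a j * (U 0 ω i * U 0 ω j) := fun ω => by
      rw [hT, sq]
      simp only
      rw [Finset.sum_mul_sum]
      exact Finset.sum_congr rfl fun i _ => Finset.sum_congr rfl fun j _ => by ring
    simp only [Pi.pow_apply, this]
    rw [integral_finsetSum _ fun i _ => integrable_finsetSum _ fun j _ => (hInt2 i j).const_mul _]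
    refine Finset.sum_congr rfl fun i _ => ?_
    rw [integral_finsetSum _ fun j _ => (hInt2 i j).const_mul _]
    refine Finset.sum_congr rfl fun j _ => ?_
    rw [integral_const_mul, hA]
    ring
  set b : Fin J → ℝ := A.transpose.mulVec a with hb
  have hbY : ∀ x : Fin J → ℝ, ∑ j, a j * (A.mulVec x) j = ∑ j, b j * x j := fun x => by
    change a ⬝ᵥ A.mulVec x = b ⬝ᵥ x
    rw [Matrix.dotProduct_mulVec, hb, Matrix.mulVec_transpose]
  have hvar2 : ∑ i, ∑ j, a i * (A * A.transpose) i j * a j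
      = ∑ i, ∑ j, b i * (1 : Matrix (Fin J) (Fin J) ℝ) i j * b j := by
    have e1 : ∑ i, ∑ j, a i * (A * A.transpose) i j * a j
        = a ⬝ᵥ (A * A.transpose).mulVec a := by
      simp [dotProduct, Matrix.mulVec, Finset.mul_sum, mul_assoc]
    have e2 : ∑ i, ∑ j, b i * (1 : Matrix (Fin J) (Fin J) ℝ) i j * b j
        = b ⬝ᵥ b := by
      simp [dotProduct, Matrix.one_apply]
    rw [e1, e2, ← Matrix.mulVec_mulVec, Matrix.dotProduct_mulVec, hb, Matrix.mulVec_transpose]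
  have hlaw : HasLaw (fun x : Fin J → ℝ => ∑ j, b j * x j)
      (gaussianReal 0 Var[T 0; μ].toNNReal) ν :=
    ⟨(Finset.measurable_sum _ fun j _ => (measurable_pi_apply j).const_mul _).aemeasurable, by
      rw [hν.2 b, hVar, hvar2]⟩
  have hclt := ProbabilityTheory.tendstoInDistribution_inv_sqrt_mul_sum_sub (X := T) hlaw hMem
    (hind.comp (fun _ => fun v : Fin J → ℝ => ∑ j, a j * v j) fun _ => hga)
    (fun i => (hid i).comp hga)
  refine hclt.congr (fun n => ae_of_all _ fun ω => ?_) (ae_of_all _ fun x => (hbY x).symm)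
  rw [hT0, mul_zero, sub_zero]
  simp only [hT]
  rw [Finset.sum_comm]
  simp only [Finset.mul_sum]
  exact Finset.sum_congr rfl fun j _ => Finset.sum_congr rfl fun i _ => by ring

open scoped MatrixOrder Matrix.Norms.L2Operator in
theorem matrix_sqrt_cts_aux {J : ℕ} :
    ContinuousOn (CFC.sqrt : Matrix (Fin J) (Fin J) ℝ → Matrix (Fin J) (Fin J) ℝ)
      {M | 0 ≤ M} :=
  CFC.continuousOn_sqrt (A := Matrix (Fin J) (Fin J) ℝ)

open scoped MatrixOrder in
theorem matrix_sqrt_cts {J : ℕ} :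
    ContinuousOn (CFC.sqrt : Matrix (Fin J) (Fin J) ℝ → Matrix (Fin J) (Fin J) ℝ)
      {M | M.PosSemidef} := by
  have h := matrix_sqrt_cts_aux (J := J)
  have hs : {M : Matrix (Fin J) (Fin J) ℝ | M.PosSemidef} = {M | 0 ≤ M} := by
    ext M
    exact Matrix.nonneg_iff_posSemidef.symm
  rw [hs]
  refine h.congr fun M hM => ?_
  refine CFC.sqrt_unique ?_ (CFC.sqrt_nonneg M)
  exact CFC.sqrt_mul_sqrt_self M hM

theorem tim_of_entry {Ω : Type} [MeasurableSpace Ω] (μ : Measure Ω) {J : ℕ}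
    {F : Type} [PseudoEMetricSpace F] (f : (Fin J → Fin J → ℝ) → F) (S : Set (Fin J → Fin J → ℝ))
    (c : Fin J → Fin J → ℝ) (hf : ContinuousWithinAt f S c)
    (M : ℕ → Ω → Fin J → Fin J → ℝ) (hMS : ∀ n ω, M n ω ∈ S)
    (hM : ∀ i j, TendstoInMeasure μ (fun n ω => M n ω i j) atTop (fun _ => c i j)) :
    TendstoInMeasure μ (fun n ω => f (M n ω)) atTop (fun _ => f c) := by
  intro ε hε
  have h1 : ∀ᶠ m in 𝓝[S] c, edist (f m) (f c) < ε := by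
    have := hf (Metric.eball_mem_nhds (f c) hε)
    exact this
  rw [Metric.nhdsWithin_basis_ball.eventually_iff] at h1
  obtain ⟨η, hη, h2⟩ := h1
  have hle : ∀ n, μ {x | ε ≤ edist (f (M n x)) (f c)} ≤
      ∑ i, ∑ j, μ {x | ENNReal.ofReal η ≤ edist (M n x i j) (c i j)} := by
    intro n
    have hsub : {x | ε ≤ edist (f (M n x)) (f c)} ⊆
        ⋃ i, ⋃ j, {x | ENNReal.ofReal η ≤ edist (M n x i j) (c i j)} := by
      intro x hx
      by_contra hcon
      simp only [Set.mem_iUnion, Set.mem_setOf_eq, not_exists, not_le] at hcon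
      refine absurd (h2 ⟨?_, hMS n x⟩) (not_lt.2 hx)
      rw [Metric.mem_ball, dist_pi_lt_iff hη]
      intro i
      rw [dist_pi_lt_iff hη]
      intro j
      have := hcon i j
      rwa [edist_dist, ENNReal.ofReal_lt_ofReal_iff hη] at this
    refine (measure_mono hsub).trans ((measure_iUnion_fintype_le _ _).trans ?_)
    exact Finset.sum_le_sum fun i _ => measure_iUnion_fintype_le _ _
  have hlim : Tendsto (fun n => ∑ i, ∑ j, μ {x | ENNReal.ofReal η ≤ edist (M n x i j) (c i j)})
      atTop (𝓝 0) := by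
    have : (0 : ENNReal) = ∑ _i : Fin J, ∑ _j : Fin J, (0 : ENNReal) := by simp
    rw [this]
    exact tendsto_finsetSum _ fun i _ => tendsto_finsetSum _ fun j _ =>
      hM i j _ (ENNReal.ofReal_pos.2 hη)
  exact tendsto_of_tendsto_of_tendsto_of_le_of_le tendsto_const_nhds hlim (fun _ => zero_le) hle

open scoped MatrixOrder in
theorem invSqrt_props {J : ℕ} (S : Matrix (Fin J) (Fin J) ℝ) (hS : S.PosDef) :
    ∃ A : Matrix (Fin J) (Fin J) ℝ, A * A.transpose = S ∧ invSqrtMat S * A = 1 := by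
  refine ⟨CFC.sqrt S, ?_, ?_⟩
  · have h0 : (CFC.sqrt S).PosSemidef := Matrix.nonneg_iff_posSemidef.1 (CFC.sqrt_nonneg S)
    have h1 : (CFC.sqrt S).transpose = CFC.sqrt S := by
      have := h0.1
      rwa [Matrix.IsHermitian, Matrix.conjTranspose_eq_transpose_of_trivial] at this
    rw [h1]
    exact CFC.sqrt_mul_sqrt_self S (Matrix.nonneg_iff_posSemidef.2 hS.posSemidef)
  · have hu : IsUnit (CFC.sqrt S).det := by
      have h2 : CFC.sqrt S * CFC.sqrt S = S :=
        CFC.sqrt_mul_sqrt_self S (Matrix.nonneg_iff_posSemidef.2 hS.posSemidef)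
      have h3 : (CFC.sqrt S).det * (CFC.sqrt S).det = S.det := by rw [← Matrix.det_mul, h2]
      have h4 := hS.det_pos
      refine isUnit_iff_ne_zero.2 fun h => ?_
      rw [h, mul_zero] at h3
      exact h4.ne h3
    rw [invSqrtMat, dif_pos hS.posSemidef]
    exact Matrix.nonsing_inv_mul _ hu

open scoped MatrixOrder in
theorem invSqrt_cts {J : ℕ} : ContinuousOn (invSqrtMat (J := J)) {M | M.PosDef} := by
  have h1 : ContinuousOn (fun M : Matrix (Fin J) (Fin J) ℝ => (CFC.sqrt M)⁻¹) {M | M.PosDef} := by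
    have hs : ContinuousOn (CFC.sqrt : Matrix (Fin J) (Fin J) ℝ → Matrix (Fin J) (Fin J) ℝ)
      {M | M.PosDef} := matrix_sqrt_cts.mono fun M hM => hM.posSemidef
    simp only [Matrix.inv_def, Ring.inverse_eq_inv']
    have hd : Continuous (fun M : Matrix (Fin J) (Fin J) ℝ => M.det) :=
      Continuous.matrix_det continuous_id
    have ha : Continuous (fun M : Matrix (Fin J) (Fin J) ℝ => M.adjugate) :=
      Continuous.matrix_adjugate continuous_id
    refine ContinuousOn.smul (ContinuousOn.inv₀ (hd.comp_continuousOn hs) ?_)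
      (ha.comp_continuousOn hs)
    intro M hM
    have h2 : CFC.sqrt M * CFC.sqrt M = M :=
      CFC.sqrt_mul_sqrt_self M (Matrix.nonneg_iff_posSemidef.2 hM.posSemidef)
    have h3 : (CFC.sqrt M).det * (CFC.sqrt M).det = M.det := by rw [← Matrix.det_mul, h2]
    intro h
    have h' : (CFC.sqrt M).det = 0 := h
    rw [h', mul_zero] at h3
    exact hM.det_pos.ne h3
  refine h1.congr fun M hM => ?_
  rw [invSqrtMat, dif_pos hM.posSemidef]

theorem slutsky_final {Ω : Type} [MeasurableSpace Ω] (μ : Measure Ω) [IsProbabilityMeasure μ]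
    {J : ℕ} (ν : Measure (Fin J → ℝ)) [IsProbabilityMeasure ν]
    (V T : ℕ → Ω → Fin J → ℝ) (hT : ∀ n, Measurable (T n))
    (A S : Matrix (Fin J) (Fin J) ℝ) (hS : S.PosDef) (hA : invSqrtMat S * A = 1)
    (hV : MeasureTheory.TendstoInDistribution V atTop (fun x => A.mulVec x) (fun _ => μ) ν)
    (hVT : ∀ j, TendstoInMeasure μ (fun n ω => T n ω j - V n ω j) atTop (fun _ => (0 : ℝ)))
    (M : ℕ → Ω → Matrix (Fin J) (Fin J) ℝ) (hMpd : ∀ n ω, (M n ω).PosDef)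
    (hMm : ∀ n i j, Measurable fun ω => M n ω i j)
    (hM : ∀ i j, TendstoInMeasure μ (fun n ω => M n ω i j) atTop (fun _ => S i j)) :
    CIPaper.TendstoInDistribution μ (fun n ω => (invSqrtMat (M n ω)).mulVec (T n ω)) ν := by
  have hTV : TendstoInMeasure μ (T - V) atTop 0 := by
    -- one column suffices
    intro ε hε
    have hle : ∀ n, μ {x | ε ≤ edist ((T - V) n x) ((0 : Ω → Fin J → ℝ) x)} ≤
        ∑ j, μ {x | min ε 1 / 2 ≤ edist (T n x j - V n x j) 0} := by
      intro n
      have hsub : {x | ε ≤ edist ((T - V) n x) ((0 : Ω → Fin J → ℝ) x)} ⊆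
          ⋃ j, {x | min ε 1 / 2 ≤ edist (T n x j - V n x j) 0} := by
        intro x hx
        by_contra hcon
        simp only [Set.mem_iUnion, Set.mem_setOf_eq, not_exists, not_le] at hcon
        have h1 : edist ((T - V) n x) ((0 : Ω → Fin J → ℝ) x) ≤ min ε 1 / 2 :=
          edist_pi_le_iff.2 fun j => (hcon j).le
        have h2 : min ε 1 / 2 < min ε 1 :=
          ENNReal.half_lt_self (by simp [hε.ne']) (by simp)
        exact absurd (hx.trans h1) (not_le.2 (h2.trans_le (min_le_left _ _)))
      exact (measure_mono hsub).trans (measure_iUnion_fintype_le _ _)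
    have hlim : Tendsto (fun n => ∑ j, μ {x | min ε 1 / 2 ≤ edist (T n x j - V n x j) 0})
        atTop (𝓝 0) := by
      have : (0 : ENNReal) = ∑ _j : Fin J, (0 : ENNReal) := by simp
      rw [this]
      exact tendsto_finsetSum _ fun j _ => hVT j _ (ENNReal.half_pos (by simp [hε.ne']))
    exact tendsto_of_tendsto_of_tendsto_of_le_of_le tendsto_const_nhds hlim
      (fun _ => zero_le) hle
  have hTd := tendstoInDistribution_of_tendstoInMeasure_sub T _ hV hTV
    fun n => (hT n).aemeasurable
  let f : (Fin J → Fin J → ℝ) → (Fin J → Fin J → ℝ) := fun m => invSqrtMat (Matrix.of m)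
  have hfc : ContinuousOn f {m | (Matrix.of m).PosDef} := invSqrt_cts
  have hI := tim_of_entry μ f {m | (Matrix.of m).PosDef} S (hfc S hS) M hMpd hM
  have hMmeas : ∀ n, Measurable fun ω => f (M n ω) := by
    intro n
    have h1 : Measurable (fun ω => (⟨M n ω, hMpd n ω⟩ : {m | (Matrix.of m).PosDef})) := by
      refine Measurable.subtype_mk ?_
      exact measurable_pi_lambda _ fun i => measurable_pi_lambda _ fun j => hMm n i j
    exact (continuousOn_iff_continuous_restrict.1 hfc).measurable.comp h1
  have hfin := hTd.continuous_comp_prodMk_of_tendstoInMeasure_const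
    (g := fun q : (Fin J → ℝ) × (Fin J → Fin J → ℝ) => (Matrix.of q.2).mulVec q.1)
    (Continuous.matrix_mulVec continuous_snd continuous_fst) hI fun n => (hMmeas n).aemeasurable
  intro φ
  have h3 := ProbabilityMeasure.tendsto_iff_forall_integral_tendsto.1 hfin.tendsto φ
  convert h3 using 2
  · refine (integral_map (hfin.forall_aemeasurable _) ?_).symm
    exact φ.continuous.aestronglyMeasurable
  · refine Eq.trans ?_ (integral_map hfin.aemeasurable_limit ?_).symm
    · congr 1
      ext x
      congr 1
      change x = (invSqrtMat S).mulVec (A.mulVec x)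
      rw [Matrix.mulVec_mulVec, hA, Matrix.one_mulVec]
    · exact φ.continuous.aestronglyMeasurable

theorem cov_det_bound (n : ℕ) (hn : 1 ≤ n) (C η : ℝ) (hη : 0 < η) (Da Db Ua Ub : ℕ → ℝ)
    (hUa : ∀ i, |Ua i| ≤ C) (hUb : ∀ i, |Ub i| ≤ C)
    (ha : ∑ i ∈ Finset.range n, Da i ^ 2 ≤ η ^ 2 * n)
    (hb : ∑ i ∈ Finset.range n, Db i ^ 2 ≤ η ^ 2 * n) :
    |(n : ℝ)⁻¹ * ∑ i ∈ Finset.range n, ((Ua i + Da i) * (Ub i + Db i) - Ua i * Ub i)|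
      ≤ η ^ 2 + 2 * C * η := by
  have hn0 : (0 : ℝ) < n := by exact_mod_cast hn
  have hC : 0 ≤ C := (abs_nonneg _).trans (hUa 0)
  have hD : ∀ d : ℝ, |d| ≤ (d ^ 2 / η + η) / 2 := fun d => by
    have h1 : (d ^ 2 / η + η) / 2 = (d ^ 2 + η ^ 2) / (2 * η) := by field_simp
    rw [h1, le_div_iff₀ (by positivity)]
    nlinarith [sq_nonneg (|d| - η), sq_abs d]
  have hp : ∀ i, |(Ua i + Da i) * (Ub i + Db i) - Ua i * Ub i| ≤
      (1 / 2 + C / (2 * η)) * Da i ^ 2 + (1 / 2 + C / (2 * η)) * Db i ^ 2 + C * η := fun i => by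
    have e : (Ua i + Da i) * (Ub i + Db i) - Ua i * Ub i
        = Da i * Db i + Da i * Ub i + Ua i * Db i := by ring
    rw [e]
    have h1 : |Da i * Db i| ≤ (Da i ^ 2 + Db i ^ 2) / 2 := by
      rw [abs_mul]
      nlinarith [sq_nonneg (|Da i| - |Db i|), sq_abs (Da i), sq_abs (Db i)]
    have h2 : |Da i * Ub i| ≤ (Da i ^ 2 / η + η) / 2 * C := by
      rw [abs_mul]
      exact mul_le_mul (hD _) (hUb i) (abs_nonneg _) ((abs_nonneg _).trans (hD _))
    have h3 : |Ua i * Db i| ≤ C * ((Db i ^ 2 / η + η) / 2) := by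
      rw [abs_mul]
      exact mul_le_mul (hUa i) (hD _) (abs_nonneg _) hC
    calc |Da i * Db i + Da i * Ub i + Ua i * Db i|
        ≤ |Da i * Db i| + |Da i * Ub i| + |Ua i * Db i| := abs_add_three _ _ _
      _ ≤ (Da i ^ 2 + Db i ^ 2) / 2 + (Da i ^ 2 / η + η) / 2 * C
          + C * ((Db i ^ 2 / η + η) / 2) := by gcongr
      _ = _ := by field_simp; ring
  have hs : |∑ i ∈ Finset.range n, ((Ua i + Da i) * (Ub i + Db i) - Ua i * Ub i)|
      ≤ n * (η ^ 2 + 2 * C * η) := by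
    refine (Finset.abs_sum_le_sum_abs _ _).trans ((Finset.sum_le_sum fun i _ => hp i).trans ?_)
    rw [Finset.sum_add_distrib, Finset.sum_add_distrib, ← Finset.mul_sum, ← Finset.mul_sum]
    simp only [Finset.sum_const, Finset.card_range, nsmul_eq_mul]
    have hK : 0 ≤ 1 / 2 + C / (2 * η) := by positivity
    calc _ ≤ (1 / 2 + C / (2 * η)) * (η ^ 2 * n) + (1 / 2 + C / (2 * η)) * (η ^ 2 * n)
          + n * (C * η) := by gcongr
      _ = _ := by field_simp; ring
  rw [abs_mul, abs_of_pos (inv_pos.2 hn0), inv_mul_le_iff₀ hn0]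
  exact hs

theorem tim_add {Ω : Type} [MeasurableSpace Ω] (μ : Measure Ω) (f g : ℕ → Ω → ℝ) (c : ℝ)
    (hf : TendstoInMeasure μ f atTop (fun _ => c))
    (hg : TendstoInMeasure μ g atTop (fun _ => (0 : ℝ))) :
    TendstoInMeasure μ (fun n ω => f n ω + g n ω) atTop (fun _ => c) := by
  rw [tendstoInMeasure_iff_norm] at hf hg ⊢
  intro ε hε
  have h := (hf (ε / 2) (by positivity)).add (hg (ε / 2) (by positivity))
  rw [add_zero] at h
  refine tendsto_of_tendsto_of_tendsto_of_le_of_le tendsto_const_nhds h (fun _ => zero_le)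
    fun n => ?_
  refine (measure_mono ?_).trans (measure_union_le _ _)
  intro ω hω
  by_contra hcon
  simp only [Set.mem_union, Set.mem_ofPred_eq, not_or, not_le] at hcon hω
  have h1 : f n ω + g n ω - c = (f n ω - c) + (g n ω - 0) := by ring
  have := norm_add_le (f n ω - c) (g n ω - 0)
  rw [← h1] at this
  linarith [hcon.1, hcon.2]

/-- The abstract limit theorem behind Proposition 4. -/
theorem abstract_limit {Ω : Type} [MeasurableSpace Ω] (μ : Measure Ω) [IsProbabilityMeasure μ]
    {J : ℕ} (ν : Measure (Fin J → ℝ)) (hν : IsCenteredGaussian (1 : Matrix (Fin J) (Fin J) ℝ) ν)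
    (U : ℕ → Ω → Fin J → ℝ) (hU : ∀ n, Measurable (U n)) (C : ℝ) (hC : ∀ n ω j, |U n ω j| ≤ C)
    (hind : iIndepFun U μ) (hid : ∀ i, IdentDistrib (U i) (U 0) μ μ)
    (hmean : ∀ j, ∫ ω, U 0 ω j ∂μ = 0)
    (S : Matrix (Fin J) (Fin J) ℝ) (hS : ∀ i j, S i j = ∫ ω, U 0 ω i * U 0 ω j ∂μ)
    (hSu : IsUnit S)
    (Ut : ℕ → ℕ → Ω → Fin J → ℝ) (hUt : ∀ n i j, Measurable fun ω => Ut n i ω j)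
    (h1 : ∀ j (c : ℝ), 0 < c → Tendsto (fun n : ℕ => μ {ω | c * n ≤
      (∑ i ∈ Finset.range n, (Ut n i ω j - U i ω j)) ^ 2}) atTop (𝓝 0))
    (h2 : ∀ j (c : ℝ), 0 < c → Tendsto (fun n : ℕ => μ {ω | c * n ≤
      ∑ i ∈ Finset.range n, (Ut n i ω j - U i ω j) ^ 2}) atTop (𝓝 0))
    (δ : ℕ → ℝ) (hδpos : ∀ n, 0 < δ n) (hδ : Tendsto δ atTop (𝓝 0)) :
    CIPaper.TendstoInDistribution μ
      (fun n ω => Real.sqrt n • (invSqrtMat ((Matrix.of fun j j' => (n : ℝ)⁻¹ *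
        ∑ i ∈ Finset.range n, Ut n i ω j * Ut n i ω j') +
          δ n • (1 : Matrix (Fin J) (Fin J) ℝ))).mulVec
        (fun j => (n : ℝ)⁻¹ * ∑ i ∈ Finset.range n, Ut n i ω j)) ν := by
  haveI := hν.1
  have hUj : ∀ n j, Measurable (fun ω => U n ω j) := fun n j => (measurable_pi_apply j).comp (hU n)
  have hC0 : ∀ _j : Fin J, 0 ≤ C := fun j => by
    obtain ⟨ω⟩ : Nonempty Ω := nonempty_of_isProbabilityMeasure μ
    exact (abs_nonneg _).trans (hC 0 ω j)
  have hInt2 : ∀ i j, Integrable (fun ω => U 0 ω i * U 0 ω j) μ := fun i j =>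
    Integrable.of_bound ((hUj 0 i).mul (hUj 0 j)).aestronglyMeasurable (C * C)
      (ae_of_all _ fun ω => by
        rw [Real.norm_eq_abs, abs_mul]
        exact mul_le_mul (hC 0 ω i) (hC 0 ω j) (abs_nonneg _) ((abs_nonneg _).trans (hC 0 ω i)))
  have hSpsd : S.PosSemidef := by
    refine Matrix.PosSemidef.of_dotProduct_mulVec_nonneg ?_ ?_
    · ext i j
      simp only [Matrix.conjTranspose_apply, star_trivial, hS]
      simp only [mul_comm]
    · intro x
      have e : star x ⬝ᵥ S.mulVec x = ∫ ω, (∑ i, x i * U 0 ω i) ^ 2 ∂μ := by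
        have : ∀ ω, (∑ i, x i * U 0 ω i) ^ 2 = ∑ i, ∑ j, (x i * x j) * (U 0 ω i * U 0 ω j) :=
          fun ω => by
            rw [sq, Finset.sum_mul_sum]
            exact Finset.sum_congr rfl fun i _ => Finset.sum_congr rfl fun j _ => by ring
        simp only [this]
        rw [integral_finsetSum _ fun i _ => integrable_finsetSum _ fun j _ =>
          (hInt2 i j).const_mul _]
        simp only [dotProduct, Matrix.mulVec, star_trivial, Finset.mul_sum]
        refine Finset.sum_congr rfl fun i _ => ?_
        rw [integral_finsetSum _ fun j _ => (hInt2 i j).const_mul _]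
        refine Finset.sum_congr rfl fun j _ => ?_
        rw [integral_const_mul, hS]
        ring
      rw [e]
      exact integral_nonneg fun ω => sq_nonneg _
  have hSpd : S.PosDef := hSpsd.posDef_iff_isUnit.2 hSu
  obtain ⟨A, hAA, hA⟩ := invSqrt_props S hSpd
  have hclt := multi_clt μ ν hν U hU C hC hind hid hmean A (fun i j => by rw [hAA, hS])
  have hsq : ∀ n : ℕ, Real.sqrt n * (n : ℝ)⁻¹ = (Real.sqrt n)⁻¹ := fun n => by
    rcases Nat.eq_zero_or_pos n with rfl | hn
    · simp
    · have : (0 : ℝ) < n := by exact_mod_cast hn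
      have h3 := Real.mul_self_sqrt this.le
      have h4 : 0 < Real.sqrt n := Real.sqrt_pos.2 this
      rw [mul_inv_eq_iff_eq_mul₀ this.ne', eq_inv_mul_iff_mul_eq₀ h4.ne']
      exact h3
  let T : ℕ → Ω → Fin J → ℝ := fun n ω j =>
    (Real.sqrt n)⁻¹ * ∑ i ∈ Finset.range n, Ut n i ω j
  have hTm : ∀ n, Measurable (T n) := fun n => measurable_pi_lambda _ fun j =>
    (Finset.measurable_sum _ fun i _ => hUt n i j).const_mul _
  let M : ℕ → Ω → Matrix (Fin J) (Fin J) ℝ := fun n ω => (Matrix.of fun j j' => (n : ℝ)⁻¹ *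
        ∑ i ∈ Finset.range n, Ut n i ω j * Ut n i ω j') +
          δ n • (1 : Matrix (Fin J) (Fin J) ℝ)
  have hfin := slutsky_final μ ν _ T hTm A S hSpd hA hclt ?_ M ?_ ?_ ?_
  · intro φ
    have := hfin φ
    refine this.congr fun n => ?_
    congr 1
    ext ω
    congr 1
    beta_reduce
    rw [← Matrix.mulVec_smul]
    congr 1
    ext j
    simp only [T, Pi.smul_apply, smul_eq_mul]
    rw [← mul_assoc, hsq]
  · intro j
    rw [tendstoInMeasure_iff_norm]
    intro ε hε
    refine tendsto_of_tendsto_of_tendsto_of_le_of_le' tendsto_const_nhds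
      (h1 j (ε ^ 2) (by positivity)) (Eventually.of_forall fun _ => zero_le) ?_
    filter_upwards [eventually_ge_atTop 1] with n hn
    refine measure_mono fun ω hω => ?_
    have hn0 : (0 : ℝ) < n := by exact_mod_cast hn
    have h4 : 0 < Real.sqrt n := Real.sqrt_pos.2 hn0
    have e : T n ω j - (Real.sqrt n)⁻¹ * ∑ i ∈ Finset.range n, U i ω j - 0
        = (Real.sqrt n)⁻¹ * ∑ i ∈ Finset.range n, (Ut n i ω j - U i ω j) := by
      simp only [T, Finset.sum_sub_distrib]
      ring
    simp only [Set.mem_ofPred_eq] at hω ⊢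
    rw [e, norm_mul, Real.norm_eq_abs, Real.norm_eq_abs, abs_of_pos (inv_pos.2 h4),
      le_inv_mul_iff₀ h4] at hω
    have h5 : (Real.sqrt n * ε) ^ 2 ≤ |∑ i ∈ Finset.range n, (Ut n i ω j - U i ω j)| ^ 2 := by
      gcongr
    rw [sq_abs, mul_pow, Real.sq_sqrt hn0.le] at h5
    linarith
  · intro n ω
    have hp : (Matrix.of fun j j' => (n : ℝ)⁻¹ *
        ∑ i ∈ Finset.range n, Ut n i ω j * Ut n i ω j').PosSemidef := by
      refine Matrix.PosSemidef.of_dotProduct_mulVec_nonneg ?_ ?_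
      · ext i j
        simp only [Matrix.conjTranspose_apply, star_trivial, Matrix.of_apply]
        simp only [mul_comm]
      · intro x
        have e : star x ⬝ᵥ (Matrix.of fun j j' => (n : ℝ)⁻¹ *
            ∑ i ∈ Finset.range n, Ut n i ω j * Ut n i ω j').mulVec x
            = (n : ℝ)⁻¹ * ∑ i ∈ Finset.range n, (∑ j, x j * Ut n i ω j) ^ 2 := by
          simp only [dotProduct, Matrix.mulVec, star_trivial, Matrix.of_apply, sq,
            Finset.sum_mul_sum]
          rw [Finset.sum_comm, Finset.mul_sum]
          simp only [Finset.mul_sum, Finset.sum_mul]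
          rw [Finset.sum_comm]
          refine Finset.sum_congr rfl fun i _ => ?_
          rw [Finset.sum_comm]
          refine Finset.sum_congr rfl fun j _ => ?_
          exact Finset.sum_congr rfl fun l _ => by ring
        rw [e]
        exact mul_nonneg (by positivity) (Finset.sum_nonneg fun i _ => sq_nonneg _)
    exact Matrix.PosDef.posSemidef_add hp (Matrix.PosDef.one.smul (hδpos n))
  · intro n i j
    simp only [M, Matrix.add_apply, Matrix.of_apply]
    exact ((Finset.measurable_sum _ fun l _ => (hUt n l i).mul (hUt n l j)).const_mul _).add_const _
  · intro a b
    have hL : TendstoInMeasure μ (fun (n : ℕ) ω =>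
        (∑ i ∈ Finset.range n, U i ω a * U i ω b) / n + (δ n • (1 : Matrix (Fin J) (Fin J) ℝ)) a b)
        atTop (fun _ => S a b) := by
      refine tendstoInMeasure_of_tendsto_ae (fun n => ?_) ?_
      · exact (((Finset.measurable_sum _ fun l _ =>
          (hUj l a).mul (hUj l b)).div_const _).add_const _).aestronglyMeasurable
      · have hgm : Measurable (fun v : Fin J → ℝ => v a * v b) :=
          (measurable_pi_apply a).mul (measurable_pi_apply b)
        have hl := strong_law_ae_real (fun i ω => U i ω a * U i ω b) (hInt2 a b)
          (fun i j hij => (hind.indepFun hij).comp hgm hgm) (fun i => (hid i).comp hgm)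
        filter_upwards [hl] with ω hω
        have h3 : Tendsto (fun n => (δ n • (1 : Matrix (Fin J) (Fin J) ℝ)) a b) atTop (𝓝 0) := by
          simp only [Matrix.smul_apply, smul_eq_mul]
          simpa using hδ.mul_const ((1 : Matrix (Fin J) (Fin J) ℝ) a b)
        have := hω.add h3
        rw [add_zero, ← hS] at this
        exact this
    have hR : TendstoInMeasure μ (fun (n : ℕ) ω => (n : ℝ)⁻¹ * ∑ i ∈ Finset.range n,
        (Ut n i ω a * Ut n i ω b - U i ω a * U i ω b)) atTop (fun _ => (0 : ℝ)) := by
      rw [tendstoInMeasure_iff_norm]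
      intro ε hε
      have hCa := hC0 a
      obtain ⟨η, hη, hηε⟩ : ∃ η : ℝ, 0 < η ∧ η ^ 2 + 2 * C * η < ε := by
        refine ⟨min 1 (ε / (2 * (1 + 2 * C))), by positivity, ?_⟩
        set η := min 1 (ε / (2 * (1 + 2 * C)))
        have hp : 0 < η := by positivity
        have h3 : η ≤ 1 := min_le_left _ _
        have h4 : η ≤ ε / (2 * (1 + 2 * C)) := min_le_right _ _
        rw [le_div_iff₀ (by positivity)] at h4
        nlinarith
      have h3 := (h2 a (η ^ 2) (by positivity)).add (h2 b (η ^ 2) (by positivity))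
      rw [add_zero] at h3
      refine tendsto_of_tendsto_of_tendsto_of_le_of_le' tendsto_const_nhds h3
        (Eventually.of_forall fun _ => zero_le) ?_
      filter_upwards [eventually_ge_atTop 1] with n hn
      refine (measure_mono ?_).trans (measure_union_le _ _)
      intro ω hω
      by_contra hcon
      simp only [Set.mem_union, Set.mem_ofPred_eq, not_or, not_le] at hcon hω
      have h6 := cov_det_bound n hn C η hη (fun i => Ut n i ω a - U i ω a)
        (fun i => Ut n i ω b - U i ω b) (fun i => U i ω a) (fun i => U i ω b)
        (fun i => hC i ω a) (fun i => hC i ω b) hcon.1.le hcon.2.le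
      simp only [add_sub_cancel] at h6
      rw [sub_zero, Real.norm_eq_abs] at hω
      linarith
    refine (tim_add μ _ _ _ hL hR).congr_left fun n => ae_of_all _ fun ω => ?_
    simp only [M, Matrix.add_apply, Matrix.of_apply, Finset.sum_sub_distrib]
    ring

theorem clamp_exists {Ω D : Type} [MeasurableSpace Ω] [MeasurableSpace D] (μ : Measure Ω)
    [IsProbabilityMeasure μ] (Z : Ω → D) (hZ : Measurable Z) (e : D → ℝ) (he : Measurable e)
    (g : Ω → ℝ) (C : ℝ) (hC : 0 ≤ C) (hg : ∀ ω, |g ω| ≤ C)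
    (hE : (fun ω => e (Z ω)) =ᵐ[μ] μ[g | MeasurableSpace.comap Z inferInstance]) :
    ∃ f : D → ℝ, Measurable f ∧ (∀ z, |f z| ≤ C) ∧ f =ᵐ[μ.map Z] e := by
  have hfm : Measurable fun z => max (-C) (min C (e z)) :=
    measurable_const.max (measurable_const.min he)
  refine ⟨fun z => max (-C) (min C (e z)), hfm, fun z => ?_, ?_⟩
  · rw [abs_le]
    exact ⟨le_max_left _ _, max_le (by linarith) (min_le_left _ _)⟩
  · have h1 : ∀ᵐ ω ∂μ, |(μ[g | MeasurableSpace.comap Z inferInstance]) ω| ≤ C := by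
      have := ae_bdd_condExp_of_ae_bdd (m := MeasurableSpace.comap Z inferInstance) (μ := μ)
        (R := ⟨C, hC⟩) (f := g) (ae_of_all _ fun ω => hg ω)
      exact this
    have hset : MeasurableSet {z | max (-C) (min C (e z)) = e z} := measurableSet_eq_fun hfm he
    refine (ae_map_iff hZ.aemeasurable hset).2 ?_
    filter_upwards [h1, hE] with ω h1 h2
    rw [← h2, abs_le] at h1
    rw [min_eq_right h1.2, max_eq_right h1.1]

theorem measurable_rls {Ω D : Type} [MeasurableSpace Ω] [MeasurableSpace D] (k : D → D → ℝ)
    (hk : Measurable fun q : D × D => k q.1 q.2) (zs : ℕ → Ω → D) (hz : ∀ l, Measurable (zs l))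
    (tg : ℕ → Ω → ℝ) (ht : ∀ l, Measurable (tg l)) (r : ℕ) (lam : ℝ) (i : ℕ) :
    Measurable fun ω => rls k (fun l => zs l ω) (fun l => tg l ω) r lam (zs i ω) := by
  have hk' : ∀ a b : ℕ, Measurable fun ω => k (zs a ω) (zs b ω) := fun a b =>
    hk.comp (g := fun q : D × D => k q.1 q.2) (f := fun ω => (zs a ω, zs b ω))
      ((hz a).prodMk (hz b))
  unfold rls
  refine Finset.measurable_fun_sum _ fun m _ => Measurable.mul ?_ (hk' _ _)
  simp only [Matrix.mulVec, dotProduct]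
  refine Finset.measurable_fun_sum _ fun l _ => Measurable.mul ?_ (ht _)
  refine measurable_matrix_inv (fun ω => (Matrix.of fun i l : Fin r => k (zs i ω) (zs l ω)) +
        ((r : ℝ) * lam) • (1 : Matrix (Fin r) (Fin r) ℝ)) (fun a b => ?_) _ _
  simp only [Matrix.add_apply, Matrix.of_apply]
  exact (hk' _ _).add measurable_const

theorem iIndep_coord {Ω V : Type} [MeasurableSpace Ω] [MeasurableSpace V] (μ : Measure Ω)
    [IsProbabilityMeasure μ] (D : ℕ → Ω → V) (hD : ∀ i, Measurable (D i)) (h : iIndepFun D μ) :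
    iIndepFun (fun i (y : ℕ → V) => y i) (μ.map fun ω l => D l ω) := by
  have hm : Measurable fun ω l => D l ω := measurable_pi_lambda _ hD
  haveI : IsProbabilityMeasure (μ.map fun ω l => D l ω) :=
    Measure.isProbabilityMeasure_map hm.aemeasurable
  rw [iIndepFun_iff_map_fun_eq_infinitePi_map (fun i => measurable_pi_apply i)]
  rw [iIndepFun_iff_map_fun_eq_infinitePi_map hD] at h
  have e : (fun i => (μ.map fun ω l => D l ω).map (fun x : ℕ → V => x i)) = fun i => μ.map (D i) := by
    funext i
    rw [Measure.map_map (measurable_pi_apply i) hm]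
    rfl
  rw [e, ← h]
  exact Measure.map_id


/-- Proposition 4, part 1: the normalized statistic is asymptotically
standard Gaussian under `H₀`. -/
theorem statement_13
    (dx dy dz : ℕ) (hdx : 1 ≤ dx) (hdy : 1 ≤ dy) (hdz : 1 ≤ dz)
    {Ω : Type} [MeasurableSpace Ω] [StandardBorelSpace Ω] [Nonempty Ω]
    (μ : Measure Ω) [IsProbabilityMeasure μ]
    (X : Ω → Fin dx → ℝ) (Z : Ω → Fin dz → ℝ) (Y : Ω → Fin dy → ℝ)
    (hX : Measurable X) (hZ : Measurable Z) (hY : Measurable Y)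
    (p J : ℕ) (hp : 1 ≤ p) (hJ : 1 ≤ J)
    (kX : ((Fin dx → ℝ) × (Fin dz → ℝ)) → ((Fin dx → ℝ) × (Fin dz → ℝ)) → ℝ) (kY : (Fin dy → ℝ) → (Fin dy → ℝ) → ℝ)
    (hk : Assumption1 kX kY)
    (e1 : ((Fin dx → ℝ) × (Fin dz → ℝ)) → (Fin dz → ℝ) → ℝ) (e2 : (Fin dy → ℝ) → (Fin dz → ℝ) → ℝ)
    (he1m : ∀ t1, Measurable (e1 t1)) (he2m : ∀ t2, Measurable (e2 t2))
    (he1 : ∀ t1, (fun ω => e1 t1 (Z ω)) =ᵐ[μ]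
      μ[fun ω' => kX t1 (X ω', Z ω') | MeasurableSpace.comap Z inferInstance])
    (he2 : ∀ t2, (fun ω => e2 t2 (Z ω)) =ᵐ[μ]
      μ[fun ω' => kY t2 (Y ω') | MeasurableSpace.comap Z inferInstance])
    (xS : ℕ → Ω → Fin dx → ℝ) (zS : ℕ → Ω → Fin dz → ℝ) (yS : ℕ → Ω → Fin dy → ℝ)
    (hxS : ∀ i, Measurable (xS i)) (hzS : ∀ i, Measurable (zS i)) (hyS : ∀ i, Measurable (yS i))
    (hiid : iIndepFun (fun i ω => ((xS i ω, zS i ω), yS i ω)) μ)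
    (hlaw : ∀ i, μ.map (fun ω => ((xS i ω, zS i ω), yS i ω)) =
      μ.map fun ω => ((X ω, Z ω), Y ω))
    (kZ1 kZ2 : Fin J → (Fin dz → ℝ) → (Fin dz → ℝ) → ℝ)
    (hkZ1bdd : ∀ j, BoundedKernel (kZ1 j)) (hkZ2bdd : ∀ j, BoundedKernel (kZ2 j))
    (hkZ1cont : ∀ j, Continuous fun q : (Fin dz → ℝ) × (Fin dz → ℝ) => kZ1 j q.1 q.2)
    (hkZ2cont : ∀ j, Continuous fun q : (Fin dz → ℝ) × (Fin dz → ℝ) => kZ2 j q.1 q.2)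
    (hkZ1symm : ∀ j z z', kZ1 j z z' = kZ1 j z' z)
    (hkZ2symm : ∀ j z z', kZ2 j z z' = kZ2 j z' z)
    (hkZ1pd : ∀ j, PosDefKernel (kZ1 j)) (hkZ2pd : ∀ j, PosDefKernel (kZ2 j))
    (L1 L2 : Fin J → (Lp ℝ 2 (μ.map Z) →L[ℝ] Lp ℝ 2 (μ.map Z)))
    (hL1 : ∀ (j : Fin J) (g : Lp ℝ 2 (μ.map Z)),
      (L1 j g : (Fin dz → ℝ) → ℝ) =ᵐ[μ.map Z] fun z => ∫ z', kZ1 j z z' * g z' ∂(μ.map Z))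
    (hL2 : ∀ (j : Fin J) (g : Lp ℝ 2 (μ.map Z)),
      (L2 j g : (Fin dz → ℝ) → ℝ) =ᵐ[μ.map Z] fun z => ∫ z', kZ2 j z z' * g z' ∂(μ.map Z))
    (Q γ : ℝ) (hQ : 0 < Q) (hγ0 : 0 ≤ γ) (hγ1 : γ ≤ 1)
    (hA2 : ∀ j, TraceAssumption (μ.map Z) (L1 j) Q γ ∧ TraceAssumption (μ.map Z) (L2 j) Q γ)
    (β : ℝ) (hβ1 : 1 < β) (hβ2 : β ≤ 2)
    (Lβ1 Lβ2 : Fin J → (Lp ℝ 2 (μ.map Z) →L[ℝ] Lp ℝ 2 (μ.map Z)))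
    (hLβ1 : ∀ j, IsFracPower (L1 j) (β / 2) (Lβ1 j))
    (hLβ2 : ∀ j, IsFracPower (L2 j) (β / 2) (Lβ2 j))
    (he1mem : ∀ t1, MemLp (e1 t1) 2 (μ.map Z)) (he2mem : ∀ t2, MemLp (e2 t2) 2 (μ.map Z))
    (hA3r1 : ∀ (j : Fin J) (t1 : ((Fin dx → ℝ) × (Fin dz → ℝ))), MemLp.toLp (e1 t1) (he1mem t1) ∈ Set.range ⇑(Lβ1 j))
    (hA3r2 : ∀ (j : Fin J) (t2 : Fin dy → ℝ), MemLp.toLp (e2 t2) (he2mem t2) ∈ Set.range ⇑(Lβ2 j))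
    (σ0 L0 : ℝ) (hσ0 : 0 < σ0) (hL0 : 0 < L0)
    (hmom1 : ∀ (t1 : ((Fin dx → ℝ) × (Fin dz → ℝ))) (l : ℕ), 2 ≤ l → ∀ᵐ ω ∂μ,
      (μ[fun ω' => |kX t1 (X ω', Z ω') - e1 t1 (Z ω')| ^ l |
        MeasurableSpace.comap Z inferInstance]) ω ≤ (l.factorial : ℝ) * σ0 ^ 2 * L0 ^ (l - 2) / 2)
    (hmom2 : ∀ (t2 : Fin dy → ℝ) (l : ℕ), 2 ≤ l → ∀ᵐ ω ∂μ,
      (μ[fun ω' => |kY t2 (Y ω') - e2 t2 (Z ω')| ^ l |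
        MeasurableSpace.comap Z inferInstance]) ω ≤ (l.factorial : ℝ) * σ0 ^ 2 * L0 ^ (l - 2) / 2)
    (rn : ℕ → ℕ) (hrn : ∀ n, rn n ≤ n)
    (hro : (fun n : ℕ => (n : ℝ) ^ ((β + γ) / (2 * β))) =o[atTop] fun n => (rn n : ℝ))
    (δ : ℕ → ℝ) (hδpos : ∀ n, 0 < δ n) (hδ : Tendsto δ atTop (𝓝 0))
    (t : Fin J → (((Fin dx → ℝ) × (Fin dz → ℝ)) × (Fin dy → ℝ)))
    (hH0 : CondIndepFun (MeasurableSpace.comap Z inferInstance) hZ.comap_le X Y μ)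
    (hSigmaInv : IsUnit (covMat μ kX kY e1 e2 xS zS yS t)) :
    ∀ ν : Measure (Fin J → ℝ), IsCenteredGaussian (1 : Matrix (Fin J) (Fin J) ℝ) ν →
      CIPaper.TendstoInDistribution μ
        (fun n ω => Real.sqrt n •
          (invSqrtMat (covTilde kX kY kZ1 kZ2 xS zS yS t n (rn n) ((rn n : ℝ) ^ (-(1 / (1 + γ)))) ω + δ n • (1 : Matrix (Fin J) (Fin J) ℝ))).mulVec (STilde kX kY kZ1 kZ2 xS zS yS t n (rn n) ((rn n : ℝ) ^ (-(1 / (1 + γ)))) ω)) ν := by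
  intro ν hν
  haveI : Nonempty (Fin dx) := ⟨⟨0, hdx⟩⟩
  haveI : Nontrivial (Fin dx → ℝ) := inferInstance
  obtain ⟨C, hCX, hCY, hcX, hcY⟩ := kernel_regular kX kY hk
  have hC0 : 0 ≤ C := (abs_nonneg _).trans (hCY 0 0)
  have hf1e : ∀ j : Fin J, ∃ f : (Fin dz → ℝ) → ℝ, Measurable f ∧ (∀ z, |f z| ≤ C) ∧
      f =ᵐ[μ.map Z] e1 (t j).1 := fun j =>
    clamp_exists μ Z hZ (e1 (t j).1) (he1m _) (fun ω' => kX (t j).1 (X ω', Z ω')) C hC0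
      (fun ω => hCX _ _) (he1 _)
  have hf2e : ∀ j : Fin J, ∃ f : (Fin dz → ℝ) → ℝ, Measurable f ∧ (∀ z, |f z| ≤ C) ∧
      f =ᵐ[μ.map Z] e2 (t j).2 := fun j =>
    clamp_exists μ Z hZ (e2 (t j).2) (he2m _) (fun ω' => kY (t j).2 (Y ω')) C hC0
      (fun ω => hCY _ _) (he2 _)
  choose f1 hf1m hf1b hf1a using hf1e
  choose f2 hf2m hf2b hf2a using hf2e
  have hXZY : Measurable fun ω => ((X ω, Z ω), Y ω) := (hX.prodMk hZ).prodMk hY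
  have hDm : ∀ i, Measurable fun ω => ((xS i ω, zS i ω), yS i ω) := fun i =>
    ((hxS i).prodMk (hzS i)).prodMk (hyS i)
  have hWm : Measurable fun ω (i : ℕ) => ((xS i ω, zS i ω), yS i ω) := measurable_pi_lambda _ hDm
  have hkXm : ∀ a, Measurable (kX a) := fun a => (hcX a).measurable
  have hkYm : ∀ a, Measurable (kY a) := fun a => (hcY a).measurable
  have bX : ∀ j, BM (kX (t j).1) := fun j => ⟨hkXm _, C, hCX _⟩
  have bY : ∀ j, BM (kY (t j).2) := fun j => ⟨hkYm _, C, hCY _⟩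
  have bf1 : ∀ j, BM (f1 j) := fun j => ⟨hf1m j, C, hf1b j⟩
  have bf2 : ∀ j, BM (f2 j) := fun j => ⟨hf2m j, C, hf2b j⟩
  have hfe1 : ∀ j, (fun ω => f1 j (Z ω)) =ᵐ[μ]
      μ[fun ω' => kX (t j).1 (X ω', Z ω') | MeasurableSpace.comap Z inferInstance] := fun j =>
    Filter.EventuallyEq.trans (ae_of_ae_map hZ.aemeasurable (hf1a j)) (he1 _)
  have hfe2 : ∀ j, (fun ω => f2 j (Z ω)) =ᵐ[μ]
      μ[fun ω' => kY (t j).2 (Y ω') | MeasurableSpace.comap Z inferInstance] := fun j =>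
    Filter.EventuallyEq.trans (ae_of_ae_map hZ.aemeasurable (hf2a j)) (he2 _)
  have habs : ∀ a b : ℝ, |a| ≤ C → |b| ≤ C → |a - b| ≤ 2 * C := fun a b ha hb => by
    rw [abs_le] at *
    constructor <;> linarith [ha.1, ha.2, hb.1, hb.2]
  have hN1 : ∀ j, Noise (μ.map fun ω => ((X ω, Z ω), Y ω))
      (fun v : ((Fin dx → ℝ) × (Fin dz → ℝ)) × (Fin dy → ℝ) => v.1)
      (fun v : ((Fin dx → ℝ) × (Fin dz → ℝ)) × (Fin dy → ℝ) => (v.2, v.1.2))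
      (fun v : ((Fin dx → ℝ) × (Fin dz → ℝ)) × (Fin dy → ℝ) => v.1.2)
      (fun p : (Fin dx → ℝ) × (Fin dz → ℝ) => p.2)
      (fun p : (Fin dy → ℝ) × (Fin dz → ℝ) => p.2)
      (fun p : (Fin dx → ℝ) × (Fin dz → ℝ) => kX (t j).1 p - f1 j p.2) (2 * C) := by
    intro j
    have bε : BM fun p : (Fin dx → ℝ) × (Fin dz → ℝ) => kX (t j).1 p - f1 j p.2 :=
      (bX j).sub ((bf1 j).comp measurable_snd)
    refine ⟨by fun_prop, by fun_prop, by fun_prop, by fun_prop, by fun_prop, fun v => rfl,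
      fun v => rfl, bε, fun v => habs _ _ (hCX _ _) (hf1b _ _), fun q hq => ?_⟩
    rw [integral_map hXZY.aemeasurable]
    · exact orth_of_condIndep μ X Y Z hX hY hZ hH0 (kX (t j).1) (bX j) (f1 j) (bf1 j) (hfe1 j) q hq
    · exact ((hq.comp (g := fun v : ((Fin dx → ℝ) × (Fin dz → ℝ)) × (Fin dy → ℝ) =>
        (v.2, v.1.2)) (by fun_prop)).mul (bε.comp measurable_fst)).1.aestronglyMeasurable
  have hN2 : ∀ j, Noise (μ.map fun ω => ((X ω, Z ω), Y ω))
      (fun v : ((Fin dx → ℝ) × (Fin dz → ℝ)) × (Fin dy → ℝ) => (v.2, v.1.2))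
      (fun v : ((Fin dx → ℝ) × (Fin dz → ℝ)) × (Fin dy → ℝ) => v.1)
      (fun v : ((Fin dx → ℝ) × (Fin dz → ℝ)) × (Fin dy → ℝ) => v.1.2)
      (fun p : (Fin dy → ℝ) × (Fin dz → ℝ) => p.2)
      (fun p : (Fin dx → ℝ) × (Fin dz → ℝ) => p.2)
      (fun p : (Fin dy → ℝ) × (Fin dz → ℝ) => (fun p : (Fin dy → ℝ) × (Fin dz → ℝ) => kY (t j).2 p.1) p - f2 j p.2) (2 * C) := by
    intro j
    have bY2 : BM fun p : (Fin dy → ℝ) × (Fin dz → ℝ) => kY (t j).2 p.1 :=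
      (bY j).comp measurable_fst
    have bε : BM fun p : (Fin dy → ℝ) × (Fin dz → ℝ) => kY (t j).2 p.1 - f2 j p.2 :=
      bY2.sub ((bf2 j).comp measurable_snd)
    refine ⟨by fun_prop, by fun_prop, by fun_prop, by fun_prop, by fun_prop, fun v => rfl,
      fun v => rfl, bε, fun v => habs _ _ (hCY _ _) (hf2b _ _), fun q hq => ?_⟩
    rw [integral_map hXZY.aemeasurable]
    · exact orth_of_condIndep μ Y X Z hY hX hZ hH0.symm
        (fun p : (Fin dy → ℝ) × (Fin dz → ℝ) => kY (t j).2 p.1) bY2 (f2 j) (bf2 j) (hfe2 j) q hq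
    · exact ((hq.comp measurable_fst).mul
        (bε.comp (g := fun v : ((Fin dx → ℝ) × (Fin dz → ℝ)) × (Fin dy → ℝ) =>
          (v.2, v.1.2)) (by fun_prop))).1.aestronglyMeasurable
  haveI hτp : IsProbabilityMeasure (μ.map fun ω (i : ℕ) => ((xS i ω, zS i ω), yS i ω)) :=
    Measure.isProbabilityMeasure_map hWm.aemeasurable
  haveI hρp : IsProbabilityMeasure (μ.map fun ω => ((X ω, Z ω), Y ω)) :=
    Measure.isProbabilityMeasure_map hXZY.aemeasurable
  haveI hPp : IsProbabilityMeasure (μ.map Z) := Measure.isProbabilityMeasure_map hZ.aemeasurable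
  have hτind := iIndep_coord μ (fun i ω => ((xS i ω, zS i ω), yS i ω)) hDm hiid
  have hτlaw : ∀ i : ℕ, (μ.map fun ω (i : ℕ) => ((xS i ω, zS i ω), yS i ω)).map (fun y => y i) =
      μ.map fun ω => ((X ω, Z ω), Y ω) := by
    intro i
    rw [Measure.map_map (measurable_pi_apply i) hWm, ← hlaw i]
    rfl
  have hρζ : (μ.map fun ω => ((X ω, Z ω), Y ω)).map
      (fun v : ((Fin dx → ℝ) × (Fin dz → ℝ)) × (Fin dy → ℝ) => v.1.2) = μ.map Z := by
    rw [Measure.map_map (by fun_prop) hXZY]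
    rfl
  have hzlaw : μ.map (zS 0) = μ.map Z := by
    rw [← hρζ, ← hlaw 0, Measure.map_map (by fun_prop) (hDm 0)]
    rfl
  have hrem := fun (j : Fin J) (c : ℝ) (hc : 0 < c) =>
    remainder_negligible hτind hτlaw (kZ1 j) (kZ2 j) (hkZ1symm j) (hkZ2symm j) (hkZ1pd j)
      (hkZ2pd j) (hkZ1bdd j) (hkZ2bdd j) (hkZ1cont j) (hkZ2cont j) (μ.map Z) hρζ (L1 j) (L2 j)
      (Lβ1 j) (Lβ2 j) (hL1 j) (hL2 j) Q γ β hQ hγ0 hβ1 hβ2 (hA2 j).1 (hA2 j).2 (hLβ1 j) (hLβ2 j)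
      (e1 (t j).1) (e2 (t j).2) (f1 j) (f2 j) (hf1m j) (hf2m j) (hf1a j) (hf2a j) (he1mem _)
      (he2mem _) (hA3r1 j _) (hA3r2 j _) (kX (t j).1)
      (fun p : (Fin dy → ℝ) × (Fin dz → ℝ) => kY (t j).2 p.1) (hN1 j) (hN2 j) rn hrn hro c hc
  have hφm : Measurable fun (v : ((Fin dx → ℝ) × (Fin dz → ℝ)) × (Fin dy → ℝ)) (j : Fin J) =>
      (kX (t j).1 v.1 - f1 j v.1.2) * (kY (t j).2 v.2 - f2 j v.1.2) := by
    refine measurable_pi_lambda _ fun j => ?_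
    exact (((hkXm _).comp measurable_fst).sub ((hf1m j).comp (measurable_snd.comp measurable_fst))).mul
      (((hkYm _).comp measurable_snd).sub ((hf2m j).comp (measurable_snd.comp measurable_fst)))
  refine abstract_limit μ ν hν
    (fun i ω j => (kX (t j).1 (xS i ω, zS i ω) - f1 j (zS i ω)) *
      (kY (t j).2 (yS i ω) - f2 j (zS i ω)))
    (fun i => hφm.comp (hDm i)) (2 * C * (2 * C)) ?_
    (hiid.comp (fun _ => fun (v : ((Fin dx → ℝ) × (Fin dz → ℝ)) × (Fin dy → ℝ)) (j : Fin J) =>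
      (kX (t j).1 v.1 - f1 j v.1.2) * (kY (t j).2 v.2 - f2 j v.1.2)) fun _ => hφm) ?_ ?_
    (covMat μ kX kY e1 e2 xS zS yS t) ?_ hSigmaInv
    (fun n i ω j => uTildeStat kX kY kZ1 kZ2 xS zS yS t (rn n)
      ((rn n : ℝ) ^ (-(1 / (1 + γ)))) i j ω) ?_ ?_ ?_ δ hδpos hδ
  · intro n ω j
    rw [abs_mul]
    exact mul_le_mul (habs _ _ (hCX _ _) (hf1b _ _)) (habs _ _ (hCY _ _) (hf2b _ _))
      (abs_nonneg _) (by linarith)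
  · intro i
    have h0 : IdentDistrib (fun ω => ((xS i ω, zS i ω), yS i ω))
        (fun ω => ((xS 0 ω, zS 0 ω), yS 0 ω)) μ μ :=
      ⟨(hDm i).aemeasurable, (hDm 0).aemeasurable, by rw [hlaw i, hlaw 0]⟩
    exact h0.comp hφm
  · intro j
    have hm : Measurable fun v : ((Fin dx → ℝ) × (Fin dz → ℝ)) × (Fin dy → ℝ) =>
        (kX (t j).1 v.1 - f1 j v.1.2) * (kY (t j).2 v.2 - f2 j v.1.2) :=
      (measurable_pi_apply j).comp hφm
    have h0 := (hN2 j).orth (fun p => kX (t j).1 p - f1 j p.2) (hN1 j).bε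
    rw [← hlaw 0, integral_map (hDm 0).aemeasurable hm.aestronglyMeasurable] at h0
    exact h0
  · intro a b
    have hz1 : ∀ j, ∀ᵐ ω ∂μ, f1 j (zS 0 ω) = e1 (t j).1 (zS 0 ω) := fun j =>
      ae_of_ae_map (hzS 0).aemeasurable (by rw [hzlaw]; exact hf1a j)
    have hz2 : ∀ j, ∀ᵐ ω ∂μ, f2 j (zS 0 ω) = e2 (t j).2 (zS 0 ω) := fun j =>
      ae_of_ae_map (hzS 0).aemeasurable (by rw [hzlaw]; exact hf2a j)
    refine integral_congr_ae ?_
    filter_upwards [hz1 a, hz1 b, hz2 a, hz2 b] with ω h1 h2 h3 h4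
    simp only [uStat, h1, h2, h3, h4]
  · intro n i j
    have hXZi : ∀ l, Measurable fun ω => kX (t j).1 (xS l ω, zS l ω) := fun l =>
      (hkXm _).comp ((hxS l).prodMk (hzS l))
    have hYi : ∀ l, Measurable fun ω => kY (t j).2 (yS l ω) := fun l => (hkYm _).comp (hyS l)
    exact ((hXZi i).sub (measurable_rls (kZ1 j) (hkZ1cont j).measurable zS hzS _ hXZi _ _ i)).mul
      ((hYi i).sub (measurable_rls (kZ2 j) (hkZ2cont j).measurable zS hzS _ hYi _ _ i))
  · intro j c hc
    exact tendsto_of_tendsto_of_tendsto_of_le_of_le tendsto_const_nhds (hrem j c hc).1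
      (fun n => bot_le) (fun n => Measure.le_map_apply hWm.aemeasurable _)
  · intro j c hc
    exact tendsto_of_tendsto_of_tendsto_of_le_of_le tendsto_const_nhds (hrem j c hc).2
      (fun n => bot_le) (fun n => Measure.le_map_apply hWm.aemeasurable _)
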